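/- arXiv:0904.1395 — 2 statements merged into one kernel-verified Lean document; each statement's English description precedes it below -/
import Mathlib

section
/- (Noether's theorem) The Cremona group Bir(ℙ²), identified with the group of ℂ-algebra automorphisms of the field ℂ(x,y), is generated by the Cremona involution σ (the automorphism determined by x ↦ 1/x, y ↦ 1/y) together with the subgroup of projective linear transformations, i.e. the automorphisms determined by x ↦ (a₀x+a₁y+a₂)/(c₀x+c₁y+c₂), y ↦ (b₀x+b₁y+b₂)/(c₀x+c₁y+c₂) for an invertible 3×3 complex matrix with rows (a₀,a₁,a₂), (b₀,b₁,b₂), (c₀,c₁,c₂). -/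
open MvPolynomial

noncomputable section

/-- The field `ℂ(x,y)` of rational functions in two variables. -/
abbrev K2 : Type := FractionRing (MvPolynomial (Fin 2) ℂ)

/-- The Cremona group, identified with the group of `ℂ`-algebra automorphisms
of `ℂ(x,y)`. -/
abbrev Cremona : Type := K2 ≃ₐ[ℂ] K2

/-- The element `x` of `ℂ(x,y)`. -/
def xx : K2 := algebraMap (MvPolynomial (Fin 2) ℂ) K2 (X 0)

/-- The element `y` of `ℂ(x,y)`. -/
def yy : K2 := algebraMap (MvPolynomial (Fin 2) ℂ) K2 (X 1)

/-- The constant `a ∈ ℂ` viewed in `ℂ(x,y)`. -/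
def cc (a : ℂ) : K2 := algebraMap ℂ K2 a

/-- The set of projective linear transformations inside the Cremona group: the
automorphisms `x ↦ (a₀x+a₁y+a₂)/(c₀x+c₁y+c₂)`, `y ↦ (b₀x+b₁y+b₂)/(c₀x+c₁y+c₂)`
coming from an invertible `3×3` complex matrix. -/
def projLinear : Set Cremona :=
  {f | ∃ M : GL (Fin 3) ℂ,
    f xx = (cc ((M : Matrix (Fin 3) (Fin 3) ℂ) 0 0) * xx +
            cc ((M : Matrix (Fin 3) (Fin 3) ℂ) 0 1) * yy +
            cc ((M : Matrix (Fin 3) (Fin 3) ℂ) 0 2)) /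
           (cc ((M : Matrix (Fin 3) (Fin 3) ℂ) 2 0) * xx +
            cc ((M : Matrix (Fin 3) (Fin 3) ℂ) 2 1) * yy +
            cc ((M : Matrix (Fin 3) (Fin 3) ℂ) 2 2)) ∧
    f yy = (cc ((M : Matrix (Fin 3) (Fin 3) ℂ) 1 0) * xx +
            cc ((M : Matrix (Fin 3) (Fin 3) ℂ) 1 1) * yy +
            cc ((M : Matrix (Fin 3) (Fin 3) ℂ) 1 2)) /
           (cc ((M : Matrix (Fin 3) (Fin 3) ℂ) 2 0) * xx +
            cc ((M : Matrix (Fin 3) (Fin 3) ℂ) 2 1) * yy +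
            cc ((M : Matrix (Fin 3) (Fin 3) ℂ) 2 2))}

section AbsA
variable {F : Type*} [Field F] [Algebra ℂ F]

def mon (X Y : F) (e : ℤ × ℤ) : F := X ^ e.1 * Y ^ e.2

def VV (X Y : F) (S : Set (ℤ × ℤ)) : Submodule ℂ F := Submodule.span ℂ (mon X Y '' S)

def NN : Set (ℤ × ℤ) := {e | 0 ≤ e.1 ∧ 0 ≤ e.2}

def Ind (X Y : F) : Prop := ∀ p : MvPolynomial (Fin 2) ℂ, aeval ![X, Y] p = 0 → p = 0

lemma mon_mem {X Y : F} {S : Set (ℤ × ℤ)} {e : ℤ × ℤ} (h : e ∈ S) : mon X Y e ∈ VV X Y S :=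
  Submodule.subset_span ⟨e, h, rfl⟩

lemma VV_mono {X Y : F} {S T : Set (ℤ × ℤ)} (h : S ⊆ T) {P : F} (hP : P ∈ VV X Y S) :
    P ∈ VV X Y T :=
  Submodule.span_mono (Set.image_mono h) hP

lemma VV_move {X Y M : F} {S : Set (ℤ × ℤ)} {W : Submodule ℂ F}
    (h : ∀ e ∈ S, M * mon X Y e ∈ W) {P : F} (hP : P ∈ VV X Y S) : M * P ∈ W := by
  induction hP using Submodule.span_induction with
  | mem x hx => obtain ⟨e, he, rfl⟩ := hx; exact h e he
  | zero => simp
  | add x y _ _ hx hy => rw [mul_add]; exact W.add_mem hx hy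
  | smul c x _ hx => rw [mul_smul_comm]; exact W.smul_mem c hx

lemma VV_le {X Y : F} {S : Set (ℤ × ℤ)} {W : Submodule ℂ F}
    (h : ∀ e ∈ S, mon X Y e ∈ W) {P : F} (hP : P ∈ VV X Y S) : P ∈ W := by
  have := VV_move (M := 1) (W := W) (by simpa using h) hP
  simpa using this

lemma VV_split {X Y : F} {S : Set (ℤ × ℤ)} (T : Set (ℤ × ℤ)) {P : F} (hP : P ∈ VV X Y S) :
    ∃ P₁ ∈ VV X Y (S ∩ T), ∃ P₂ ∈ VV X Y (S \ T), P = P₁ + P₂ := by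
  have h : P ∈ VV X Y (S ∩ T) ⊔ VV X Y (S \ T) := by
    unfold VV
    rw [← Submodule.span_union, ← Set.image_union, Set.inter_union_sdiff]
    exact hP
  obtain ⟨a, ha, b, hb, hab⟩ := Submodule.mem_sup.1 h
  exact ⟨a, ha, b, hb, hab.symm⟩

lemma VV_swap {X Y : F} {S T : Set (ℤ × ℤ)} (h : ∀ e ∈ S, (e.2, e.1) ∈ T) {P : F}
    (hP : P ∈ VV X Y S) : P ∈ VV Y X T := by
  refine VV_le (fun e he => ?_) hP
  have := mon_mem (X := Y) (Y := X) (h e he)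
  simpa [mon, mul_comm] using this

lemma VV_iff {X Y : F} {S : Set (ℤ × ℤ)} (hS : S ⊆ NN) {P : F} :
    P ∈ VV X Y S ↔ ∃ p : MvPolynomial (Fin 2) ℂ,
      (∀ d ∈ p.support, ((d 0 : ℤ), (d 1 : ℤ)) ∈ S) ∧ aeval ![X, Y] p = P := by
  constructor
  · intro hP
    have : P ∈ Submodule.map (aeval ![X, Y]).toLinearMap
        (restrictSupport ℂ {d : Fin 2 →₀ ℕ | ((d 0 : ℤ), (d 1 : ℤ)) ∈ S}) := by
      refine VV_le (fun e he => ?_) hP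
      obtain ⟨h1, h2⟩ := hS he
      obtain ⟨i, j⟩ := e
      dsimp only at h1 h2
      lift i to ℕ using h1
      lift j to ℕ using h2
      refine ⟨monomial (Finsupp.single 0 i + Finsupp.single 1 j) 1, ?_, ?_⟩
      · simp only [SetLike.mem_coe, mem_restrictSupport_iff]
        intro d hd
        have := support_monomial_subset hd
        simp only [Finset.mem_singleton] at this
        subst this
        simpa using he
      · rw [AlgHom.toLinearMap_apply, aeval_monomial, Finsupp.prod_fintype _ _ (by simp)]
        simp [mon]
    obtain ⟨p, hp, rfl⟩ := this
    refine ⟨p, fun d hd => ?_, rfl⟩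
    simp only [SetLike.mem_coe, mem_restrictSupport_iff] at hp
    exact hp hd
  · rintro ⟨p, hp, rfl⟩
    rw [aeval_def, eval₂_eq']
    refine Submodule.sum_mem _ fun d hd => ?_
    have := Submodule.smul_mem (VV X Y S) (coeff d p) (mon_mem (X := X) (Y := Y) (hp d hd))
    simpa [Algebra.smul_def, mon] using this

lemma VV_inter {X Y : F} (hI : Ind X Y) {S T : Set (ℤ × ℤ)} (hS : S ⊆ NN) (hT : T ⊆ NN) {P : F}
    (h1 : P ∈ VV X Y S) (h2 : P ∈ VV X Y T) : P ∈ VV X Y (S ∩ T) := by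
  obtain ⟨p, hp, e1⟩ := (VV_iff hS).1 h1
  obtain ⟨q, hq, e2⟩ := (VV_iff hT).1 h2
  have : p = q := by
    rw [← sub_eq_zero]; apply hI; rw [map_sub, e1, e2, sub_self]
  subst this
  exact (VV_iff (Set.inter_subset_left.trans hS)).2 ⟨p, fun d hd => ⟨hp d hd, hq d hd⟩, e1⟩

lemma VV_transX {X Y : F} {S : Set (ℤ × ℤ)} (hS : S ⊆ NN)
    (hc : ∀ e ∈ S, ∀ i, 0 ≤ i → i ≤ e.1 → (i, e.2) ∈ S) (α : ℂ) {P : F}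
    (hP : P ∈ VV X Y S) : P ∈ VV (X - algebraMap ℂ F α) Y S := by
  refine VV_le (fun e he => ?_) hP
  obtain ⟨h1, h2⟩ := hS he
  obtain ⟨i, j⟩ := e
  dsimp only at h1 h2
  lift i to ℕ using h1
  have : mon X Y ((i : ℤ), j) = ∑ k ∈ Finset.range (i + 1), (α ^ (i - k) * (i.choose k : ℂ)) •
      mon (X - algebraMap ℂ F α) Y ((k : ℤ), j) := by
    have h := add_pow (X - algebraMap ℂ F α) (algebraMap ℂ F α) i
    rw [sub_add_cancel] at h
    simp only [mon, zpow_natCast, h, Finset.sum_mul, Algebra.smul_def, map_mul, map_pow, map_natCast]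
    refine Finset.sum_congr rfl fun k _ => by ring
  rw [this]
  refine Submodule.sum_mem _ fun k hk => Submodule.smul_mem _ _ (mon_mem (hc _ he k (by positivity) ?_))
  have := Finset.mem_range.1 hk
  simp; omega

lemma VV_transY {X Y : F} {S : Set (ℤ × ℤ)} (hS : S ⊆ NN)
    (hc : ∀ e ∈ S, ∀ j, 0 ≤ j → j ≤ e.2 → (e.1, j) ∈ S) (α : ℂ) {P : F}
    (hP : P ∈ VV X Y S) : P ∈ VV X (Y - algebraMap ℂ F α) S := by
  have h1 : P ∈ VV Y X {e | (e.2, e.1) ∈ S} := VV_swap (fun e he => he) hP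
  have h2 := VV_transX (S := {e | (e.2, e.1) ∈ S}) (α := α) (fun e he => ⟨(hS he).2, (hS he).1⟩)
    (fun e he i h0 hi => hc (e.2, e.1) he i h0 hi) h1
  exact VV_swap (fun e he => he) h2

/-- points -/
lemma VV_poly {X Y : F} {S : Set (ℤ × ℤ)} (hS : ∀ e ∈ S, e.1 = 0 ∧ 0 ≤ e.2) {P : F}
    (hP : P ∈ VV X Y S) : ∃ p : Polynomial ℂ, Polynomial.aeval Y p = P := by
  have : P ∈ Subalgebra.toSubmodule (Polynomial.aeval Y : Polynomial ℂ →ₐ[ℂ] F).range := by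
    refine VV_le (fun e he => ?_) hP
    obtain ⟨h1, h2⟩ := hS e he
    obtain ⟨i, j⟩ := e
    dsimp only at h1 h2
    subst h1
    lift j to ℕ using h2
    exact ⟨Polynomial.X ^ j, by simp [mon]⟩
  exact this

section val
variable {v : Valuation F (WithZero (Multiplicative ℤ))} (hv : ∀ c : ℂ, v (algebraMap ℂ F c) ≤ 1)
include hv

lemma val_const {c : ℂ} (hc : c ≠ 0) : v (algebraMap ℂ F c) = 1 := by
  refine le_antisymm (hv c) ?_
  have h := hv c⁻¹
  rw [map_inv₀, map_inv₀] at h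
  have h0 : v (algebraMap ℂ F c) ≠ 0 := by simpa using hc
  exact (inv_le_one₀ (zero_lt_iff.2 h0)).1 h

lemma const_zero {c : ℂ} (hc : v (algebraMap ℂ F c) < 1) : c = 0 := by
  by_contra h; exact hc.ne (val_const hv h)

lemma VV_val {X Y : F} {S : Set (ℤ × ℤ)} {γ : WithZero (Multiplicative ℤ)}
    (h : ∀ e ∈ S, v (mon X Y e) ≤ γ) {P : F} (hP : P ∈ VV X Y S) : v P ≤ γ := by
  induction hP using Submodule.span_induction with
  | mem x hx => obtain ⟨e, he, rfl⟩ := hx; exact h e he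
  | zero => simp
  | add x y _ _ hx hy => exact (v.map_add x y).trans (max_le hx hy)
  | smul c x _ hx =>
    rw [Algebra.smul_def, map_mul]
    exact (mul_le_mul' (hv c) hx).trans (by simp)

lemma VV_val_lt {X Y : F} {S : Set (ℤ × ℤ)}
    (h : ∀ e ∈ S, v (mon X Y e) < 1) {P : F} (hP : P ∈ VV X Y S) : v P < 1 := by
  induction hP using Submodule.span_induction with
  | mem x hx => obtain ⟨e, he, rfl⟩ := hx; exact h e he
  | zero => simp
  | add x y _ _ hx hy => exact (v.map_add x y).trans_lt (max_lt hx hy)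
  | smul c x _ hx =>
    rw [Algebra.smul_def, map_mul]
    exact (mul_le_mul' (hv c) le_rfl).trans_lt (by simpa using hx)

def Cent (v : Valuation F (WithZero (Multiplicative ℤ))) (X : F) : Prop :=
  ∃ α : ℂ, v (X - algebraMap ℂ F α) < 1

omit hv in
lemma cent_of_lt {X : F} (h : v X < 1) : Cent v X := ⟨0, by simpa⟩

lemma poly_cent {Y : F} (hY : ¬ Cent v Y) (p : Polynomial ℂ)
    (h : v (Polynomial.aeval Y p) < 1) : p = 0 := by
  by_contra hp
  have hs := (IsAlgClosed.splits p)
  rw [hs.eq_prod_roots] at h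
  rw [map_mul, map_mul, Polynomial.aeval_C, val_const hv (by simpa using hp), one_mul] at h
  rw [map_multiset_prod, map_multiset_prod, Multiset.map_map, Multiset.map_map] at h
  refine h.not_ge (Multiset.one_le_prod_of_one_le fun z hz => ?_)
  obtain ⟨r, _, rfl⟩ := Multiset.mem_map.1 hz
  by_contra hlt
  exact hY ⟨r, by simpa using hlt⟩

/-- edge lemma -/
lemma edge {X Y : F} {S : Set (ℤ × ℤ)} (hS : S ⊆ NN) (hX : v X < 1) (hY : v Y ≤ 1)
    (hc : ¬ Cent v Y) {P : F} (hP : P ∈ VV X Y S) (h : v P < 1) :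
    P ∈ VV X Y (S ∩ {e | 1 ≤ e.1}) := by
  obtain ⟨P1, h1, P0, h0, rfl⟩ := VV_split {e | 1 ≤ e.1} hP
  have hv1 : v P1 < 1 := by
    refine VV_val_lt hv (fun e he => ?_) h1
    obtain ⟨he, h1⟩ := he
    obtain ⟨h0, h2⟩ := hS he
    obtain ⟨i, j⟩ := e
    simp only [Set.mem_ofPred_eq] at h0 h1 h2
    lift i to ℕ using h0
    lift j to ℕ using h2
    simp only [mon, zpow_natCast, map_mul, map_pow]
    refine (mul_le_mul' le_rfl (pow_le_one' hY j)).trans_lt ?_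
    rw [mul_one]
    exact pow_lt_one₀ zero_le hX (by omega)
  have hv0 : v P0 < 1 := by
    have : P0 = (P1 + P0) - P1 := by ring
    rw [this]
    exact (v.map_sub _ _).trans_lt (max_lt h hv1)
  obtain ⟨p, rfl⟩ := VV_poly (fun e he => by
    have h1 := hS he.1
    have h2 := he.2
    simp only [Set.mem_ofPred_eq, NN] at h1 h2
    omega) h0
  rw [poly_cent hv hc p hv0]
  simpa using h1
end val
end AbsA

section AbsB
variable {F : Type*} [Field F] [Algebra ℂ F]

def JJ (D E : Derivation ℂ F F) (X Y : F) : F := D X * E Y - E X * D Y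

lemma der_aeval (D : Derivation ℂ F F) (X Y : F) (p : MvPolynomial (Fin 2) ℂ) :
    D (aeval ![X, Y] p) = aeval ![X, Y] (pderiv 0 p) * D X + aeval ![X, Y] (pderiv 1 p) * D Y := by
  induction p using MvPolynomial.induction_on with
  | C a => simp
  | add p q hp hq => simp only [map_add, hp, hq]; ring
  | mul_X p i hp =>
    simp only [map_mul, Derivation.leibniz, hp, aeval_X, smul_eq_mul, map_add]
    fin_cases i <;> simp [pderiv_X] <;> ring

lemma ind_of_J {D E : Derivation ℂ F F} {X Y : F} (h : JJ D E X Y ≠ 0) : Ind X Y := by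
  have key : ∀ N : ℕ, ∀ p : MvPolynomial (Fin 2) ℂ, (∀ d : Fin 2 →₀ ℕ, N ≤ d 0 + d 1 → coeff d p = 0) →
      aeval ![X, Y] p = 0 → p = 0 := by
    intro N
    induction N with
    | zero => intro p hp _; ext d; simpa using hp d (Nat.zero_le _)
    | succ N ih =>
      intro p hp h0
      have h1 := der_aeval D X Y p
      have h2 := der_aeval E X Y p
      rw [h0, map_zero] at h1 h2
      have e0 : aeval ![X, Y] (pderiv 0 p) = 0 := by
        have : aeval ![X, Y] (pderiv 0 p) * JJ D E X Y = 0 := by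
          unfold JJ; linear_combination (-E Y) * h1 + D Y * h2
        exact (mul_eq_zero.1 this).resolve_right h
      have e1 : aeval ![X, Y] (pderiv 1 p) = 0 := by
        have : aeval ![X, Y] (pderiv 1 p) * JJ D E X Y = 0 := by
          unfold JJ; linear_combination (E X) * h1 - D X * h2
        exact (mul_eq_zero.1 this).resolve_right h
      have f0 := ih _ (fun d hd => by
        rw [coeff_pderiv, hp _ (by simp; omega), zero_mul]) e0
      have f1 := ih _ (fun d hd => by
        rw [coeff_pderiv, hp _ (by simp; omega), zero_mul]) e1
      have hC : ∀ d : Fin 2 →₀ ℕ, d ≠ 0 → coeff d p = 0 := by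
        intro d hd
        have : ∃ i, d i ≠ 0 := by
          by_contra hh; push Not at hh; exact hd (Finsupp.ext hh)
        obtain ⟨i, hi⟩ := this
        have hz : coeff (d - Finsupp.single i 1) (pderiv i p) = 0 := by
          fin_cases i
          · simp [f0]
          · simp [f1]
        rw [coeff_pderiv] at hz
        have hd' : d - Finsupp.single i 1 + Finsupp.single i 1 = d := by
          ext j
          by_cases hj : j = i
          · subst hj; simp; omega
          · simp [Ne.symm hj]
        rw [hd'] at hz
        refine (mul_eq_zero.1 hz).resolve_right ?_
        exact Nat.cast_add_one_ne_zero _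
      have hp' : p = C (coeff 0 p) := by
        ext d
        by_cases hd : d = 0
        · subst hd; simp
        · rw [hC d hd, coeff_C, if_neg (Ne.symm hd)]
      rw [hp', aeval_C] at h0
      rw [hp']
      have : coeff 0 p = 0 := by simpa using h0
      rw [this, C_0]
  intro p hp
  refine key (p.totalDegree + 1) p (fun d hd => ?_) hp
  apply coeff_eq_zero_of_totalDegree_lt
  have : ∑ i ∈ d.support, d i = d 0 + d 1 := by
    have := Finsupp.sum_fintype d (fun _ n => n) (by simp)
    simpa [Finsupp.sum] using this
  omega

section J
variable (D E : Derivation ℂ F F) (X Y : F)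

lemma J_trans (α β : ℂ) : JJ D E (X - algebraMap ℂ F α) (Y - algebraMap ℂ F β) = JJ D E X Y := by
  simp [JJ]

lemma J_swap : JJ D E Y X = - JJ D E X Y := by simp only [JJ]; ring

lemma J_div (hY : Y ≠ 0) : JJ D E (X / Y) Y = Y⁻¹ * JJ D E X Y := by
  simp only [JJ, Derivation.leibniz_div, smul_eq_mul]; field_simp; ring

lemma J_inv : JJ D E X⁻¹ Y = -(X⁻¹ ^ 2 * JJ D E X Y) := by
  simp only [JJ, Derivation.leibniz_inv, smul_eq_mul]; ring

lemma J_rot (hX : X ≠ 0) : JJ D E X⁻¹ (Y / X) = -(X⁻¹ ^ 3 * JJ D E X Y) := by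
  simp only [JJ, Derivation.leibniz_inv, Derivation.leibniz_div, smul_eq_mul]; field_simp; ring

lemma J_yflip (n : ℤ) :
    JJ D E (X * Y ^ (-n)) Y⁻¹ = -(Y ^ (-n) * Y⁻¹ ^ 2 * JJ D E X Y) := by
  simp only [JJ, Derivation.leibniz_inv, Derivation.leibniz, Derivation.leibniz_zpow, smul_eq_mul, zsmul_eq_mul]
  ring
end J

def MM (m : ℤ) : Set (ℤ × ℤ) := {e | 0 ≤ e.1 ∧ 0 ≤ e.2 ∧ m ≤ e.1 + e.2}

structure GoodV (D E : Derivation ℂ F F) (v : Valuation F (WithZero (Multiplicative ℤ)))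
    (κ : WithZero (Multiplicative ℤ)) : Prop where
  const : ∀ c : ℂ, v (algebraMap ℂ F c) ≤ 1
  jac : ∀ X Y : F, v X ≤ 1 → v Y ≤ 1 → v (JJ D E X Y) ≤ κ

def NFc (D E : Derivation ℂ F F) (v : Valuation F (WithZero (Multiplicative ℤ)))
    (κ : WithZero (Multiplicative ℤ)) (k l : ℕ) (N : ℕ) : Prop :=
  ∀ X Y P Q : F, JJ D E X Y ≠ 0 → v X ≤ 1 → v Y ≤ 1 → P ∈ VV X Y NN → Q ∈ VV X Y NN →
    v P ≤ v Q → Q ≠ 0 → WithZero.exp (-(N : ℤ)) ≤ v Q →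
    (v P < 1 → v Q < 1 → Cent v X ∧ Cent v Y) →
    (∀ (α β : ℂ) (m : ℕ), v (X - algebraMap ℂ F α) < 1 → v (Y - algebraMap ℂ F β) < 1 →
      P ∈ VV (X - algebraMap ℂ F α) (Y - algebraMap ℂ F β) (MM m) →
      Q ∈ VV (X - algebraMap ℂ F α) (Y - algebraMap ℂ F β) (MM m) → l * m ≤ k) →
    v (JJ D E X Y) ^ k ≤ κ ^ k * v Q ^ l

lemma lt_one_exp {x : WithZero (Multiplicative ℤ)} (h : x < 1) : x ≤ WithZero.exp (-1 : ℤ) := by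
  by_cases hx : x = 0
  · simp [hx]
  · rw [← WithZero.exp_log hx] at h ⊢
    rw [← WithZero.exp_zero, WithZero.exp_lt_exp] at h
    rw [WithZero.exp_le_exp]; omega

lemma pow_small {x : WithZero (Multiplicative ℤ)} (h : x < 1) {N : ℕ}
    (h1 : WithZero.exp (-((N + 1 : ℕ) : ℤ)) ≤ x ^ (N + 2)) : False := by
  have h2 : x ^ (N + 2) ≤ WithZero.exp (-1 : ℤ) ^ (N + 2) := pow_le_pow_left' (lt_one_exp h) _
  have h3 := h1.trans h2
  rw [← WithZero.exp_nsmul, WithZero.exp_le_exp] at h3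
  simp only [smul_neg, nsmul_eq_mul, mul_one] at h3
  push_cast at h3
  omega

set_option maxHeartbeats 1000000 in
lemma nf_step {D E : Derivation ℂ F F} {v : Valuation F (WithZero (Multiplicative ℤ))}
    {κ : WithZero (Multiplicative ℤ)} (hg : GoodV D E v κ) {k l N : ℕ} (ih : NFc D E v κ k l N)
    {X Y P Q : F} (hJ : JJ D E X Y ≠ 0) (hXY : v X ≤ v Y) (hY : v Y < 1)
    (hP : P ∈ VV X Y NN) (hQ : Q ∈ VV X Y NN) (hPQ : v P ≤ v Q) (hQ1 : v Q < 1) (hQ0 : Q ≠ 0)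
    (hN : WithZero.exp (-((N + 1 : ℕ) : ℤ)) ≤ v Q)
    (hB : ∀ m : ℕ, P ∈ VV X Y (MM m) → Q ∈ VV X Y (MM m) → l * m ≤ k) :
    v (JJ D E X Y) ^ k ≤ κ ^ k * v Q ^ l := by
  have hv := hg.const
  have hY0 : Y ≠ 0 := by
    rintro rfl; apply hJ; simp [JJ]
  have hvY0 : v Y ≠ 0 := by simpa using hY0
  have hMN : ∀ m, MM m ⊆ NN := fun m e he => ⟨he.1, he.2.1⟩
  -- values of elements of MM m
  have hval : ∀ m : ℕ, ∀ R ∈ VV X Y (MM m), v R ≤ v Y ^ m := by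
    intro m R hR
    refine VV_val hv (fun e he => ?_) hR
    obtain ⟨h1, h2, h3⟩ := he
    obtain ⟨i, j⟩ := e
    dsimp only at h1 h2 h3
    lift i to ℕ using h1
    lift j to ℕ using h2
    simp only [mon, zpow_natCast, map_mul, map_pow]
    calc v X ^ i * v Y ^ j ≤ v Y ^ i * v Y ^ j := by gcongr
      _ = v Y ^ (i + j) := (pow_add _ _ _).symm
      _ ≤ v Y ^ m := pow_le_pow_right_of_le_one' hY.le (by omega)
  -- maximal m
  have hex : ∃ m : ℕ, (P ∈ VV X Y (MM m) ∧ Q ∈ VV X Y (MM m)) ∧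
      ¬ (P ∈ VV X Y (MM (m + 1)) ∧ Q ∈ VV X Y (MM (m + 1))) := by
    by_contra hcon
    have hall : ∀ m : ℕ, P ∈ VV X Y (MM m) ∧ Q ∈ VV X Y (MM m) := by
      intro m
      induction m with
      | zero =>
        have : NN ⊆ MM ((0 : ℕ) : ℤ) := fun e he => ⟨he.1, he.2, by
          have h1 := he.1; have h2 := he.2; simp; omega⟩
        exact ⟨VV_mono this hP, VV_mono this hQ⟩
      | succ m ih => 
        rw [Nat.cast_succ]
        by_contra hh
        exact hcon ⟨m, ih, hh⟩
    have h1 := hval _ Q (hall (N + 2)).2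
    exact pow_small hY (hN.trans h1)
  obtain ⟨m, ⟨hPm, hQm⟩, hmax⟩ := hex
  have hm1 : m ≠ 0 := by
    rintro rfl
    have key : ∀ R ∈ VV X Y NN, v R < 1 → R ∈ VV X Y (MM 1) := by
      intro R hR hR1
      obtain ⟨R1, h1, R0, h0, rfl⟩ := VV_split (MM 1) hR
      have h1' : R1 ∈ VV X Y (MM 1) := VV_mono Set.inter_subset_right h1
      have hv1 : v R1 < 1 := (hval 1 _ (by simpa using h1')).trans_lt (by simpa using hY)
      have hv0 : v R0 < 1 := by
        have : R0 = (R1 + R0) - R1 := by ring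
        rw [this]
        exact (v.map_sub _ _).trans_lt (max_lt hR1 hv1)
      have hc : ∃ c : ℂ, algebraMap ℂ F c = R0 := by
        have : R0 ∈ Subalgebra.toSubmodule (⊥ : Subalgebra ℂ F) := by
          refine VV_le (fun e he => ?_) h0
          obtain ⟨⟨ha, hb⟩, hc⟩ := he
          obtain ⟨i, j⟩ := e
          simp only [MM, Set.mem_ofPred_eq] at ha hb hc
          have hi : i = 0 := by omega
          have hj : j = 0 := by omega
          subst hi hj
          simp [mon]
        simpa [Algebra.mem_bot] using this
      obtain ⟨c, rfl⟩ := hc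
      rw [const_zero hv hv0, map_zero, add_zero]
      exact h1'
    exact hmax ⟨by simpa using key P hP (hPQ.trans_lt hQ1), by simpa using key Q hQ hQ1⟩
  have hlm := hB m hPm hQm
  -- blow up
  set X' := X / Y with hX'
  have hXX : X = X' * Y := by rw [hX']; field_simp
  have hMne : (Y ^ m)⁻¹ ≠ 0 := by positivity
  have hmon : ∀ e : ℤ × ℤ, (Y ^ m)⁻¹ * mon X Y e = mon X' Y (e.1, e.1 + e.2 - m) := by
    intro e
    simp only [mon, hXX, mul_zpow]
    rw [zpow_sub₀ hY0, zpow_add₀ hY0, zpow_natCast]; field_simp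
  let T : Set (ℤ × ℤ) := {e | 0 ≤ e.1 ∧ 0 ≤ e.2 ∧ e.1 ≤ e.2 + m}
  have hTN : T ⊆ NN := fun e he => ⟨he.1, he.2.1⟩
  have hmv : ∀ R ∈ VV X Y (MM m), (Y ^ m)⁻¹ * R ∈ VV X' Y T := by
    intro R hR
    refine VV_move (fun e he => ?_) hR
    rw [hmon]
    apply mon_mem
    obtain ⟨h1, h2, h3⟩ := he
    refine ⟨h1, ?_, ?_⟩ <;> dsimp only <;> omega
  have hback : ∀ R, (Y ^ m)⁻¹ * R ∈ VV X' Y (T ∩ {e | 1 ≤ e.2}) → R ∈ VV X Y (MM (m + 1)) := by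
    intro R hR
    have : Y ^ m * ((Y ^ m)⁻¹ * R) ∈ VV X Y (MM (m + 1)) := by
      refine VV_move (fun e he => ?_) hR
      obtain ⟨⟨h1, h2, h3⟩, h4⟩ := he
      have : Y ^ m * mon X' Y e = mon X Y (e.1, e.2 - e.1 + m) := by
        have := hmon (e.1, e.2 - e.1 + m)
        rw [show e.1 + (e.2 - e.1 + (m : ℤ)) - m = e.2 by ring] at this
        rw [← this]; field_simp
      rw [this]
      apply mon_mem
      simp only [Set.mem_ofPred_eq] at h4
      refine ⟨h1, ?_, ?_⟩ <;> dsimp only <;> omega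
    rwa [mul_inv_cancel_left₀ (by positivity)] at this
  set P' := (Y ^ m)⁻¹ * P with hP'
  set Q' := (Y ^ m)⁻¹ * Q with hQ'
  have hP'T := hmv P hPm
  have hQ'T := hmv Q hQm
  have hvX' : v X' ≤ 1 := by
    rw [hX', map_div₀]
    exact (div_le_one₀ (zero_lt_iff.2 hvY0)).2 hXY
  have hJ' : JJ D E X' Y = Y⁻¹ * JJ D E X Y := J_div D E X Y hY0
  have hJ'0 : JJ D E X' Y ≠ 0 := by rw [hJ']; exact mul_ne_zero (inv_ne_zero hY0) hJ
  have hI := ind_of_J hJ'0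
  have hQQ : v Q = v Y ^ m * v Q' := by
    rw [hQ', map_mul, map_inv₀, map_pow, mul_inv_cancel_left₀ (pow_ne_zero _ hvY0)]
  have hmain := ih X' Y P' Q' hJ'0 hvX' hY.le (VV_mono hTN hP'T) (VV_mono hTN hQ'T)
    (by rw [hP', hQ', map_mul, map_mul]; gcongr) (mul_ne_zero hMne hQ0) ?_ ?_ ?_
  · -- conclude
    have e1 : v (JJ D E X Y) = v Y * v (JJ D E X' Y) := by
      rw [hJ', map_mul, map_inv₀, mul_inv_cancel_left₀ hvY0]
    rw [e1, hQQ, mul_pow, mul_pow, ← pow_mul]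
    calc v Y ^ k * v (JJ D E X' Y) ^ k ≤ v Y ^ (m * l) * (κ ^ k * v Q' ^ l) := by
          gcongr ?_ * ?_
          exact pow_le_pow_right_of_le_one' hY.le (by rw [mul_comm]; exact hlm)
      _ = _ := by rw [mul_left_comm]
  · -- value
    have h1 : v Q ≤ WithZero.exp (-1 : ℤ) * v Q' := by
      rw [hQQ]; gcongr
      calc v Y ^ m ≤ v Y ^ 1 := pow_le_pow_right_of_le_one' hY.le (by omega)
        _ ≤ _ := by rw [pow_one]; exact lt_one_exp hY
    have h2 : WithZero.exp (-(N : ℤ)) = WithZero.exp (1 : ℤ) * WithZero.exp (-((N + 1 : ℕ) : ℤ)) := by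
      rw [← WithZero.exp_add]; congr 1; push_cast; ring
    rw [h2]
    calc _ ≤ WithZero.exp (1 : ℤ) * (WithZero.exp (-1 : ℤ) * v Q') := by gcongr; exact hN.trans h1
      _ = v Q' := by rw [← mul_assoc, ← WithZero.exp_add]; simp
  · -- centre
    intro hp1 hq1
    refine ⟨?_, cent_of_lt hY⟩
    by_contra hc
    have hsw : ∀ R ∈ VV X' Y T, v R < 1 → R ∈ VV X' Y (T ∩ {e | 1 ≤ e.2}) := by
      intro R hR hR1
      have h1 : R ∈ VV Y X' {e | (e.2, e.1) ∈ T} := VV_swap (fun e he => he) hR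
      have h2 := edge hv (S := {e | (e.2, e.1) ∈ T}) (fun e he => ⟨he.2.1, he.1⟩) hY hvX' hc h1 hR1
      exact VV_swap (T := T ∩ {e | 1 ≤ e.2}) (fun e he => And.intro he.1 he.2) h2
    exact hmax ⟨hback P (hsw P' hP'T hp1), hback Q (hsw Q' hQ'T hq1)⟩
  · -- multiplicity
    intro α β m' hα hβ hPm' hQm'
    have hβ0 : β = 0 := by
      apply const_zero hv
      have : algebraMap ℂ F β = Y - (Y - algebraMap ℂ F β) := by ring
      rw [this]
      exact (v.map_sub _ _).trans_lt (max_lt hY hβ)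
    subst hβ0
    rw [map_zero, sub_zero] at hPm' hQm'
    have hmm : m' ≤ m := by
      by_contra hlt
      push Not at hlt
      set X2 := X' - algebraMap ℂ F α with hX2
      have hI2 : Ind X2 Y := by
        apply ind_of_J (D := D) (E := E)
        have := J_trans D E X' Y α 0
        rw [map_zero, sub_zero] at this
        rw [hX2, this]; exact hJ'0
      have key : ∀ R, R ∈ VV X' Y T → R ∈ VV X2 Y (MM m') → R ∈ VV X' Y (T ∩ {e | 1 ≤ e.2}) := by
        intro R hR hR'
        let U : Set (ℤ × ℤ) := {e | 0 ≤ e.1 ∧ 0 ≤ e.2 ∧ (e.1 ≤ m ∨ 1 ≤ e.2)}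
        have h1 : R ∈ VV X2 Y T := VV_transX hTN (fun e he i h0 hi => by
          obtain ⟨h1, h2, h3⟩ := he
          refine ⟨h0, h2, ?_⟩; dsimp only; omega) α hR
        have h3 := VV_inter hI2 hTN (hMN m') h1 hR'
        have h4 : R ∈ VV X2 Y {e | 0 ≤ e.1 ∧ 1 ≤ e.2} := VV_mono (fun e he => by
          obtain ⟨⟨h1, h2, h3⟩, ⟨h4, h5, h6⟩⟩ := he
          refine ⟨h1, ?_⟩; omega) h3
        have h5 := VV_transX (X := X2) (Y := Y) (S := {e | 0 ≤ e.1 ∧ 1 ≤ e.2})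
          (fun e he => ⟨he.1, by have := he.2; omega⟩)
          (fun e he i h0 hi => ⟨h0, he.2⟩) (-α) h4
        have h6 : X2 - algebraMap ℂ F (-α) = X' := by rw [hX2, map_neg]; ring
        rw [h6] at h5
        refine VV_mono (T := T ∩ {e | 1 ≤ e.2}) (fun e he => And.intro he.1 he.2.2)
          (VV_inter hI hTN (fun e he => ⟨he.1, by have := he.2; omega⟩) hR h5)
      exact hmax ⟨hback P (key P' hP'T hPm'), hback Q (key Q' hQ'T hQm')⟩
    exact (Nat.mul_le_mul_left l hmm).trans hlm

theorem nf_local {D E : Derivation ℂ F F} {v : Valuation F (WithZero (Multiplicative ℤ))}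
    {κ : WithZero (Multiplicative ℤ)} (hg : GoodV D E v κ) (k l N : ℕ) : NFc D E v κ k l N := by
  have hv := hg.const
  have hbase : ∀ X Y Q : F, v X ≤ 1 → v Y ≤ 1 → 1 ≤ v Q → v (JJ D E X Y) ^ k ≤ κ ^ k * v Q ^ l := by
    intro X Y Q hX hY hQ
    calc v (JJ D E X Y) ^ k ≤ κ ^ k := by gcongr; exact hg.jac X Y hX hY
      _ ≤ κ ^ k * v Q ^ l := le_mul_of_one_le_right' (one_le_pow_of_one_le' hQ l)
  induction N with
  | zero =>
    intro X Y P Q hJ hX hY hP hQ hPQ hQ0 hN hA hB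
    exact hbase X Y Q hX hY (by simpa using hN)
  | succ N ih =>
    intro X Y P Q hJ hX hY hP hQ hPQ hQ0 hN hA hB
    by_cases hQ1 : 1 ≤ v Q
    · exact hbase X Y Q hX hY hQ1
    push Not at hQ1
    obtain ⟨⟨α, hα⟩, ⟨β, hβ⟩⟩ := hA (hPQ.trans_lt hQ1) hQ1
    have hB' := fun m => hB α β m hα hβ
    rw [← J_trans D E X Y α β] at hJ ⊢
    have tr : ∀ R ∈ VV X Y NN, R ∈ VV (X - algebraMap ℂ F α) (Y - algebraMap ℂ F β) NN := by
      intro R hR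
      exact VV_transY (fun e he => he) (fun e he j h0 hj => ⟨he.1, h0⟩) β
        (VV_transX (fun e he => he) (fun e he j h0 hj => ⟨h0, he.2⟩) α hR)
    have sw : ∀ (A B R : F) (m : ℤ), R ∈ VV A B (MM m) → R ∈ VV B A (MM m) := fun A B R m hR =>
      VV_swap (S := MM m) (T := MM m) (fun e he => ⟨he.2.1, he.1, by have := he.2.2; dsimp only; omega⟩) hR
    have swN : ∀ (A B R : F), R ∈ VV A B NN → R ∈ VV B A NN := fun A B R hR =>
      VV_swap (S := NN) (T := NN) (fun e he => ⟨he.2, he.1⟩) hR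
    rcases le_total (v (X - algebraMap ℂ F α)) (v (Y - algebraMap ℂ F β)) with h | h
    · exact nf_step hg ih hJ h hβ (tr P hP) (tr Q hQ) hPQ hQ1 hQ0 hN hB'
    · rw [J_swap] at hJ ⊢
      rw [Valuation.map_neg]
      exact nf_step hg ih (by simpa using hJ) h hα (swN _ _ _ (tr P hP)) (swN _ _ _ (tr Q hQ)) hPQ hQ1
        hQ0 hN (fun m h1 h2 => hB' m (sw _ _ _ _ h1) (sw _ _ _ _ h2))
end AbsB

section AbsC
variable {F : Type*} [Field F] [Algebra ℂ F]

abbrev Vl (F : Type*) [Field F] := Valuation F (WithZero (Multiplicative ℤ))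

def C1 (v : Vl F) (X : F) : Prop := v X = 1 ∧ Cent v X

lemma C1_inv {v : Vl F} (hv : ∀ c : ℂ, v (algebraMap ℂ F c) ≤ 1) {X : F} (h : C1 v X) :
    C1 v X⁻¹ := by
  obtain ⟨h1, α, hα⟩ := h
  refine ⟨by simp [h1], α⁻¹, ?_⟩
  have hα0 : α ≠ 0 := by
    rintro rfl; simp [h1] at hα
  have hX0 : X ≠ 0 := by rintro rfl; simp at h1
  have hA0 : algebraMap ℂ F α ≠ 0 := by simpa using hα0
  have : X⁻¹ - algebraMap ℂ F α⁻¹ = -((X - algebraMap ℂ F α) * (X⁻¹ * (algebraMap ℂ F α)⁻¹)) := by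
    rw [map_inv₀]; field_simp; ring
  rw [this, Valuation.map_neg, map_mul, map_mul, map_inv₀, map_inv₀, h1, val_const hv hα0]
  simpa using hα

lemma C1_mul {v : Vl F} (hv : ∀ c : ℂ, v (algebraMap ℂ F c) ≤ 1) {X Y : F} (h : C1 v X)
    (h' : C1 v Y) : C1 v (X * Y) := by
  obtain ⟨h1, α, hα⟩ := h
  obtain ⟨h2, β, hβ⟩ := h'
  refine ⟨by simp [h1, h2], α * β, ?_⟩
  have : X * Y - algebraMap ℂ F (α * β) = X * (Y - algebraMap ℂ F β) +
      algebraMap ℂ F β * (X - algebraMap ℂ F α) := by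
    rw [map_mul]; ring
  rw [this]
  refine (v.map_add _ _).trans_lt (max_lt ?_ ?_)
  · rw [map_mul, h1, one_mul]; exact hβ
  · rw [map_mul]; exact (mul_le_mul' (hv β) le_rfl).trans_lt (by simpa using hα)

lemma C1_zpow {v : Vl F} (hv : ∀ c : ℂ, v (algebraMap ℂ F c) ≤ 1) {X : F} (h : C1 v X) (n : ℤ) :
    C1 v (X ^ n) := by
  have hp : ∀ k : ℕ, C1 v (X ^ k) := by
    intro k
    induction k with
    | zero => exact ⟨by simp, 1, by simp⟩
    | succ k ih => rw [pow_succ]; exact C1_mul hv ih h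
  obtain ⟨k, rfl | rfl⟩ := Int.eq_nat_or_neg n
  · rw [zpow_natCast]; exact hp k
  · rw [zpow_neg, zpow_natCast]; exact C1_inv hv (hp k)

lemma C1_mon {v : Vl F} (hv : ∀ c : ℂ, v (algebraMap ℂ F c) ≤ 1) {X Y : F} (h : C1 v X)
    (h' : C1 v Y) (e : ℤ × ℤ) : C1 v (mon X Y e) :=
  C1_mul hv (C1_zpow hv h _) (C1_zpow hv h' _)

lemma mon_mul {X Y : F} (hX : X ≠ 0) (hY : Y ≠ 0) (e f : ℤ × ℤ) :
    mon X Y e * mon X Y f = mon X Y (e + f) := by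
  simp only [mon, Prod.fst_add, Prod.snd_add, zpow_add₀ hX, zpow_add₀ hY]; ring

lemma mon_mon {X Y : F} (hX : X ≠ 0) (hY : Y ≠ 0) (r s e : ℤ × ℤ) :
    mon (mon X Y r) (mon X Y s) e = mon X Y (r.1 * e.1 + s.1 * e.2, r.2 * e.1 + s.2 * e.2) := by
  simp only [mon, mul_zpow, ← zpow_mul, zpow_add₀ hX, zpow_add₀ hY]; ring

lemma mon_ne {X Y : F} (hX : X ≠ 0) (hY : Y ≠ 0) (e : ℤ × ℤ) : mon X Y e ≠ 0 :=
  mul_ne_zero (zpow_ne_zero _ hX) (zpow_ne_zero _ hY)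

lemma mon_one {v : Vl F} {X Y : F} (hX : v X = 1) (hY : v Y = 1) (e : ℤ × ℤ) : v (mon X Y e) = 1 := by
  simp [mon, hX, hY]

def Cop (X Y P Q : F) : Prop := ∀ v : Vl F, (∀ c : ℂ, v (algebraMap ℂ F c) ≤ 1) →
  v X = 1 → v Y = 1 → v P < 1 → v Q < 1 → Cent v X ∧ Cent v Y

def CopA (X Y P Q : F) : Prop := ∀ v : Vl F, (∀ c : ℂ, v (algebraMap ℂ F c) ≤ 1) →
  v X ≤ 1 → v Y ≤ 1 → v P < 1 → v Q < 1 → Cent v X ∧ Cent v Y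

lemma CopA_trans {X Y P Q : F} (h : CopA X Y P Q) (α β : ℂ) :
    Cop (X - algebraMap ℂ F α) (Y - algebraMap ℂ F β) P Q := by
  intro v hv hX hY hP hQ
  have hl : ∀ (Z : F) (c : ℂ), v (Z - algebraMap ℂ F c) = 1 → v Z ≤ 1 := by
    intro Z c hZ
    have : Z = (Z - algebraMap ℂ F c) + algebraMap ℂ F c := by ring
    rw [this]; exact (v.map_add _ _).trans (max_le hZ.le (hv c))
  obtain ⟨⟨a, ha⟩, ⟨b, hb⟩⟩ := h v hv (hl _ _ hX) (hl _ _ hY) hP hQ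
  refine ⟨⟨a - α, ?_⟩, ⟨b - β, ?_⟩⟩
  · rw [RingHom.map_sub (algebraMap ℂ F), sub_sub_sub_cancel_right]; exact ha
  · rw [RingHom.map_sub (algebraMap ℂ F), sub_sub_sub_cancel_right]; exact hb

structure Orbit (D E : Derivation ℂ F F) (O : F → F → Prop) : Prop where
  inv : ∀ X Y, O X Y → O X⁻¹ Y
  swap : ∀ X Y, O X Y → O Y X
  div : ∀ X Y, O X Y → O (X / Y) Y
  trans : ∀ X Y (α : ℂ), O X Y → O (X - algebraMap ℂ F α) Y
  jac : ∀ X Y, O X Y → JJ D E X Y ≠ 0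

variable {D E : Derivation ℂ F F} {O : F → F → Prop} (hO : Orbit D E O)
include hO

lemma O_x {X Y : F} (h : O X Y) : X ≠ 0 := by
  rintro rfl; exact hO.jac _ _ h (by simp [JJ])

lemma O_y {X Y : F} (h : O X Y) : Y ≠ 0 := O_x hO (hO.swap _ _ h)

lemma O_yinv {X Y : F} (h : O X Y) : O X Y⁻¹ := hO.swap _ _ (hO.inv _ _ (hO.swap _ _ h))

lemma O_ytrans {X Y : F} (h : O X Y) (β : ℂ) : O X (Y - algebraMap ℂ F β) :=
  hO.swap _ _ (hO.trans _ _ β (hO.swap _ _ h))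

lemma O_tw {X Y : F} (h : O X Y) (n : ℤ) : O (X * Y ^ n) Y := by
  have hy := O_y hO h
  have hp : ∀ k : ℕ, ∀ Z W : F, O Z W → O (Z * (W ^ k)⁻¹) W := by
    intro k
    induction k with
    | zero => intro Z W hZ; simpa using hZ
    | succ k ih =>
      intro Z W hZ
      have := hO.div _ _ (ih Z W hZ)
      rwa [div_eq_mul_inv, mul_assoc, ← mul_inv, ← pow_succ] at this
  obtain ⟨k, rfl | rfl⟩ := Int.eq_nat_or_neg n
  · have := O_yinv hO (hp k _ _ (O_yinv hO h))
    simpa using this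
  · simpa using hp k _ _ h

omit hO
def Dat (O : F → F → Prop) (x : F) (S : Set (ℤ × ℤ)) (X Y P Q : F) : Prop :=
  O X Y ∧ P ∈ VV X Y S ∧ Q ∈ VV X Y S ∧ x * Q = P ∧ Q ≠ 0 ∧ Cop X Y P Q

include hO
lemma Dat_mon {x : F} {S T : Set (ℤ × ℤ)} {X Y P Q X' Y' : F} (h : Dat O x S X Y P Q)
    (h' : O X' Y') (r s t r' s' : ℤ × ℤ) (hX : X' = mon X Y r) (hY : Y' = mon X Y s)
    (hX' : X = mon X' Y' r') (hY' : Y = mon X' Y' s')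
    (hST : ∀ e ∈ S, ∃ e' ∈ T, t.1 + e.1 = r.1 * e'.1 + s.1 * e'.2 ∧
      t.2 + e.2 = r.2 * e'.1 + s.2 * e'.2) :
    Dat O x T X' Y' (mon X Y t * P) (mon X Y t * Q) := by
  obtain ⟨h1, h2, h3, h4, h5, h6⟩ := h
  have hx := O_x hO h1
  have hy := O_y hO h1
  have hm : ∀ e ∈ S, mon X Y t * mon X Y e ∈ VV X' Y' T := by
    intro e he
    obtain ⟨e', he', ha, hb⟩ := hST e he
    have : mon X Y t * mon X Y e = mon X' Y' e' := by
      rw [hX, hY, mon_mon hx hy, mon_mul hx hy]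
      congr 1
      exact Prod.ext ha hb
    rw [this]; exact mon_mem he'
  refine ⟨h', VV_move hm h2, VV_move hm h3, by rw [← h4]; ring, mul_ne_zero (mon_ne hx hy _) h5, ?_⟩
  intro v hv hvX hvY hP hQ
  have e1 : v X = 1 := by rw [hX']; exact mon_one hvX hvY _
  have e2 : v Y = 1 := by rw [hY']; exact mon_one hvX hvY _
  rw [map_mul, mon_one e1 e2, one_mul] at hP hQ
  obtain ⟨c1, c2⟩ := h6 v hv e1 e2 hP hQ
  rw [hX, hY]
  exact ⟨(C1_mon hv ⟨e1, c1⟩ ⟨e2, c2⟩ _).2, (C1_mon hv ⟨e1, c1⟩ ⟨e2, c2⟩ _).2⟩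

lemma Dat_trans {x : F} {S : Set (ℤ × ℤ)} {X Y P Q : F} (h : Dat O x S X Y P Q)
    (hS : S ⊆ NN) (hA : CopA X Y P Q) (α β : ℂ)
    (hcX : α = 0 ∨ ∀ e ∈ S, ∀ i, 0 ≤ i → i ≤ e.1 → (i, e.2) ∈ S)
    (hcY : ∀ e ∈ S, ∀ j, 0 ≤ j → j ≤ e.2 → (e.1, j) ∈ S) :
    Dat O x S (X - algebraMap ℂ F α) (Y - algebraMap ℂ F β) P Q := by
  obtain ⟨h1, h2, h3, h4, h5, h6⟩ := h
  have key : ∀ R ∈ VV X Y S, R ∈ VV (X - algebraMap ℂ F α) (Y - algebraMap ℂ F β) S := by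
    intro R hR
    refine VV_transY hS hcY β ?_
    rcases hcX with rfl | hcX
    · simpa using hR
    · exact VV_transX hS hcX α hR
  exact ⟨O_ytrans hO (hO.trans _ _ α h1) β, key P h2, key Q h3, h4, h5, CopA_trans hA α β⟩

omit hO
lemma Dat_sub {x : F} {S T : Set (ℤ × ℤ)} {X Y P Q : F} (h : Dat O x S X Y P Q)
    (hP : P ∈ VV X Y T) (hQ : Q ∈ VV X Y T) : Dat O x T X Y P Q :=
  ⟨h.1, hP, hQ, h.2.2.2⟩

lemma Dat_mono {x : F} {S T : Set (ℤ × ℤ)} {X Y P Q : F} (h : Dat O x S X Y P Q)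
    (hST : S ⊆ T) : Dat O x T X Y P Q := Dat_sub h (VV_mono hST h.2.1) (VV_mono hST h.2.2.1)

lemma Dat_ne {x : F} {S : Set (ℤ × ℤ)} {X Y P Q : F} (h : Dat O x S X Y P Q) : ∃ e, e ∈ S := by
  by_contra hh
  push Not at hh
  have : S = ∅ := Set.eq_empty_of_forall_notMem hh
  have h3 := h.2.2.1
  rw [this] at h3
  simp [VV] at h3
  exact h.2.2.2.2.1 h3

/-- affine coprimality from the two edges -/
lemma copA_of {x : F} {S : Set (ℤ × ℤ)} (hS : S ⊆ NN) {X Y P Q : F} (h : Dat O x S X Y P Q)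
    (e1 : ¬ Dat O x (S ∩ {e | 1 ≤ e.1}) X Y P Q) (e2 : ¬ Dat O x (S ∩ {e | 1 ≤ e.2}) X Y P Q) :
    CopA X Y P Q := by
  intro v hv hX hY hP hQ
  have a1 : v X < 1 → Cent v Y := by
    intro hx
    by_contra hc
    exact e1 (Dat_sub h (edge hv hS hx hY hc h.2.1 hP) (edge hv hS hx hY hc h.2.2.1 hQ))
  have a2 : v Y < 1 → Cent v X := by
    intro hy
    by_contra hc
    have hsw : ∀ R ∈ VV X Y S, v R < 1 → R ∈ VV X Y (S ∩ {e | 1 ≤ e.2}) := by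
      intro R hR hR1
      have h1 : R ∈ VV Y X {e | (e.2, e.1) ∈ S} := VV_swap (fun e he => he) hR
      have h2 := edge hv (S := {e | (e.2, e.1) ∈ S}) (fun e he => ⟨(hS he).2, (hS he).1⟩) hy hX hc h1 hR1
      exact VV_swap (T := S ∩ {e | 1 ≤ e.2}) (fun e he => And.intro he.1 he.2) h2
    exact e2 (Dat_sub h (hsw P h.2.1 hP) (hsw Q h.2.2.1 hQ))
  rcases hX.lt_or_eq with hx | hx
  · exact ⟨cent_of_lt hx, a1 hx⟩
  rcases hY.lt_or_eq with hy | hy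
  · exact ⟨a2 hy, cent_of_lt hy⟩
  exact h.2.2.2.2.2 v hv hx hy hP hQ
end AbsC

section AbsC2
variable {F : Type*} [Field F] [Algebra ℂ F]

def Box (a n b : ℤ) : Set (ℤ × ℤ) := {e | 0 ≤ e.1 ∧ 0 ≤ e.2 ∧ e.1 ≤ a ∧ e.2 + n * e.1 ≤ b}
def Tri (b : ℤ) : Set (ℤ × ℤ) := {e | 0 ≤ e.1 ∧ 0 ≤ e.2 ∧ e.1 + e.2 ≤ b}

lemma Box_NN (a n b : ℤ) : Box a n b ⊆ NN := fun _ he => ⟨he.1, he.2.1⟩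
lemma Tri_NN (b : ℤ) : Tri b ⊆ NN := fun _ he => ⟨he.1, he.2.1⟩
lemma MM_NN (b : ℤ) : MM b ⊆ NN := fun _ he => ⟨he.1, he.2.1⟩

lemma exp_ex {γ : WithZero (Multiplicative ℤ)} (h : γ ≠ 0) : ∃ N : ℕ, WithZero.exp (-(N : ℤ)) ≤ γ := by
  refine ⟨(WithZero.log γ).natAbs, ?_⟩
  rw [← WithZero.exp_log h, WithZero.exp_le_exp]
  simp only [WithZero.log_exp]
  omega

variable {D E : Derivation ℂ F F} {O : F → F → Prop} (hO : Orbit D E O) {x : F}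
include hO

lemma nf_apply {v : Vl F} {κ : WithZero (Multiplicative ℤ)} (hg : GoodV D E v κ) (hx : v x ≤ 1)
    {S : Set (ℤ × ℤ)} (hS : S ⊆ NN) {X Y P Q : F} (h : Dat O x S X Y P Q) (hA : CopA X Y P Q)
    (hX : v X ≤ 1) (hY : v Y ≤ 1) (k l : ℕ)
    (hcX : v X < 1 ∨ ∀ e ∈ S, ∀ i, 0 ≤ i → i ≤ e.1 → (i, e.2) ∈ S)
    (hcY : ∀ e ∈ S, ∀ j, 0 ≤ j → j ≤ e.2 → (e.1, j) ∈ S)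
    (hm : ∀ (X Y : F) (m : ℕ), Dat O x (S ∩ MM m) X Y P Q → l * m ≤ k) :
    v (JJ D E X Y) ^ k ≤ κ ^ k * v Q ^ l := by
  have hv := hg.const
  have hQ0 := h.2.2.2.2.1
  obtain ⟨N, hN⟩ := exp_ex (γ := v Q) (by simpa using hQ0)
  refine nf_local hg k l N X Y P Q (hO.jac _ _ h.1) hX hY (VV_mono hS h.2.1) (VV_mono hS h.2.2.1)
    ?_ hQ0 hN (hA v hv hX hY) ?_
  · rw [← h.2.2.2.1, map_mul]; exact (mul_le_mul' hx le_rfl).trans (by simp)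
  · intro α β m hα hβ hP hQ
    have hd := Dat_trans hO h hS hA α β ?_ hcY
    · have hI := ind_of_J (hO.jac _ _ hd.1)
      exact hm _ _ m (Dat_sub hd (VV_inter hI hS (MM_NN _) hd.2.1 hP) (VV_inter hI hS (MM_NN _) hd.2.2.1 hQ))
    · refine hcX.imp (fun h1 => ?_) id
      apply const_zero hv
      have : algebraMap ℂ F α = X - (X - algebraMap ℂ F α) := by ring
      rw [this]
      exact (v.map_sub _ _).trans_lt (max_lt h1 hα)

lemma D_flip {a n b : ℤ} {X Y P Q : F} (h : Dat O x (Box a n b) X Y P Q) :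
    Dat O x (Box a (-n) (b - n * a)) X⁻¹ Y (mon X Y (-a, 0) * P) (mon X Y (-a, 0) * Q) := by
  refine Dat_mon hO h (hO.inv _ _ h.1) (-1, 0) (0, 1) (-a, 0) (-1, 0) (0, 1) (by simp [mon])
    (by simp [mon]) (by simp [mon]) (by simp [mon]) ?_
  rintro ⟨i, j⟩ ⟨h1, h2, h3, h4⟩
  dsimp only at h1 h2 h3 h4
  exact ⟨(a - i, j), ⟨by dsimp only; omega, h2, by dsimp only; omega, by dsimp only; linarith⟩,
    by dsimp only; ring, by dsimp only; ring⟩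

lemma D_yflip {a n b : ℤ} {X Y P Q : F} (h : Dat O x (Box a n b) X Y P Q) :
    Dat O x (Box a n b) (X * Y ^ (-n)) Y⁻¹ (mon X Y (0, -b) * P) (mon X Y (0, -b) * Q) := by
  have hy := O_y hO h.1
  refine Dat_mon hO h (O_yinv hO (O_tw hO h.1 _)) (1, -n) (0, -1) (0, -b) (1, -n) (0, -1)
    (by simp [mon]) (by simp [mon]) (by simp [mon]; field_simp) (by simp [mon]) ?_
  rintro ⟨i, j⟩ ⟨h1, h2, h3, h4⟩
  dsimp only at h1 h2 h3 h4
  exact ⟨(i, b - n * i - j), ⟨h1, by dsimp only; linarith, h3, by dsimp only; linarith⟩,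
    by dsimp only; ring, by dsimp only; ring⟩

lemma D_link {a n b m : ℤ} {X Y P Q : F} (h : Dat O x (Box a n b ∩ MM m) X Y P Q) :
    Dat O x (Box a (n - 1) (b - m)) (X / Y) Y (mon X Y (0, -m) * P) (mon X Y (0, -m) * Q) := by
  have hy := O_y hO h.1
  refine Dat_mon hO h (hO.div _ _ h.1) (1, -1) (0, 1) (0, -m) (1, 1) (0, 1)
    (by simp [mon, div_eq_mul_inv]) (by simp [mon]) (by simp [mon]; field_simp) (by simp [mon]) ?_
  rintro ⟨i, j⟩ ⟨⟨h1, h2, h3, h4⟩, ⟨_, _, h5⟩⟩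
  dsimp only at h1 h2 h3 h4 h5
  exact ⟨(i, i + j - m), ⟨h1, by dsimp only; omega, h3, by dsimp only; linarith⟩,
    by dsimp only; ring, by dsimp only; ring⟩

lemma D_swap {S : Set (ℤ × ℤ)} {X Y P Q : F} (h : Dat O x S X Y P Q) :
    Dat O x {e | (e.2, e.1) ∈ S} Y X P Q := by
  have := Dat_mon hO (T := {e | (e.2, e.1) ∈ S}) h (hO.swap _ _ h.1) (0, 1) (1, 0) (0, 0) (0, 1) (1, 0)
    (by simp [mon]) (by simp [mon]) (by simp [mon]) (by simp [mon]) (fun e he => ⟨(e.2, e.1), he, by simp, by simp⟩)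
  simpa [mon] using this

lemma D_divX {S T : Set (ℤ × ℤ)} {X Y P Q : F} (h : Dat O x S X Y P Q)
    (hST : ∀ e ∈ S, (e.1 - 1, e.2) ∈ T) :
    Dat O x T X Y (mon X Y (-1, 0) * P) (mon X Y (-1, 0) * Q) :=
  Dat_mon hO h h.1 (1, 0) (0, 1) (-1, 0) (1, 0) (0, 1) (by simp [mon]) (by simp [mon]) (by simp [mon])
    (by simp [mon]) (fun e he => ⟨_, hST e he, by dsimp only; ring, by dsimp only; ring⟩)

lemma D_divY {S T : Set (ℤ × ℤ)} {X Y P Q : F} (h : Dat O x S X Y P Q)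
    (hST : ∀ e ∈ S, (e.1, e.2 - 1) ∈ T) :
    Dat O x T X Y (mon X Y (0, -1) * P) (mon X Y (0, -1) * Q) :=
  Dat_mon hO h h.1 (1, 0) (0, 1) (0, -1) (1, 0) (0, 1) (by simp [mon]) (by simp [mon]) (by simp [mon])
    (by simp [mon]) (fun e he => ⟨_, hST e he, by dsimp only; ring, by dsimp only; ring⟩)

lemma O_rot {X Y : F} (h : O X Y) : O X⁻¹ (Y / X) := by
  exact hO.inv _ _ (hO.swap _ _ (hO.div _ _ (hO.swap _ _ h)))

lemma T_rot {b : ℤ} {S T : Set (ℤ × ℤ)} {X Y P Q : F} (h : Dat O x S X Y P Q)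
    (hST : ∀ e ∈ S, (b - e.1 - e.2, e.2) ∈ T) :
    Dat O x T X⁻¹ (Y / X) (mon X Y (-b, 0) * P) (mon X Y (-b, 0) * Q) := by
  have hx := O_x hO h.1
  exact Dat_mon hO h (O_rot hO h.1) (-1, 0) (-1, 1) (-b, 0) (-1, 0) (-1, 1)
    (by simp [mon]) (by simp [mon, div_eq_inv_mul]) (by simp [mon]) (by simp [mon]; field_simp)
    (fun e he => ⟨_, hST e he, by dsimp only; ring, by dsimp only; ring⟩)
omit hO

def MinA (O : F → F → Prop) (x : F) (a : ℤ) : Prop :=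
  ∀ a' n b X Y P Q, Dat O x (Box a' n b) X Y P Q → a ≤ a'
def MinB (O : F → F → Prop) (x : F) (a M : ℤ) : Prop :=
  ∀ n b X Y P Q, Dat O x (Box a n b) X Y P Q → M ≤ 2 * b - a * n
def MinT (O : F → F → Prop) (x : F) (b : ℤ) : Prop :=
  ∀ b' X Y P Q, Dat O x (Tri b') X Y P Q → b ≤ b'

include hO
lemma min_E1 {a n b : ℤ} {X Y P Q : F} (hA : MinA O x a) :
    ¬ Dat O x (Box a n b ∩ {e | 1 ≤ e.1}) X Y P Q := by
  intro h
  have := hA _ _ _ _ _ _ _ (D_divX hO (T := Box (a - 1) n (b - n)) h ?_)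
  · omega
  · rintro ⟨i, j⟩ ⟨⟨h1, h2, h3, h4⟩, h5⟩
    simp only [Set.mem_ofPred_eq] at h1 h2 h3 h4 h5
    exact ⟨by dsimp only; omega, h2, by dsimp only; omega, by dsimp only; linarith⟩

lemma min_b {a n b : ℤ} {X Y P Q : F} (hA : MinA O x a) (h : Dat O x (Box a n b) X Y P Q) : 0 ≤ b := by
  by_contra hb
  refine min_E1 hO hA (Dat_mono h ?_ : Dat O x (Box a n b ∩ {e | 1 ≤ e.1}) X Y P Q)
  rintro ⟨i, j⟩ ⟨h1, h2, h3, h4⟩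
  refine ⟨⟨h1, h2, h3, h4⟩, ?_⟩
  simp only [Set.mem_ofPred_eq] at h1 h2 h3 h4 ⊢
  rcases h1.lt_or_eq with h | h
  · omega
  · subst h; simp at h4; omega

lemma min_b' {a n b : ℤ} {X Y P Q : F} (hA : MinA O x a) (h : Dat O x (Box a n b) X Y P Q) : n * a ≤ b := by
  have := min_b hO hA (D_flip hO h); linarith

lemma min_copA {a n b : ℤ} {X Y P Q : F} (hA : MinA O x a) (hB : MinB O x a (2 * b - a * n))
    (h : Dat O x (Box a n b) X Y P Q) : CopA X Y P Q := by
  refine copA_of (Box_NN _ _ _) h (min_E1 hO hA) (fun h' => ?_)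
  have := hB _ _ _ _ _ _ (D_divY hO (T := Box a n (b - 1)) h' ?_)
  · omega
  · rintro ⟨i, j⟩ ⟨⟨h1, h2, h3, h4⟩, h5⟩
    simp only [Set.mem_ofPred_eq] at h1 h2 h3 h4 h5
    exact ⟨h1, by dsimp only; omega, h3, by dsimp only; omega⟩

variable {v : Vl F} {κ : WithZero (Multiplicative ℤ)} (hg : GoodV D E v κ) (hx : v x ≤ 1)
include hg hx

lemma L1 {a : ℕ} {n b : ℤ} {X Y P Q : F} (hA : MinA O x a) (hB : MinB O x a (2 * b - a * n))
    (h : Dat O x (Box a n b) X Y P Q) (hX : v X ≤ 1) (hY : v Y ≤ 1) (hn : v X < 1 ∨ 0 ≤ n) :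
    v (JJ D E X Y) ^ a ≤ κ ^ a * v Q ^ 2 := by
  refine nf_apply hO hg hx (Box_NN _ _ _) h (min_copA hO hA hB h) hX hY a 2 ?_ ?_ ?_
  · refine hn.imp_right fun hn => ?_
    rintro ⟨i, j⟩ ⟨h1, h2, h3, h4⟩ i' h5 h6
    dsimp only at h1 h2 h3 h4 h5 h6
    refine ⟨h5, h2, by dsimp only; omega, ?_⟩
    dsimp only; nlinarith
  · rintro ⟨i, j⟩ ⟨h1, h2, h3, h4⟩ j' h5 h6
    dsimp only at h1 h2 h3 h4 h5 h6
    exact ⟨h1, h5, h3, by dsimp only; omega⟩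
  · intro X Y m hd
    have := hB _ _ _ _ _ _ (D_link hO hd)
    have : 2 * (m : ℤ) ≤ a := by linarith
    omega

lemma L2 {a : ℕ} {n b : ℤ} {X Y P Q : F} (hA : MinA O x a) (hB : MinB O x a (2 * b - a * n))
    (h : Dat O x (Box a n b) X Y P Q) (hY : v Y ≤ 1) (hn : 0 ≤ n) :
    v (JJ D E X Y) ^ a ≤ κ ^ a * v Q ^ 2 := by
  rcases le_or_gt (v X) 1 with hX | hX
  · exact L1 hO hg hx hA hB h hX hY (Or.inr hn)
  have hX1 : v X⁻¹ < 1 := by rw [map_inv₀]; exact inv_lt_one_of_one_lt₀ hX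
  have h0 : v X ≠ 0 := (zero_lt_one.trans hX).ne'
  have := L1 hO hg hx hA (b := b - n * a) (n := -n) (by convert hB using 1; ring) (D_flip hO h) hX1.le hY (Or.inl hX1)
  rw [J_inv, Valuation.map_neg] at this
  simp only [mon, zpow_neg, zpow_natCast, zpow_zero, mul_one, map_mul, map_pow, map_inv₀] at this
  have e1 : v (JJ D E X Y) ^ a = (v X ^ 2) ^ a * (((v X)⁻¹ ^ 2 * v (JJ D E X Y)) ^ a) := by
    rw [← mul_pow]; congr 1; field_simp
  have e2 : κ ^ a * v Q ^ 2 = (v X ^ 2) ^ a * (κ ^ a * ((v X ^ a)⁻¹ * v Q) ^ 2) := by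
    rw [← pow_mul, mul_comm 2 a, pow_mul]; field_simp
  rw [e1, e2]
  gcongr

lemma L3 {a : ℕ} {n b : ℤ} {X Y P Q : F} (hA : MinA O x a) (hB : MinB O x a (2 * b - a * n))
    (h : Dat O x (Box a n b) X Y P Q) (hn : 0 ≤ n) (hab : a * (n + 2) ≤ 2 * b) :
    v (JJ D E X Y) ^ a ≤ κ ^ a * v Q ^ 2 := by
  rcases le_or_gt (v Y) 1 with hY | hY
  · exact L2 hO hg hx hA hB h hY hn
  have h0 : v Y ≠ 0 := (zero_lt_one.trans hY).ne'
  have hb := min_b hO hA h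
  have hY1 : v Y⁻¹ ≤ 1 := by rw [map_inv₀]; exact (inv_lt_one_of_one_lt₀ hY).le
  have := L2 hO hg hx hA hB (D_yflip hO h) hY1 hn
  rw [J_yflip, Valuation.map_neg] at this
  lift n to ℕ using hn
  lift b to ℕ using hb
  simp only [mon, zpow_neg, zpow_natCast, zpow_zero, one_mul, map_mul, map_pow, map_inv₀] at this
  have e1 : v (JJ D E X Y) ^ a = v Y ^ (a * (n + 2)) * ((v Y ^ n)⁻¹ * (v Y)⁻¹ ^ 2 * v (JJ D E X Y)) ^ a := by
    rw [mul_comm a, pow_mul, ← mul_pow]; congr 1; rw [pow_add]; field_simp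
  have e2 : κ ^ a * v Q ^ 2 = v Y ^ (2 * b) * (κ ^ a * ((v Y ^ b)⁻¹ * v Q) ^ 2) := by
    rw [mul_comm 2, pow_mul]; field_simp
  rw [e1, e2]
  have : a * (n + 2) ≤ 2 * b := by exact_mod_cast hab
  gcongr
  exact hY.le

lemma T1 {a : ℤ} {b : ℕ} {X Y P Q : F} (hA : MinA O x a) (hT : MinT O x b) (hab : 2 * b < 3 * a)
    (h : Dat O x (Tri b) X Y P Q) (hX : v X ≤ 1) (hY : v Y ≤ 1) :
    v (JJ D E X Y) ^ b ≤ κ ^ b * v Q ^ 3 := by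
  have hcop : CopA X Y P Q := by
    refine copA_of (Tri_NN _) h (fun h' => ?_) (fun h' => ?_)
    · have := hT _ _ _ _ _ (D_divX hO (T := Tri (b - 1)) h' ?_)
      · omega
      · rintro ⟨i, j⟩ ⟨⟨h1, h2, h3⟩, h5⟩
        simp only [Set.mem_ofPred_eq] at h1 h2 h3 h5
        exact ⟨by dsimp only; omega, h2, by dsimp only; omega⟩
    · have := hT _ _ _ _ _ (D_divY hO (T := Tri (b - 1)) h' ?_)
      · omega
      · rintro ⟨i, j⟩ ⟨⟨h1, h2, h3⟩, h5⟩
        simp only [Set.mem_ofPred_eq] at h1 h2 h3 h5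
        exact ⟨h1, by dsimp only; omega, by dsimp only; omega⟩
  refine nf_apply hO hg hx (Tri_NN _) h hcop hX hY b 3 (Or.inr ?_) ?_ ?_
  · rintro ⟨i, j⟩ ⟨h1, h2, h3⟩ i' h5 h6
    dsimp only at h1 h2 h3 h5 h6
    exact ⟨h5, h2, by dsimp only; omega⟩
  · rintro ⟨i, j⟩ ⟨h1, h2, h3⟩ i' h5 h6
    dsimp only at h1 h2 h3 h5 h6
    exact ⟨h1, h5, by dsimp only; omega⟩
  · intro X Y m hd
    have := hA _ _ _ _ _ _ _ (T_rot hO (b := b) (T := Box (b - m) 1 b) hd ?_)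
    · omega
    · rintro ⟨i, j⟩ ⟨⟨h1, h2, h3⟩, ⟨_, _, h5⟩⟩
      dsimp only at h1 h2 h3 h5
      exact ⟨by dsimp only; omega, h2, by dsimp only; omega, by dsimp only; omega⟩

lemma T2 {a : ℤ} {b : ℕ} {X Y P Q : F} (hA : MinA O x a) (hT : MinT O x b) (hab : 2 * b < 3 * a)
    (h : Dat O x (Tri b) X Y P Q) (hXY : v Y ≤ v X) :
    v (JJ D E X Y) ^ b ≤ κ ^ b * v Q ^ 3 := by
  rcases le_or_gt (v X) 1 with hX | hX
  · exact T1 hO hg hx hA hT hab h hX (hXY.trans hX)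
  have hX1 : v X⁻¹ < 1 := by rw [map_inv₀]; exact inv_lt_one_of_one_lt₀ hX
  have h0 : v X ≠ 0 := (zero_lt_one.trans hX).ne'
  have hY1 : v (Y / X) ≤ 1 := by
    rw [map_div₀]; exact (div_le_one₀ (zero_lt_iff.2 h0)).2 hXY
  have := T1 hO hg hx hA hT hab (T_rot hO (b := b) (T := Tri b) h (by
    rintro ⟨i, j⟩ ⟨h1, h2, h3⟩
    dsimp only at h1 h2 h3
    exact ⟨by dsimp only; omega, h2, by dsimp only; omega⟩)) hX1.le hY1
  rw [J_rot _ _ _ _ (O_x hO h.1), Valuation.map_neg] at this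
  simp only [mon, zpow_neg, zpow_natCast, zpow_zero, mul_one, map_mul, map_pow, map_inv₀] at this
  have e1 : v (JJ D E X Y) ^ b = (v X ^ 3) ^ b * (((v X)⁻¹ ^ 3 * v (JJ D E X Y)) ^ b) := by
    rw [← mul_pow]; congr 1; field_simp
  have e2 : κ ^ b * v Q ^ 3 = (v X ^ 3) ^ b * (κ ^ b * ((v X ^ b)⁻¹ * v Q) ^ 3) := by
    rw [← pow_mul, mul_comm 3 b, pow_mul]; field_simp
  rw [e1, e2]
  gcongr

lemma T3 {a : ℤ} {b : ℕ} {X Y P Q : F} (hA : MinA O x a) (hT : MinT O x b) (hab : 2 * b < 3 * a)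
    (h : Dat O x (Tri b) X Y P Q) : v (JJ D E X Y) ^ b ≤ κ ^ b * v Q ^ 3 := by
  rcases le_total (v Y) (v X) with hXY | hXY
  · exact T2 hO hg hx hA hT hab h hXY
  · have := T2 hO hg hx hA hT hab (Dat_mono (D_swap hO h) (T := Tri b) (by
      rintro ⟨i, j⟩ ⟨h1, h2, h3⟩
      dsimp only at h1 h2 h3
      exact ⟨h2, h1, by dsimp only; omega⟩)) hXY
    rwa [J_swap, Valuation.map_neg] at this
omit hg hx

theorem noether_fano
    (hFin : ∀ (h : F) (k : ℕ), k ≠ 0 → (∀ v κ, GoodV D E v κ → v x ≤ 1 → v h ≤ κ ^ k) → h = 0)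
    (hex : ∃ a n b X Y P Q, Dat O x (Box a n b) X Y P Q) :
    ∃ n b X Y P Q, Dat O x (Box 0 n b) X Y P Q := by
  have ha0 : ∀ a n b X Y P Q, Dat O x (Box a n b) X Y P Q → 0 ≤ a := by
    intro a n b X Y P Q h
    obtain ⟨e, h1, h2, h3, h4⟩ := Dat_ne h
    omega
  have hfin : ∀ (J Q : F) (k l : ℕ), k ≠ 0 → J ≠ 0 → Q ≠ 0 →
      (∀ v κ, GoodV D E v κ → v x ≤ 1 → v J ^ k ≤ κ ^ k * v Q ^ l) → False := by
    intro J Q k l hk hJ hQ hh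
    have := hFin (J ^ k / Q ^ l) k hk (fun v κ hg hx => by
      have h1 := hh v κ hg hx
      have h0 : v Q ^ l ≠ 0 := pow_ne_zero _ (by simpa using hQ)
      rw [map_div₀, map_pow, map_pow]
      exact (div_le_iff₀ (zero_lt_iff.2 h0)).2 h1)
    exact div_ne_zero (pow_ne_zero _ hJ) (pow_ne_zero _ hQ) this
  -- minimal a
  obtain ⟨a, ⟨⟨n₀, b₀, X₀, Y₀, P₀, Q₀, h₀⟩, hA⟩⟩ : ∃ a, (∃ n b X Y P Q, Dat O x (Box a n b) X Y P Q) ∧ MinA O x a := by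
    obtain ⟨a, h1, h2⟩ := Int.exists_least_of_bdd (P := fun a => ∃ n b X Y P Q, Dat O x (Box a n b) X Y P Q)
      ⟨0, fun a ⟨n, b, X, Y, P, Q, h⟩ => ha0 a n b X Y P Q h⟩ hex
    exact ⟨a, h1, fun a' n b X Y P Q h => h2 a' ⟨n, b, X, Y, P, Q, h⟩⟩
  have haa := ha0 _ _ _ _ _ _ _ h₀
  rcases haa.lt_or_eq with hapos | rfl
  swap
  · exact ⟨n₀, b₀, X₀, Y₀, P₀, Q₀, h₀⟩
  exfalso
  lift a to ℕ using haa
  obtain ⟨n, b, X, Y, P, Q, h, hB⟩ : ∃ n b X Y P Q, Dat O x (Box a n b) X Y P Q ∧ MinB O x a (2 * b - a * n) := by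
    obtain ⟨M, ⟨n, b, X, Y, P, Q, h, rfl⟩, h2⟩ := Int.exists_least_of_bdd
      (P := fun M => ∃ n b X Y P Q, Dat O x (Box a n b) X Y P Q ∧ 2 * b - a * n = M)
      ⟨0, by
        rintro M ⟨n, b, X, Y, P, Q, h, rfl⟩
        have h1 := min_b hO hA h
        have h2 := min_b' hO hA h
        linarith⟩ ⟨_, n₀, b₀, X₀, Y₀, P₀, Q₀, h₀, rfl⟩
    exact ⟨n, b, X, Y, P, Q, h, fun n' b' X' Y' P' Q' h' => h2 _ ⟨n', b', X', Y', P', Q', h', rfl⟩⟩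
  obtain ⟨n, b, X, Y, P, Q, h, hB, hn⟩ : ∃ n b X Y P Q, Dat O x (Box a n b) X Y P Q ∧
      MinB O x a (2 * b - a * n) ∧ 0 ≤ n := by
    rcases le_total 0 n with hn | hn
    · exact ⟨n, b, X, Y, P, Q, h, hB, hn⟩
    · refine ⟨_, _, _, _, _, _, D_flip hO h, ?_, by omega⟩
      convert hB using 1; ring
  have hb' := min_b' hO hA h
  by_cases hab : a * (n + 2) ≤ 2 * b
  · exact hfin _ _ a 2 (by omega) (hO.jac _ _ h.1) h.2.2.2.2.1
      (fun v κ hg hx => L3 hO hg hx hA hB h hn hab)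
  push Not at hab
  have hn2 : n < 2 := by
    by_contra hn2
    push Not at hn2
    nlinarith
  have hcase : n = 0 ∨ n = 1 := by omega
  rcases hcase with rfl | rfl
  · have := hA _ _ _ _ _ _ _ (Dat_mono (D_swap hO h) (T := Box b 0 a) (by
      rintro ⟨i, j⟩ ⟨h1, h2, h3, h4⟩
      dsimp only at h1 h2 h3 h4
      exact ⟨h2, h1, by dsimp only; omega, by dsimp only; omega⟩))
    omega
  · obtain ⟨b₁, ⟨X, Y, P, Q, h1⟩, h2⟩ := Int.exists_least_of_bdd
      (P := fun b => ∃ X Y P Q, Dat O x (Tri b) X Y P Q)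
      ⟨0, by
        rintro b ⟨X, Y, P, Q, h⟩
        obtain ⟨e, h1, h2, h3⟩ := Dat_ne h
        omega⟩ ⟨b, X, Y, P, Q, Dat_mono h (by
          rintro ⟨i, j⟩ ⟨h1, h2, h3, h4⟩
          dsimp only at h1 h2 h3 h4
          exact ⟨h1, h2, by dsimp only; omega⟩)⟩
    have hT : MinT O x b₁ := fun b' X Y P Q h => h2 b' ⟨X, Y, P, Q, h⟩
    have hbb : b₁ ≤ b := hT b _ _ _ _ (Dat_mono h (T := Tri b) (by
          rintro ⟨i, j⟩ ⟨h1, h2, h3, h4⟩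
          dsimp only at h1 h2 h3 h4
          exact ⟨h1, h2, by dsimp only; omega⟩))
    have hb0 : 0 ≤ b₁ := by
      obtain ⟨e, h1, h2, h3⟩ := Dat_ne h1
      omega
    have hab₁ := hA _ _ _ _ _ _ _ (T_rot hO (b := b₁) (T := Box b₁ 1 b₁) h1 (by
      rintro ⟨i, j⟩ ⟨h1, h2, h3⟩
      dsimp only at h1 h2 h3
      exact ⟨by dsimp only; omega, h2, by dsimp only; omega, by dsimp only; omega⟩))
    lift b₁ to ℕ using hb0
    exact hfin _ _ b₁ 3 (by omega) (hO.jac _ _ h1.1) h1.2.2.2.2.1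
      (fun v κ hg hx => T3 hO hg hx hA hT (by omega) h1)
end AbsC2

section AbsD
variable {K : Type*} [Field K] [Algebra (MvPolynomial (Fin 2) ℂ) K]
  [IsFractionRing (MvPolynomial (Fin 2) ℂ) K] [Algebra ℂ K] [IsScalarTower ℂ (MvPolynomial (Fin 2) ℂ) K]

local notation "RR" => MvPolynomial (Fin 2) ℂ
local notation "ι" => algebraMap (MvPolynomial (Fin 2) ℂ) K

variable (K) in
lemma iota_aeval (p : RR) : aeval ![ι (X 0), ι (X 1)] p = ι p := by
  have : (aeval ![ι (X 0), ι (X 1)] : RR →ₐ[ℂ] K) = IsScalarTower.toAlgHom ℂ RR K := by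
    ext i; fin_cases i <;> simp
  rw [this]; rfl

variable (K) in
lemma iota_C (c : ℂ) : algebraMap ℂ K c = ι (C c) := by
  rw [← MvPolynomial.algebraMap_eq, ← IsScalarTower.algebraMap_apply]

lemma hom_ext {L : Type*} [CommRing L] [Algebra ℂ L] {f g : K →ₐ[ℂ] L} (h0 : f (ι (X 0)) = g (ι (X 0)))
    (h1 : f (ι (X 1)) = g (ι (X 1))) : f = g := by
  have h : (f.comp (IsScalarTower.toAlgHom ℂ RR K)) = (g.comp (IsScalarTower.toAlgHom ℂ RR K)) := by
    ext i; fin_cases i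
    · exact h0
    · exact h1
  have h2 : (f : K →+* L) = g := by
    refine IsLocalization.ringHom_ext (nonZeroDivisors RR) ?_
    ext r
    · simp [← iota_C]
    · exact DFunLike.congr_fun h (X r)
  ext z; exact DFunLike.congr_fun h2 z

lemma der_ext {D E : Derivation ℂ K K} (h0 : D (ι (X 0)) = E (ι (X 0)))
    (h1 : D (ι (X 1)) = E (ι (X 1))) : D = E := by
  have h : ∀ p : RR, D (ι p) = E (ι p) := by
    intro p
    rw [← iota_aeval K p, der_aeval, der_aeval, h0, h1]
  ext z
  obtain ⟨a, b, hb, rfl⟩ := IsFractionRing.div_surjective (A := RR) z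
  rw [Derivation.leibniz_div, Derivation.leibniz_div, h, h]

lemma der_exists (e0 e1 : K) : ∃ D : Derivation ℂ K K, D (ι (X 0)) = e0 ∧ D (ι (X 1)) = e1 := by
  let g : RR →ₐ[ℂ] DualNumber K := aeval ![TrivSqZeroExt.inl (ι (X 0)) + TrivSqZeroExt.inr e0,
    TrivSqZeroExt.inl (ι (X 1)) + TrivSqZeroExt.inr e1]
  have hfst : ∀ p, TrivSqZeroExt.fst (g p) = ι p := by
    intro p
    have : ((TrivSqZeroExt.fstHom ℂ K K).comp g) = IsScalarTower.toAlgHom ℂ RR K := by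
      ext i; fin_cases i <;> simp [g]
    exact DFunLike.congr_fun this p
  have hu : ∀ y : nonZeroDivisors RR, IsUnit (g y) := by
    intro y
    rw [TrivSqZeroExt.isUnit_iff_isUnit_fst, hfst]
    exact isUnit_iff_ne_zero.2 (IsFractionRing.to_map_ne_zero_of_mem_nonZeroDivisors y.2)
  let f : K →ₐ[ℂ] DualNumber K := IsLocalization.liftAlgHom (M := nonZeroDivisors RR) (f := g) hu
  have hf : ∀ p, f (ι p) = g p := fun p => by
    exact IsLocalization.lift_eq (M := nonZeroDivisors RR) (g := (g : RR →+* DualNumber K)) hu p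
  have hf1 : (TrivSqZeroExt.fstHom ℂ K K).comp f = AlgHom.id ℂ K := by
    apply hom_ext
    · simp [hf, hfst]
    · simp [hf, hfst]
  have hf1' : ∀ z, TrivSqZeroExt.fst (f z) = z := fun z => DFunLike.congr_fun hf1 z
  let D : Derivation ℂ K K := Derivation.mk' ((TrivSqZeroExt.sndHom K K).restrictScalars ℂ ∘ₗ f.toLinearMap) (by
    intro a b
    simp [hf1', mul_comm])
  refine ⟨D, ?_, ?_⟩
  · change TrivSqZeroExt.snd (f _) = _
    rw [hf]; simp [g]
  · change TrivSqZeroExt.snd (f _) = _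
    rw [hf]; simp [g]

def conjD (τ : K ≃ₐ[ℂ] K) (D : Derivation ℂ K K) : Derivation ℂ K K :=
  Derivation.mk' (τ.toLinearMap ∘ₗ D.toLinearMap ∘ₗ τ.symm.toLinearMap) (by
    intro a b
    simp [Derivation.leibniz])

omit [Algebra (MvPolynomial (Fin 2) ℂ) K] [IsFractionRing (MvPolynomial (Fin 2) ℂ) K] [IsScalarTower ℂ (MvPolynomial (Fin 2) ℂ) K] in
lemma conjD_apply (τ : K ≃ₐ[ℂ] K) (D : Derivation ℂ K K) (z : K) : conjD τ D z = τ (D (τ.symm z)) := rfl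

lemma J_auto {D E : Derivation ℂ K K} (hD0 : D (ι (X 0)) = 1) (hD1 : D (ι (X 1)) = 0)
    (hE0 : E (ι (X 0)) = 0) (hE1 : E (ι (X 1)) = 1) (φ : K ≃ₐ[ℂ] K) :
    JJ D E (φ (ι (X 0))) (φ (ι (X 1))) ≠ 0 := by
  intro h
  obtain ⟨w, hw0, hw⟩ := Matrix.exists_mulVec_eq_zero_iff.2
    (show (!![D (φ (ι (X 0))), E (φ (ι (X 0))); D (φ (ι (X 1))), E (φ (ι (X 1)))]).det = 0 by
      rw [Matrix.det_fin_two_of]; exact h)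
  have a0 := congrFun hw 0
  have a1 := congrFun hw 1
  simp [Matrix.mulVec, dotProduct, Fin.sum_univ_two] at a0 a1
  have c0 : (w 0 • D + w 1 • E) (φ (ι (X 0))) = 0 := by simp; linear_combination a0
  have c1 : (w 0 • D + w 1 • E) (φ (ι (X 1))) = 0 := by simp; linear_combination a1
  have : conjD φ.symm (w 0 • D + w 1 • E) = 0 := by
    apply der_ext
    · rw [conjD_apply, AlgEquiv.symm_symm, c0]; simp
    · rw [conjD_apply, AlgEquiv.symm_symm, c1]; simp
  have h2 : ∀ z, (w 0 • D + w 1 • E) z = 0 := by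
    intro z
    have h3 := DFunLike.congr_fun this (φ.symm z)
    rw [conjD_apply, AlgEquiv.symm_symm, AlgEquiv.apply_symm_apply] at h3
    exact (map_eq_zero_iff _ φ.symm.injective).1 h3
  have b0 := h2 (ι (X 0))
  have b1 := h2 (ι (X 1))
  simp [hD0, hD1, hE0, hE1] at b0 b1
  apply hw0
  ext i; fin_cases i
  · exact b0
  · exact b1
end AbsD

section AbsD2
variable {K : Type*} [Field K] [Algebra (MvPolynomial (Fin 2) ℂ) K]
  [IsFractionRing (MvPolynomial (Fin 2) ℂ) K] [Algebra ℂ K] [IsScalarTower ℂ (MvPolynomial (Fin 2) ℂ) K]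

local notation "RR" => MvPolynomial (Fin 2) ℂ
local notation "ι" => algebraMap (MvPolynomial (Fin 2) ℂ) K

open Classical in
def piV (π : RR) (hπ : Prime π) : Valuation RR (WithZero (Multiplicative ℤ)) where
  toFun r := if r = 0 then 0 else WithZero.exp (-(multiplicity π r : ℤ))
  map_zero' := by simp
  map_one' := by
    rw [if_neg one_ne_zero]
    have : multiplicity π (1 : RR) = 0 := multiplicity_eq_zero.2 (fun h => hπ.not_isUnit (isUnit_of_dvd_one h))
    simp [this]
  map_mul' a b := by
    by_cases ha : a = 0
    · simp [ha]
    by_cases hb : b = 0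
    · simp [hb]
    rw [if_neg ha, if_neg hb, if_neg (mul_ne_zero ha hb), ← WithZero.exp_add,
      multiplicity_mul hπ (FiniteMultiplicity.of_prime_left hπ (mul_ne_zero ha hb))]
    congr 1; push_cast; ring
  map_add_le_max' a b := by
    by_cases ha : a = 0
    · simp [ha]
    by_cases hb : b = 0
    · simp [hb]
    by_cases hab : a + b = 0
    · simp [hab]
    rw [if_neg ha, if_neg hb, if_neg hab]
    have h := min_le_emultiplicity_add (p := π) (a := a) (b := b)
    rw [(FiniteMultiplicity.of_prime_left hπ ha).emultiplicity_eq_multiplicity,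
      (FiniteMultiplicity.of_prime_left hπ hb).emultiplicity_eq_multiplicity,
      (FiniteMultiplicity.of_prime_left hπ hab).emultiplicity_eq_multiplicity] at h
    rw [le_max_iff, WithZero.exp_le_exp, WithZero.exp_le_exp]
    rcases min_le_iff.1 h with h | h
    · left; rw [Nat.cast_le] at h; omega
    · right; rw [Nat.cast_le] at h; omega

variable (K) in
lemma prime_val {π : RR} (hπ : Prime π) : ∃ v : Vl K, (∀ r, v (ι r) ≤ 1) ∧ ∀ r, v (ι r) < 1 ↔ π ∣ r := by
  have hS : nonZeroDivisors RR ≤ (piV π hπ).supp.primeCompl := by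
    intro s hs h
    rw [SetLike.mem_coe, Valuation.mem_supp_iff] at h
    have hs0 : s ≠ 0 := nonZeroDivisors.ne_zero hs
    change (if s = 0 then 0 else WithZero.exp (-(multiplicity π s : ℤ))) = 0 at h
    rw [if_neg hs0] at h
    exact WithZero.exp_ne_zero h
  have key : ∀ r : RR, piV π hπ r = (if r = 0 then 0 else WithZero.exp (-(multiplicity π r : ℤ))) := by
    intro r; by_cases hr : r = 0 <;> simp [hr, piV]
  refine ⟨(piV π hπ).extendToLocalization hS K, fun r => ?_, fun r => ?_⟩
  · rw [Valuation.extendToLocalization_apply_map_apply, key]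
    split_ifs with h
    · simp
    · rw [← WithZero.exp_zero, WithZero.exp_le_exp]; omega
  · rw [Valuation.extendToLocalization_apply_map_apply, key]
    split_ifs with h
    · simp [h]
    · rw [← WithZero.exp_zero, WithZero.exp_lt_exp]
      have := multiplicity_eq_zero (a := π) (b := r)
      constructor
      · intro h1; by_contra h2; rw [this.2 h2] at h1; simp at h1
      · intro h1
        have : multiplicity π r ≠ 0 := fun h2 => this.1 h2 h1
        omega

lemma int_frac {π : RR} (hπ : Prime π) {v : Vl K} (h1 : ∀ r, v (ι r) ≤ 1) (h2 : ∀ r, v (ι r) < 1 ↔ π ∣ r)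
    (f : K) (hf : v f ≤ 1) : ¬ π ∣ (IsFractionRing.den RR f : RR) := by
  intro hd
  have hn : ¬ π ∣ IsFractionRing.num RR f := fun h => hπ.not_isUnit (IsFractionRing.num_den_reduced RR f h hd)
  have hn1 : v (ι (IsFractionRing.num RR f)) = 1 := le_antisymm (h1 _) (not_lt.1 (fun h => hn ((h2 _).1 h)))
  have hd1 := (h2 _).2 hd
  have e := IsFractionRing.mk'_num_den' RR f
  have hd0 : ι (IsFractionRing.den RR f : RR) ≠ 0 :=
    IsFractionRing.to_map_ne_zero_of_mem_nonZeroDivisors (IsFractionRing.den RR f).2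
  rw [div_eq_iff hd0] at e
  have := congrArg v e
  rw [hn1, map_mul] at this
  have h3 : v f * v (ι (IsFractionRing.den RR f : RR)) < 1 :=
    (mul_le_mul' hf le_rfl).trans_lt (by simpa using hd1)
  exact h3.ne this.symm

lemma der_int {π : RR} (hπ : Prime π) {v : Vl K} (h1 : ∀ r, v (ι r) ≤ 1) (h2 : ∀ r, v (ι r) < 1 ↔ π ∣ r)
    {D : Derivation ℂ K K} (hD0 : v (D (ι (X 0))) ≤ 1) (hD1 : v (D (ι (X 1))) ≤ 1)
    (f : K) (hf : v f ≤ 1) : v (D f) ≤ 1 := by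
  have hd := int_frac hπ h1 h2 f hf
  have hd1 : v (ι (IsFractionRing.den RR f : RR)) = 1 := le_antisymm (h1 _) (not_lt.1 (fun h => hd ((h2 _).1 h)))
  have hp : ∀ p : RR, v (D (ι p)) ≤ 1 := by
    intro p
    rw [← iota_aeval K p, der_aeval, iota_aeval, iota_aeval]
    refine (v.map_add _ _).trans (max_le ?_ ?_)
    · rw [map_mul]; exact mul_le_one' (h1 _) hD0
    · rw [map_mul]; exact mul_le_one' (h1 _) hD1
  rw [← IsFractionRing.mk'_num_den' RR f, Derivation.leibniz_div]
  simp only [smul_eq_mul, map_mul, map_pow, map_inv₀, hd1]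
  simp only [one_pow, inv_one, one_mul]
  refine (v.map_sub _ _).trans (max_le ?_ ?_)
  · rw [map_mul]; exact mul_le_one' (h1 _) (hp _)
  · rw [map_mul]; exact mul_le_one' (h1 _) (hp _)

lemma J_int {F : Type*} [Field F] [Algebra ℂ F] {v : Vl F} {D E : Derivation ℂ F F}
    (hD : ∀ f, v f ≤ 1 → v (D f) ≤ 1) (hE : ∀ f, v f ≤ 1 → v (E f) ≤ 1) (A B : F)
    (hA : v A ≤ 1) (hB : v B ≤ 1) : v (JJ D E A B) ≤ 1 := by
  unfold JJ
  refine (v.map_sub _ _).trans (max_le ?_ ?_)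
  · rw [map_mul]; exact mul_le_one' (hD _ hA) (hE _ hB)
  · rw [map_mul]; exact mul_le_one' (hE _ hA) (hD _ hB)

lemma no_pole {F : Type*} [Field F] [Algebra ℂ F] {v : Vl F} (hv : ∀ c : ℂ, v (algebraMap ℂ F c) ≤ 1)
    {x y : F} (hy0 : y ≠ 0) (hy : v y⁻¹ < 1) (hx : v x ≤ 1) (hc : ¬ Cent v x) (P : F) (hP : P ∈ VV x y NN)
    (hP1 : v P < 1) : P = 0 := by
  have key : ∀ d : ℕ, P ∈ VV x y {e | 0 ≤ e.1 ∧ 0 ≤ e.2 ∧ e.2 < d} → P = 0 := by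
    intro d
    induction d with
    | zero =>
      intro h
      have : {e : ℤ × ℤ | 0 ≤ e.1 ∧ 0 ≤ e.2 ∧ e.2 < ((0 : ℕ) : ℤ)} = ∅ := by
        ext e; simp
      rw [this] at h
      simpa [VV] using h
    | succ d ih =>
      intro h
      apply ih
      let T : Set (ℤ × ℤ) := {e | 0 ≤ e.1 ∧ 0 ≤ e.2 ∧ e.1 ≤ d}
      have h1 : (y ^ d)⁻¹ * P ∈ VV y⁻¹ x T := by
        refine VV_move (fun e he => ?_) h
        obtain ⟨a1, a2, a3⟩ := he
        have : (y ^ d)⁻¹ * mon x y e = mon y⁻¹ x (d - e.2, e.1) := by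
          simp only [mon, inv_zpow', neg_sub, zpow_sub₀ hy0, zpow_natCast]; field_simp
        rw [this]
        apply mon_mem
        refine ⟨?_, a1, ?_⟩ <;> dsimp only <;> push_cast at a3 <;> omega
      have h2 := edge hv (S := T) (fun e he => ⟨he.1, he.2.1⟩) hy hx hc h1 (by
        rw [map_mul, ← inv_pow, map_pow]
        exact (mul_le_mul' (pow_le_one' hy.le d) le_rfl).trans_lt (by simpa using hP1))
      have h3 : y ^ d * ((y ^ d)⁻¹ * P) ∈ VV x y {e | 0 ≤ e.1 ∧ 0 ≤ e.2 ∧ e.2 < d} := by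
        refine VV_move (fun e he => ?_) h2
        obtain ⟨⟨a1, a2, a3⟩, a4⟩ := he
        have : y ^ d * mon y⁻¹ x e = mon x y (e.2, d - e.1) := by
          simp only [mon, inv_zpow', zpow_sub₀ hy0, zpow_natCast, zpow_neg]; field_simp
        rw [this]
        apply mon_mem
        simp only [Set.mem_ofPred_eq] at a4
        refine ⟨a2, ?_, ?_⟩ <;> dsimp only <;> omega
      rwa [mul_inv_cancel_left₀ (pow_ne_zero _ hy0)] at h3
  obtain ⟨p, hp, rfl⟩ := (VV_iff (fun e he => he)).1 hP
  refine key (p.totalDegree + 1) ((VV_iff (fun e he => ⟨he.1, he.2.1⟩)).2 ⟨p, fun d hd => ?_, rfl⟩)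
  refine ⟨by simp, by simp, ?_⟩
  have h1 := le_totalDegree hd
  have : ∑ i ∈ d.support, d i = d 0 + d 1 := by
    have := Finsupp.sum_fintype d (fun _ n => n) (by simp)
    simpa [Finsupp.sum] using this
  simp only [Finsupp.sum] at h1
  dsimp only; push_cast; omega

theorem final_zero {D E : Derivation ℂ K K} (hD0 : D (ι (X 0)) = 1) (hD1 : D (ι (X 1)) = 0)
    (hE0 : E (ι (X 0)) = 0) (hE1 : E (ι (X 1)) = 1) (τ : K ≃ₐ[ℂ] K) (hτ0 : τ (ι (X 0)) = ι (X 0))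
    (hτ1 : τ (ι (X 1)) = (ι (X 1))⁻¹) (h : K) (k : ℕ) (hk : k ≠ 0)
    (hh : ∀ v κ, GoodV D E v κ → v (ι (X 0)) ≤ 1 → v h ≤ κ ^ k) : h = 0 := by
  have hy0 : ι (X 1) ≠ 0 := by
    rw [Ne, FaithfulSMul.algebraMap_eq_zero_iff]; exact X_ne_zero _
  have good : ∀ π : RR, ∀ hπ : Prime π, ∀ v : Vl K, (∀ r, v (ι r) ≤ 1) → (∀ r, v (ι r) < 1 ↔ π ∣ r) →
      (∀ f, v f ≤ 1 → v (D f) ≤ 1) ∧ (∀ f, v f ≤ 1 → v (E f) ≤ 1) := by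
    intro π hπ v h1 h2
    exact ⟨der_int hπ h1 h2 (by simp [hD0]) (by simp [hD1]), der_int hπ h1 h2 (by simp [hE0]) (by simp [hE1])⟩
  have hden : IsUnit (IsFractionRing.den RR h : RR) := by
    by_contra hu
    obtain ⟨π, hπ, hd⟩ := WfDvdMonoid.exists_irreducible_factor hu (nonZeroDivisors.ne_zero (IsFractionRing.den RR h).2)
    have hπ := hπ.prime
    obtain ⟨v, h1, h2⟩ := prime_val K hπ
    have := hh v 1 ⟨fun c => by rw [iota_C]; exact h1 _, J_int (good π hπ v h1 h2).1 (good π hπ v h1 h2).2⟩ (h1 _)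
    rw [one_pow] at this
    exact int_frac hπ h1 h2 h this hd
  obtain ⟨p, hp⟩ : ∃ p : RR, ι p = h := by
    obtain ⟨u, hu⟩ := hden
    refine ⟨IsFractionRing.num RR h * (↑u⁻¹ : RR), ?_⟩
    have h3 : ι (↑u⁻¹ : RR) * ι (u : RR) = 1 := by rw [← map_mul, Units.inv_mul, map_one]
    have h4 := IsFractionRing.mk'_num_den' RR h
    rw [← hu, div_eq_mul_inv, ← eq_inv_of_mul_eq_one_left h3] at h4
    rw [map_mul]; exact h4
  obtain ⟨v, h1, h2⟩ := prime_val K (π := X 1) X_prime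
  have hvc : ∀ c : ℂ, v (algebraMap ℂ K c) ≤ 1 := fun c => by rw [iota_C]; exact h1 _
  let w : Vl K := v.comap (τ : K →+* K)
  have hw : ∀ z, w z = v (τ z) := fun z => rfl
  have hwc : ∀ c : ℂ, w (algebraMap ℂ K c) ≤ 1 := fun c => by rw [hw, AlgEquiv.commutes]; exact hvc c
  have hsx : τ.symm (ι (X 0)) = ι (X 0) := by rw [AlgEquiv.symm_apply_eq]; exact hτ0.symm
  have hsy : τ.symm (ι (X 1)) = (ι (X 1))⁻¹ := by
    rw [AlgEquiv.symm_apply_eq, map_inv₀, hτ1, inv_inv]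
  have cD : conjD τ D = D := by
    apply der_ext
    · rw [conjD_apply, hsx, hD0, map_one]
    · rw [conjD_apply, hsy, Derivation.leibniz_inv, hD1]; simp
  have cE : conjD τ E = (-(ι (X 1)) ^ 2) • E := by
    apply der_ext
    · rw [conjD_apply, hsx, hE0]; simp [hE0]
    · rw [conjD_apply, hsy, Derivation.leibniz_inv, hE1]; simp [hE1, hτ1]
  have cJ : ∀ A B, τ (JJ D E A B) = -(ι (X 1)) ^ 2 * JJ D E (τ A) (τ B) := by
    intro A B
    have e1 : ∀ A, τ (D A) = D (τ A) := fun A => by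
      conv_rhs => rw [← cD]
      rw [conjD_apply, AlgEquiv.symm_apply_apply]
    have e2 : ∀ A, τ (E A) = -(ι (X 1)) ^ 2 * E (τ A) := fun A => by
      have := DFunLike.congr_fun cE (τ A)
      rw [conjD_apply, AlgEquiv.symm_apply_apply] at this
      rw [this]; rfl
    simp only [JJ, map_sub, map_mul, e1, e2]; ring
  have hvy : v (ι (X 1)) < 1 := (h2 _).2 dvd_rfl
  have hg : GoodV D E w (v (ι (X 1)) ^ 2) := by
    refine ⟨hwc, fun A B hA hB => ?_⟩
    rw [hw, cJ, map_mul, Valuation.map_neg, map_pow]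
    have := J_int (good _ X_prime v h1 h2).1 (good _ X_prime v h1 h2).2 (τ A) (τ B) hA hB
    exact (mul_le_mul' le_rfl this).trans (by simp)
  have hwx : w (ι (X 0)) ≤ 1 := by rw [hw, hτ0]; exact h1 _
  have hwh : w h < 1 := by
    refine (hh w _ hg hwx).trans_lt ?_
    rw [← pow_mul]
    exact pow_lt_one₀ zero_le hvy (by omega)
  refine no_pole hwc hy0 ?_ hwx ?_ h ?_ hwh
  · rw [hw, map_inv₀, hτ1, inv_inv]; exact hvy
  · rintro ⟨α, hα⟩
    rw [hw, map_sub, hτ0, AlgEquiv.commutes, iota_C, ← map_sub, h2] at hα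
    obtain ⟨q, hq⟩ := hα
    have := congrArg (eval ![α + 1, 0]) hq
    simp at this
  · rw [← hp]
    exact (VV_iff (fun e he => he)).2 ⟨p, fun d _ => ⟨by simp, by simp⟩, iota_aeval K p⟩
end AbsD2

section AbsE
variable {K : Type*} [Field K] [Algebra (MvPolynomial (Fin 2) ℂ) K]
  [IsFractionRing (MvPolynomial (Fin 2) ℂ) K] [Algebra ℂ K] [IsScalarTower ℂ (MvPolynomial (Fin 2) ℂ) K]

local notation "RR" => MvPolynomial (Fin 2) ℂ
local notation "ι" => algebraMap (MvPolynomial (Fin 2) ℂ) K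
local notation "x" => algebraMap (MvPolynomial (Fin 2) ℂ) K (X 0)
local notation "y" => algebraMap (MvPolynomial (Fin 2) ℂ) K (X 1)

lemma x_ne : x ≠ 0 := by
  rw [Ne, FaithfulSMul.algebraMap_eq_zero_iff]; exact X_ne_zero _

lemma y_ne : y ≠ 0 := by
  rw [Ne, FaithfulSMul.algebraMap_eq_zero_iff]; exact X_ne_zero _

lemma aut_ext {f g : K ≃ₐ[ℂ] K} (h0 : f x = g x) (h1 : f y = g y) : f = g := by
  have : (f : K →ₐ[ℂ] K) = g := hom_ext h0 h1
  ext z; exact DFunLike.congr_fun this z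

lemma hom_of_ind {a b : K} (h : Ind a b) : ∃ f : K →ₐ[ℂ] K, f x = a ∧ f y = b := by
  have hu : ∀ z : nonZeroDivisors RR, IsUnit ((aeval ![a, b] : RR →ₐ[ℂ] K) z) := by
    intro z
    rw [isUnit_iff_ne_zero]
    exact fun h0 => nonZeroDivisors.ne_zero z.2 (h _ h0)
  let f : K →ₐ[ℂ] K := IsLocalization.liftAlgHom (M := nonZeroDivisors RR) (f := aeval ![a, b]) hu
  have hf : ∀ p, f (ι p) = aeval ![a, b] p := fun p => by
    exact IsLocalization.lift_eq (M := nonZeroDivisors RR) (g := ((aeval ![a, b] : RR →ₐ[ℂ] K) : RR →+* K)) hu p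
  exact ⟨f, by rw [hf]; simp, by rw [hf]; simp⟩

lemma mk_aut {a b : K} (h : Ind a b) (z w : K)
    (hz : ∀ f : K →ₐ[ℂ] K, f x = a → f y = b → f z = x)
    (hw : ∀ f : K →ₐ[ℂ] K, f x = a → f y = b → f w = y) : ∃ f : K ≃ₐ[ℂ] K, f x = a ∧ f y = b := by
  obtain ⟨f, h0, h1⟩ := hom_of_ind h
  have hs : Function.Surjective f := by
    intro u
    obtain ⟨p, q, hq, rfl⟩ := IsFractionRing.div_surjective (A := RR) u
    have : ∀ p : RR, f (aeval ![z, w] p) = ι p := by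
      intro p
      have : f.comp (aeval ![z, w]) = IsScalarTower.toAlgHom ℂ RR K := by
        ext i; fin_cases i
        · simpa using hz f h0 h1
        · simpa using hw f h0 h1
      exact DFunLike.congr_fun this p
    exact ⟨aeval ![z, w] p / aeval ![z, w] q, by rw [map_div₀, this, this]⟩
  exact ⟨AlgEquiv.ofBijective f ⟨f.injective, hs⟩, h0, h1⟩

variable (K) in
lemma J_base : ∃ D E : Derivation ℂ K K, D x = 1 ∧ D y = 0 ∧ E x = 0 ∧ E y = 1 := by
  obtain ⟨D, h1, h2⟩ := der_exists (K := K) 1 0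
  obtain ⟨E, h3, h4⟩ := der_exists (K := K) 0 1
  exact ⟨D, E, h1, h2, h3, h4⟩

variable (K) in
lemma ex_trans (α : ℂ) : ∃ f : K ≃ₐ[ℂ] K, f x = x + algebraMap ℂ K α ∧ f y = y := by
  obtain ⟨D, E, h1, h2, h3, h4⟩ := J_base K
  refine mk_aut (ind_of_J (D := D) (E := E) ?_) (x - algebraMap ℂ K α) y ?_ ?_
  · simp [JJ, h1, h2, h3, h4]
  · intro f hx hy; rw [map_sub, hx, AlgHom.commutes]; ring
  · intro f hx hy; exact hy

variable (K) in
lemma ex_lin : ∃ f : K ≃ₐ[ℂ] K, f x = x + y ∧ f y = y := by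
  obtain ⟨D, E, h1, h2, h3, h4⟩ := J_base K
  refine mk_aut (ind_of_J (D := D) (E := E) ?_) (x - y) y ?_ ?_
  · simp [JJ, h1, h2, h3, h4]
  · intro f hx hy; rw [map_sub, hx, hy]; ring
  · intro f hx hy; exact hy

variable (K) in
lemma ex_swap : ∃ f : K ≃ₐ[ℂ] K, f x = y ∧ f y = x := by
  obtain ⟨D, E, h1, h2, h3, h4⟩ := J_base K
  refine mk_aut (ind_of_J (D := D) (E := E) ?_) y x ?_ ?_
  · simp [JJ, h1, h2, h3, h4]
  · intro f hx hy; exact hy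
  · intro f hx hy; exact hx

variable (K) in
lemma ex_scale (α : ℂ) (hα : α ≠ 0) : ∃ f : K ≃ₐ[ℂ] K, f x = algebraMap ℂ K α * x ∧ f y = y := by
  obtain ⟨D, E, h1, h2, h3, h4⟩ := J_base K
  have h : algebraMap ℂ K α ≠ 0 := by simpa using hα
  refine mk_aut (ind_of_J (D := D) (E := E) ?_) ((algebraMap ℂ K α)⁻¹ * x) y ?_ ?_
  · simp [JJ, h1, h2, h3, h4, hα]
  · intro f hx hy; rw [map_mul, map_inv₀, hx, AlgHom.commutes]; field_simp
  · intro f hx hy; exact hy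

variable (K) in
lemma ex_rot : ∃ f : K ≃ₐ[ℂ] K, f x = x⁻¹ ∧ f y = y / x := by
  obtain ⟨D, E, h1, h2, h3, h4⟩ := J_base K
  have hx0 := x_ne (K := K)
  refine mk_aut (ind_of_J (D := D) (E := E) ?_) x⁻¹ (y / x) ?_ ?_
  · rw [J_rot _ _ _ _ hx0]; simp only [JJ, h1, h2, h3, h4]; simp [hx0]
  · intro f hx hy; rw [map_inv₀, hx, inv_inv]
  · intro f hx hy; rw [map_div₀, hx, hy]; field_simp

variable (K) in
structure Gen (G : Subgroup (K ≃ₐ[ℂ] K)) : Prop where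
  trans : ∀ (α : ℂ) (f : K ≃ₐ[ℂ] K), f x = x + algebraMap ℂ K α → f y = y → f ∈ G
  lin : ∀ (f : K ≃ₐ[ℂ] K), f x = x + y → f y = y → f ∈ G
  swap : ∀ (f : K ≃ₐ[ℂ] K), f x = y → f y = x → f ∈ G
  scale : ∀ (α : ℂ) (f : K ≃ₐ[ℂ] K), α ≠ 0 → f x = algebraMap ℂ K α * x → f y = y → f ∈ G
  rot : ∀ (f : K ≃ₐ[ℂ] K), f x = x⁻¹ → f y = y / x → f ∈ G
  inv : ∃ f ∈ G, f x = x⁻¹ ∧ f y = y⁻¹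

variable {G : Subgroup (K ≃ₐ[ℂ] K)} (hG : Gen K G)
include hG

lemma g_trans (α : ℂ) : ∃ f ∈ G, f x = x + algebraMap ℂ K α ∧ f y = y := by
  obtain ⟨f, h1, h2⟩ := ex_trans K α; exact ⟨f, hG.trans α f h1 h2, h1, h2⟩

lemma g_swap : ∃ f ∈ G, f x = y ∧ f y = x := by
  obtain ⟨f, h1, h2⟩ := ex_swap K; exact ⟨f, hG.swap f h1 h2, h1, h2⟩

/-- swap conjugation -/
lemma g_conj {a : K} (h : ∃ f ∈ G, f x = x ∧ f y = a) : ∃ s ∈ G, s x = y ∧ s y = x ∧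
    ∃ f ∈ G, f x = s a ∧ f y = y := by
  obtain ⟨s, hs, s1, s2⟩ := g_swap hG
  obtain ⟨f, hf, f1, f2⟩ := h
  refine ⟨s, hs, s1, s2, s * f * s, G.mul_mem (G.mul_mem hs hf) hs, ?_, ?_⟩
  · simp [AlgEquiv.mul_apply, s1, f2]
  · simp [AlgEquiv.mul_apply, s2, f1, s1]

lemma g_U : ∃ f ∈ G, f x = x ∧ f y = x / y := by
  obtain ⟨r, r1, r2⟩ := ex_rot K
  obtain ⟨σ, hσ, s1, s2⟩ := hG.inv
  refine ⟨r * σ, G.mul_mem (hG.rot r r1 r2) hσ, ?_, ?_⟩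
  · simp [AlgEquiv.mul_apply, r1, s1]
  · simp [AlgEquiv.mul_apply, r1, r2, s2]

lemma g_I : ∃ f ∈ G, f x = x⁻¹ ∧ f y = y := by
  obtain ⟨s, hs, s1, s2, u, hu, u1, u2⟩ := g_conj hG (g_U hG)
  rw [map_div₀, s1, s2] at u1
  obtain ⟨l, l1, l2⟩ := ex_lin K
  obtain ⟨t, ht, t1, t2⟩ := g_trans hG (-1)
  obtain ⟨c, c1, c2⟩ := ex_scale K (-1) (by simp)
  have hl := hG.lin l l1 l2
  have hc := hG.scale (-1) c (by simp) c1 c2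
  have hx := x_ne (K := K)
  have hy := y_ne (K := K)
  simp only [map_neg, map_one, neg_mul, one_mul] at t1 c1
  have hm1 : (u * l * u) x = x / (1 + x) := by
    simp only [AlgEquiv.mul_apply, u1, map_div₀, l1, l2, u2, map_add]
    field_simp
  have hm2 : (u * l * u) y = y := by simp [AlgEquiv.mul_apply, u2, l2]
  have hm := G.mul_mem (G.mul_mem hu hl) hu
  generalize u * l * u = m at hm1 hm2 hm
  have h1x : (1 : K) + x ≠ 0 := by
    intro h
    have h3 : m x = 0 := by rw [hm1, h, div_zero]
    exact hx ((map_eq_zero_iff _ m.injective).1 h3)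
  refine ⟨c * (t * m * t), G.mul_mem hc (G.mul_mem (G.mul_mem ht hm) ht), ?_, ?_⟩
  · have : m (t x) = - (1 + x)⁻¹ := by
      rw [t1, map_add, hm1, map_neg, map_one]; field_simp; ring
    rw [AlgEquiv.mul_apply, AlgEquiv.mul_apply, AlgEquiv.mul_apply, this]
    simp only [map_neg, map_inv₀, map_add, map_one, t1, c1]
    rw [← inv_neg]; congr 1; ring
  · simp [AlgEquiv.mul_apply, t2, hm2, c2]

lemma g_I' : ∃ f ∈ G, f x = x ∧ f y = y⁻¹ := by
  obtain ⟨s, hs, s1, s2⟩ := g_swap hG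
  obtain ⟨f, hf, f1, f2⟩ := g_I hG
  refine ⟨s * f * s, G.mul_mem (G.mul_mem hs hf) hs, ?_, ?_⟩
  · simp [AlgEquiv.mul_apply, s1, f2, s2]
  · simp [AlgEquiv.mul_apply, s2, f1, s1]

lemma g_dx : ∃ f ∈ G, f x = x ∧ f y = x * y := by
  obtain ⟨u, hu, u1, u2⟩ := g_U hG
  obtain ⟨i, hi, i1, i2⟩ := g_I' hG
  refine ⟨i * u, G.mul_mem hi hu, ?_, ?_⟩
  · simp [AlgEquiv.mul_apply, u1, i1]
  · simp [AlgEquiv.mul_apply, u2, i1, i2, div_eq_mul_inv]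

lemma g_div : ∃ f ∈ G, f x = x / y ∧ f y = y := by
  obtain ⟨s, hs, s1, s2, u, hu, u1, u2⟩ := g_conj hG (g_U hG)
  obtain ⟨i, hi, i1, i2⟩ := g_I hG
  rw [map_div₀, s1, s2] at u1
  refine ⟨u * i, G.mul_mem hu hi, ?_, ?_⟩
  · simp [AlgEquiv.mul_apply, u1, i1]
  · simp [AlgEquiv.mul_apply, u2, i2]

/-- x+α multiplier -/
lemma g_dxa (α : ℂ) : ∃ f ∈ G, f x = x ∧ f y = (x + algebraMap ℂ K α) * y := by
  obtain ⟨d, hd, d1, d2⟩ := g_dx hG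
  obtain ⟨t, ht, t1, t2⟩ := g_trans hG α
  obtain ⟨t', ht', t1', t2'⟩ := g_trans hG (-α)
  refine ⟨t * d * t', G.mul_mem (G.mul_mem ht hd) ht', ?_, ?_⟩
  · simp [AlgEquiv.mul_apply, t1', d1, t1]
  · simp [AlgEquiv.mul_apply, t2', d2, t1, t2]

lemma g_dc (α : ℂ) (hα : α ≠ 0) : ∃ f ∈ G, f x = x ∧ f y = algebraMap ℂ K α * y := by
  obtain ⟨s, hs, s1, s2⟩ := g_swap hG
  obtain ⟨f, f1, f2⟩ := ex_scale K α hα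
  refine ⟨s * f * s, G.mul_mem (G.mul_mem hs (hG.scale α f hα f1 f2)) hs, ?_, ?_⟩
  · simp [AlgEquiv.mul_apply, s1, f2, s2]
  · simp [AlgEquiv.mul_apply, s2, f1, s1]

omit hG in
lemma fix_k {f : K ≃ₐ[ℂ] K} (hf : f x = x) {z : K} (hz : z ∈ IntermediateField.adjoin ℂ {x}) : f z = z := by
  rw [IntermediateField.mem_adjoin_simple_iff] at hz
  obtain ⟨r, s, rfl⟩ := hz
  rw [map_div₀, ← Polynomial.aeval_algHom_apply, ← Polynomial.aeval_algHom_apply, hf]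

lemma g_dmul {r s : K} (hs : s ∈ IntermediateField.adjoin ℂ {x})
    (h1 : ∃ f ∈ G, f x = x ∧ f y = r * y) (h2 : ∃ f ∈ G, f x = x ∧ f y = s * y) :
    ∃ f ∈ G, f x = x ∧ f y = (r * s) * y := by
  obtain ⟨f, hf, f1, f2⟩ := h1
  obtain ⟨g, hg, g1, g2⟩ := h2
  refine ⟨f * g, G.mul_mem hf hg, ?_, ?_⟩
  · simp [AlgEquiv.mul_apply, f1, g1]
  · simp only [AlgEquiv.mul_apply, g2, map_mul, f2, fix_k f1 hs]; ring

lemma g_dinv {r : K} (hr : r ∈ IntermediateField.adjoin ℂ {x}) (h0 : r ≠ 0)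
    (h1 : ∃ f ∈ G, f x = x ∧ f y = r * y) :
    ∃ f ∈ G, f x = x ∧ f y = r⁻¹ * y := by
  obtain ⟨f, hf, f1, f2⟩ := h1
  refine ⟨f⁻¹, G.inv_mem hf, ?_, ?_⟩
  · rw [AlgEquiv.aut_inv, AlgEquiv.symm_apply_eq]; exact f1.symm
  · rw [AlgEquiv.aut_inv, AlgEquiv.symm_apply_eq, map_mul, map_inv₀, fix_k f1 hr, f2]; field_simp

lemma g_dp (p : Polynomial ℂ) (hp : p ≠ 0) :
    ∃ f ∈ G, f x = x ∧ f y = Polynomial.aeval x p * y := by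
  have h1 := (IsAlgClosed.splits p).eq_prod_roots
  have hm : ∀ q : Polynomial ℂ, Polynomial.aeval x q ∈ IntermediateField.adjoin ℂ {x} := fun q => by
    rw [IntermediateField.mem_adjoin_simple_iff]
    exact ⟨q, 1, by simp⟩
  rw [h1, map_mul, Polynomial.aeval_C]
  refine g_dmul hG (hm _) (g_dc hG _ (by simpa)) ?_
  generalize p.roots = m
  induction m using Multiset.induction_on with
  | empty => exact ⟨1, G.one_mem, by simp, by simp⟩
  | cons a m ih =>
    rw [Multiset.map_cons, Multiset.prod_cons, map_mul]
    refine g_dmul hG (hm _) ?_ ih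
    have := g_dxa hG (-a)
    simpa [sub_eq_add_neg] using this

lemma g_d {r : K} (hr : r ∈ IntermediateField.adjoin ℂ {x}) (h0 : r ≠ 0) :
    ∃ f ∈ G, f x = x ∧ f y = r * y := by
  have hr' := hr
  rw [IntermediateField.mem_adjoin_simple_iff] at hr
  obtain ⟨p, q, rfl⟩ := hr
  have hm : ∀ q : Polynomial ℂ, Polynomial.aeval x q ∈ IntermediateField.adjoin ℂ {x} := fun q => by
    rw [IntermediateField.mem_adjoin_simple_iff]
    exact ⟨q, 1, by simp⟩
  have hp : p ≠ 0 := by rintro rfl; simp at h0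
  have hq : q ≠ 0 := by rintro rfl; simp at h0
  have hq' : Polynomial.aeval x q ≠ 0 := fun h => by simp [h] at h0
  rw [div_eq_mul_inv]
  exact g_dmul hG (inv_mem (hm _)) (g_dp hG p hp) (g_dinv hG (hm _) hq' (g_dp hG q hq))

lemma g_add {w : K} (hw : w ∈ IntermediateField.adjoin ℂ {x}) : ∃ f ∈ G, f x = x ∧ f y = y + w := by
  by_cases h0 : w = 0
  · exact ⟨1, G.one_mem, by simp, by simp [h0]⟩
  obtain ⟨d, hd, d1, d2⟩ := g_d hG (inv_mem hw) (inv_ne_zero h0)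
  obtain ⟨d', hd', d1', d2'⟩ := g_d hG hw h0
  obtain ⟨s, hs, s1, s2⟩ := g_swap hG
  obtain ⟨t, ht, t1, t2⟩ := g_trans hG 1
  have ht1 : (s * t * s) x = x := by simp [AlgEquiv.mul_apply, s1, t2, s2]
  have ht2 : (s * t * s) y = y + 1 := by simp [AlgEquiv.mul_apply, s1, t1, s2]
  have hT := G.mul_mem (G.mul_mem hs ht) hs
  generalize s * t * s = T at ht1 ht2 hT
  refine ⟨d * T * d', G.mul_mem (G.mul_mem hd hT) hd', ?_, ?_⟩
  · simp [AlgEquiv.mul_apply, d1', ht1, d1]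
  · simp only [AlgEquiv.mul_apply, d2', map_mul, fix_k ht1 hw, fix_k d1 hw, ht2, map_add, d2, map_one]
    field_simp

lemma g_aff {u w : K} (hu : u ∈ IntermediateField.adjoin ℂ {x}) (h0 : u ≠ 0)
    (hw : w ∈ IntermediateField.adjoin ℂ {x}) : ∃ f ∈ G, f x = x ∧ f y = u * y + w := by
  obtain ⟨d, hd, d1, d2⟩ := g_d hG hu h0
  obtain ⟨t, ht, t1, t2⟩ := g_add hG hw
  refine ⟨d * t, G.mul_mem hd ht, ?_, ?_⟩
  · simp [AlgEquiv.mul_apply, t1, d1]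
  · simp only [AlgEquiv.mul_apply, t2, map_add, d2, fix_k d1 hw]

lemma g_mob {a b c d : K} (ha : a ∈ IntermediateField.adjoin ℂ {x}) (hb : b ∈ IntermediateField.adjoin ℂ {x})
    (hc : c ∈ IntermediateField.adjoin ℂ {x}) (hd : d ∈ IntermediateField.adjoin ℂ {x})
    (h : a * d - b * c ≠ 0) : ∃ f ∈ G, f x = x ∧ f y = (a * y + b) / (c * y + d) := by
  by_cases hc0 : c = 0
  · subst hc0
    have had : a ≠ 0 := fun h0 => by simp [h0] at h
    have hdd : d ≠ 0 := fun h0 => by simp [h0] at h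
    obtain ⟨f, hf, f1, f2⟩ := g_aff hG (div_mem ha hd) (div_ne_zero had hdd) (div_mem hb hd)
    refine ⟨f, hf, f1, ?_⟩
    rw [f2, zero_mul, zero_add]; field_simp
  · have hs : (b * c - a * d) / c ∈ IntermediateField.adjoin ℂ {x} :=
      div_mem (sub_mem (mul_mem hb hc) (mul_mem ha hd)) hc
    have hs0 : (b * c - a * d) / c ≠ 0 := div_ne_zero (fun h0 => h (by linear_combination -h0)) hc0
    obtain ⟨f, hf, f1, f2⟩ := g_aff hG hs hs0 (div_mem ha hc)
    obtain ⟨g, hg, g1, g2⟩ := g_aff hG hc hc0 hd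
    obtain ⟨i, hi, i1, i2⟩ := g_I' hG
    have hne : c * y + d ≠ 0 := by
      rw [← g2]; exact fun h0 => y_ne ((map_eq_zero_iff _ g.injective).1 h0)
    refine ⟨g * i * f, G.mul_mem (G.mul_mem hg hi) hf, ?_, ?_⟩
    · simp [AlgEquiv.mul_apply, f1, i1, g1]
    · simp only [AlgEquiv.mul_apply, f2, map_mul, map_add, fix_k i1 hs, fix_k g1 hs, fix_k i1 (div_mem ha hc),
        fix_k g1 (div_mem ha hc), i2, map_inv₀, g2]
      field_simp; ring
end AbsE

lemma max_of_coprime {I : Ideal (MvPolynomial (Fin 2) ℂ)} (hI : I.IsPrime) {p q : MvPolynomial (Fin 2) ℂ}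
    (hp : p ∈ I) (hq : q ∈ I) (hp0 : p ≠ 0) (h : IsRelPrime p q) : I.IsMaximal := by
  by_contra hM
  obtain ⟨m, hm, hIm⟩ := Ideal.exists_le_maximal I hI.ne_top
  have hlt : I < m := lt_of_le_of_ne hIm (fun e => hM (e ▸ hm))
  have hbot : I ≠ ⊥ := fun e => hp0 (by simpa [e] using hp)
  obtain ⟨π, hπI, hπ⟩ := hI.exists_mem_prime_of_ne_bot hbot
  have hs : Ideal.span {π} < I := by
    refine lt_of_le_of_ne ((Ideal.span_singleton_le_iff_mem I).2 hπI) (fun e => ?_)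
    rw [← e, Ideal.mem_span_singleton] at hp hq
    exact hπ.not_isUnit (h hp hq)
  have hsp : (Ideal.span {π}).IsPrime := (Ideal.span_singleton_prime hπ.ne_zero).2 hπ
  have hb : ⊥ < Ideal.span {π} := by
    rw [bot_lt_iff_ne_bot, Ne, Ideal.span_singleton_eq_bot]; exact hπ.ne_zero
  let s : LTSeries (PrimeSpectrum (MvPolynomial (Fin 2) ℂ)) := ⟨3, ![⟨⊥, Ideal.isPrime_bot⟩, ⟨Ideal.span {π}, hsp⟩,
    ⟨I, hI⟩, ⟨m, hm.isPrime⟩], by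
      intro i
      fin_cases i
      · exact hb
      · exact hs
      · exact hlt⟩
  have := Order.LTSeries.length_le_krullDim s
  change (3 : WithBot ℕ∞) ≤ ringKrullDim _ at this
  rw [MvPolynomial.ringKrullDim_of_isNoetherianRing, ringKrullDim_eq_zero_of_field] at this
  simp at this
  exact absurd this (by decide)

section AbsE2
variable {F : Type*} [Field F] [Algebra ℂ F]
lemma cop_of_relprime {X' Y : F} {p q : MvPolynomial (Fin 2) ℂ} (hp0 : p ≠ 0) (h : IsRelPrime p q) :
    Cop X' Y (aeval ![X', Y] p) (aeval ![X', Y] q) := by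
  intro v hv hX hY hp hq
  have hint : ∀ r : MvPolynomial (Fin 2) ℂ, v (aeval ![X', Y] r) ≤ 1 := by
    intro r
    induction r using MvPolynomial.induction_on with
    | C a => simpa using hv a
    | add a b ha hb => rw [map_add]; exact (v.map_add _ _).trans (max_le ha hb)
    | mul_X a i ha =>
      rw [map_mul, map_mul]
      refine mul_le_one' ha ?_
      fin_cases i
      · simp [hX]
      · simp [hY]
  let I : Ideal (MvPolynomial (Fin 2) ℂ) :=
    { carrier := {r | v (aeval ![X', Y] r) < 1}
      add_mem' := by
        intro a b ha hb
        change v _ < 1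
        rw [map_add]; exact v.map_add_lt ha hb
      zero_mem' := by change v _ < 1; simp
      smul_mem' := by
        intro c a ha
        change v _ < 1
        rw [smul_eq_mul, map_mul, map_mul]
        exact (mul_le_mul' (hint c) le_rfl).trans_lt (by rw [one_mul]; exact ha) }
  have hmem : ∀ r, r ∈ I ↔ v (aeval ![X', Y] r) < 1 := fun r => Iff.rfl
  have hI : I.IsPrime := by
    refine ⟨fun e => ?_, fun {a b} hab => ?_⟩
    · have := (Ideal.eq_top_iff_one I).1 e
      rw [hmem] at this; simp at this
    · rw [hmem, map_mul, map_mul] at hab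
      by_contra hc
      push Not at hc
      rw [hmem, hmem, not_lt, not_lt] at hc
      exact absurd hab (not_lt.2 (one_le_mul hc.1 hc.2))
  have hM := max_of_coprime hI ((hmem p).2 hp) ((hmem q).2 hq) hp0 h
  obtain ⟨w, hw⟩ := (MvPolynomial.isMaximal_iff_eq_vanishingIdeal_singleton).1 hM
  have key : ∀ i, (MvPolynomial.X i - C (w i)) ∈ I := by
    intro i
    rw [hw, mem_vanishingIdeal_singleton_iff]; simp
  refine ⟨⟨w 0, ?_⟩, ⟨w 1, ?_⟩⟩
  · have := (hmem _).1 (key 0); simpa using this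
  · have := (hmem _).1 (key 1); simpa using this
end AbsE2

/-- Möbius lemma -/
lemma mobius_rat {k : Type*} [Field k] (w : RatFunc k) (hw : IntermediateField.adjoin k {w} = ⊤) :
    ∃ a b c d : k, a * d - b * c ≠ 0 ∧ w = (algebraMap k (RatFunc k) a * RatFunc.X + algebraMap k (RatFunc k) b) /
      (algebraMap k (RatFunc k) c * RatFunc.X + algebraMap k (RatFunc k) d) := by
  have h := RatFunc.finrank_eq_max_natDegree w
  rw [hw, IntermediateField.finrank_top] at h
  have hn : w.num.natDegree ≤ 1 := by rw [h]; exact le_max_left _ _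
  have hd : w.denom.natDegree ≤ 1 := by rw [h]; exact le_max_right _ _
  obtain ⟨a, b, hab⟩ := Polynomial.exists_eq_X_add_C_of_natDegree_le_one hn
  obtain ⟨c, d, hcd⟩ := Polynomial.exists_eq_X_add_C_of_natDegree_le_one hd
  have e1 : algebraMap (Polynomial k) (RatFunc k) w.num = algebraMap k (RatFunc k) a * RatFunc.X + algebraMap k (RatFunc k) b := by
    rw [hab]; simp
  have e2 : algebraMap (Polynomial k) (RatFunc k) w.denom = algebraMap k (RatFunc k) c * RatFunc.X + algebraMap k (RatFunc k) d := by
    rw [hcd]; simp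
  refine ⟨a, b, c, d, fun h0 => ?_, ?_⟩
  · obtain ⟨u, v, huv⟩ := RatFunc.isCoprime_num_denom w
    have hm : max w.num.natDegree w.denom.natDegree = 1 := h.symm
    by_cases hc : c = 0
    · subst hc
      have : a * d = 0 := by linear_combination h0
      rcases mul_eq_zero.1 this with ha | hd0
      · subst ha; rw [hab, hcd] at hm; simp at hm
      · subst hd0; exact w.denom_ne_zero (by rw [hcd]; simp)
    · have r1 := congrArg (Polynomial.eval (-d / c)) huv
      have r2 : Polynomial.eval (-d / c) w.num = 0 := by
        rw [hab]; simp; field_simp; linear_combination -h0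
      have r3 : Polynomial.eval (-d / c) w.denom = 0 := by
        rw [hcd]; simp; field_simp; ring
      simp [r2, r3] at r1
  · rw [← e1, ← e2]; exact (RatFunc.num_div_denom w).symm

lemma mobius {k L : Type*} [Field k] [Field L] [Algebra k L] {T W : L} (hT : Transcendental k T)
    (h1 : W ∈ IntermediateField.adjoin k {T}) (h2 : T ∈ IntermediateField.adjoin k {W}) :
    ∃ a b c d : k, a * d - b * c ≠ 0 ∧ W = (algebraMap k L a * T + algebraMap k L b) /
      (algebraMap k L c * T + algebraMap k L d) := by
  let e := RatFunc.algEquivOfTranscendental T hT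
  have heX : (e RatFunc.X : L) = T := by
    rw [← RatFunc.algebraMap_X]; simp [e, RatFunc.algEquivOfTranscendental_algebraMap]
  let j : RatFunc k →ₐ[k] L := (IntermediateField.val _).comp e.toAlgHom
  have hj : ∀ z, j z = (e z : L) := fun z => rfl
  have hw : ∃ w, j w = W := ⟨e.symm ⟨W, h1⟩, by rw [hj, AlgEquiv.apply_symm_apply]⟩
  obtain ⟨w, hw⟩ := hw
  have htop : IntermediateField.adjoin k {w} = ⊤ := by
    rw [eq_top_iff, ← RatFunc.adjoin_X, IntermediateField.adjoin_simple_le_iff]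
    rw [IntermediateField.mem_adjoin_simple_iff] at h2 ⊢
    obtain ⟨r, s, hrs⟩ := h2
    have hinj : Function.Injective j := j.injective
    refine ⟨r, s, hinj ?_⟩
    rw [map_div₀, ← Polynomial.aeval_algHom_apply, ← Polynomial.aeval_algHom_apply, hw, hj, heX, hrs]
  obtain ⟨a, b, c, d, h0, hq⟩ := mobius_rat w htop
  refine ⟨a, b, c, d, h0, ?_⟩
  rw [← hw, hq, map_div₀, map_add, map_add, map_mul, map_mul, hj RatFunc.X, heX]
  simp only [AlgHom.commutes]

lemma alg_closed_in {k L : Type*} [Field k] [Field L] [Algebra k L] {T z : L} (hT : Transcendental k T)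
    (h1 : z ∈ IntermediateField.adjoin k {T}) (h2 : IsAlgebraic k z) : ∃ c, algebraMap k L c = z := by
  let e := RatFunc.algEquivOfTranscendental T hT
  let j : RatFunc k →ₐ[k] L := (IntermediateField.val _).comp e.toAlgHom
  have hj : ∀ z, j z = (e z : L) := fun z => rfl
  have hw : ∃ w, j w = z := ⟨e.symm ⟨z, h1⟩, by rw [hj, AlgEquiv.apply_symm_apply]⟩
  obtain ⟨w, hw⟩ := hw
  have h3 : IsAlgebraic k w := by
    rw [← hw] at h2
    exact (isAlgebraic_algHom_iff j j.injective).1 h2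
  by_contra hc
  refine RatFunc.transcendental_of_ne_C w ?_ h3
  rintro ⟨c, rfl⟩
  exact hc ⟨c, by rw [← hw, ← RatFunc.algebraMap_eq_C, AlgHom.commutes]⟩

section AbsF
variable {K : Type*} [Field K] [Algebra (MvPolynomial (Fin 2) ℂ) K]
  [IsFractionRing (MvPolynomial (Fin 2) ℂ) K] [Algebra ℂ K] [IsScalarTower ℂ (MvPolynomial (Fin 2) ℂ) K]

local notation "RR" => MvPolynomial (Fin 2) ℂ
local notation "ι" => algebraMap (MvPolynomial (Fin 2) ℂ) K
local notation "x" => algebraMap (MvPolynomial (Fin 2) ℂ) K (X 0)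
local notation "y" => algebraMap (MvPolynomial (Fin 2) ℂ) K (X 1)
local notation "kk" => IntermediateField.adjoin ℂ {algebraMap (MvPolynomial (Fin 2) ℂ) K (X 0)}

lemma transc_of_shift {k L : Type*} [Field k] [Field L] [Algebra k L] [Algebra ℂ L] (z : L)
    (h : ∀ (p : Polynomial k) (α : ℂ), Polynomial.aeval z p = 0 → Polynomial.aeval (z + algebraMap ℂ L α) p = 0) :
    Transcendental k z := by
  rintro ⟨p, hp, hz⟩
  have hp' : p.map (algebraMap k L) ≠ 0 := by
    rwa [Ne, Polynomial.map_eq_zero_iff (algebraMap k L).injective]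
  refine hp' (Polynomial.eq_zero_of_infinite_isRoot _ ?_)
  have hinj : Function.Injective (fun α : ℂ => z + algebraMap ℂ L α) := fun a b hab =>
    (algebraMap ℂ L).injective (add_left_cancel hab)
  refine (Set.infinite_range_of_injective hinj).mono ?_
  rintro _ ⟨α, rfl⟩
  have := h p α hz
  change Polynomial.IsRoot _ _
  rw [Polynomial.IsRoot, Polynomial.eval_map_algebraMap]
  exact this

variable (K) in
lemma x_transc : Transcendental ℂ (x : K) := by
  refine transc_of_shift _ fun p α hz => ?_
  obtain ⟨f, f1, f2⟩ := ex_trans K α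
  rw [← f1]
  have := Polynomial.aeval_algHom_apply f x p
  rw [this, hz, map_zero]

lemma fix_aeval {f : K ≃ₐ[ℂ] K} (hf : f x = x) (z : K) (p : Polynomial kk) :
    f (Polynomial.aeval z p) = Polynomial.aeval (f z) p := by
  have h : ((f : K →+* K).comp (algebraMap kk K)) = algebraMap kk K := by
    ext c
    exact fix_k hf c.2
  have := Polynomial.hom_eval₂ p (algebraMap kk K) (f : K →+* K) z
  rw [h] at this
  exact this

variable {G : Subgroup (K ≃ₐ[ℂ] K)} (hG : Gen K G)

include hG in
lemma y_transc : Transcendental kk (y : K) := by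
  refine transc_of_shift _ fun p α hz => ?_
  obtain ⟨f, _, f1, f2⟩ := g_add hG (w := algebraMap ℂ K α) (algebraMap_mem _ α)
  rw [← f2, ← fix_aeval f1, hz, map_zero]

variable (K) in
lemma adj_top : IntermediateField.adjoin kk {(y : K)} = ⊤ := by
  rw [eq_top_iff]
  intro z _
  obtain ⟨p, q, hq, rfl⟩ := IsFractionRing.div_surjective (A := RR) z
  have h : ∀ p : RR, ι p ∈ IntermediateField.adjoin kk {(y : K)} := by
    intro p
    induction p using MvPolynomial.induction_on with
    | C a =>
      rw [← iota_C]
      exact algebraMap_mem (IntermediateField.adjoin kk {(y : K)}) (algebraMap ℂ kk a)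
    | add a b ha hb => rw [map_add]; exact add_mem ha hb
    | mul_X a i ha =>
      rw [map_mul]
      refine mul_mem ha ?_
      fin_cases i
      · exact algebraMap_mem (IntermediateField.adjoin kk {(y : K)})
          (⟨x, IntermediateField.mem_adjoin_simple_self ℂ _⟩ : kk)
      · exact IntermediateField.mem_adjoin_simple_self kk _
  exact div_mem (h p) (h q)

include hG in
lemma alg_k {z : K} (hz : IsAlgebraic kk z) : z ∈ kk := by
  obtain ⟨c, rfl⟩ := alg_closed_in (y_transc hG) (by rw [adj_top K]; trivial) hz
  exact c.2

include hG in
lemma fix_mem {η : K ≃ₐ[ℂ] K} (hη : η x = x) : η ∈ G := by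
  have hinv : η.symm x = x := by rw [AlgEquiv.symm_apply_eq]; exact hη.symm
  have h2 : y ∈ IntermediateField.adjoin kk {η y} := by
    have : η.symm y ∈ IntermediateField.adjoin kk {(y : K)} := by rw [adj_top K]; trivial
    rw [IntermediateField.mem_adjoin_simple_iff] at this ⊢
    obtain ⟨r, s, h⟩ := this
    refine ⟨r, s, ?_⟩
    rw [← fix_aeval hη, ← fix_aeval hη, ← map_div₀, ← h, AlgEquiv.apply_symm_apply]
  obtain ⟨a, b, c, d, h0, hW⟩ := mobius (y_transc hG) (W := η y) (by rw [adj_top K]; trivial) h2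
  obtain ⟨g, hg, g1, g2⟩ := g_mob hG a.2 b.2 c.2 d.2 (fun h => h0 (Subtype.ext h))
  have : η = g := aut_ext (hη.trans g1.symm) (hW.trans g2.symm)
  rw [this]; exact hg

include hG in
lemma finish {ψ : K ≃ₐ[ℂ] K} {p q : Polynomial ℂ} (h : x * Polynomial.aeval (ψ y) q = Polynomial.aeval (ψ y) p)
    (hq : Polynomial.aeval (ψ y) q ≠ 0) : ψ ∈ G := by
  have hY : ψ y ∈ kk := by
    apply alg_k hG
    refine ⟨p.map (algebraMap ℂ kk) -
      Polynomial.C (⟨x, IntermediateField.mem_adjoin_simple_self ℂ _⟩ : kk) * q.map (algebraMap ℂ kk), ?_, ?_⟩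
    · intro h0
      have hq0 : q ≠ 0 := by rintro rfl; simp at hq
      have hc := congrArg (fun r => Polynomial.coeff r q.natDegree) h0
      simp only [Polynomial.coeff_sub, Polynomial.coeff_map, Polynomial.coeff_C_mul, Polynomial.coeff_zero] at hc
      have hc2 := congrArg (algebraMap kk K) hc
      rw [map_sub, map_mul, map_zero, ← IsScalarTower.algebraMap_apply, ← IsScalarTower.algebraMap_apply] at hc2
      have hl : algebraMap ℂ K (q.coeff q.natDegree) ≠ 0 := by
        simpa using hq0
      have hx : x = algebraMap ℂ K (p.coeff q.natDegree / q.coeff q.natDegree) := by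
        rw [map_div₀, eq_div_iff hl]
        exact (sub_eq_zero.1 hc2).symm
      exact x_transc K (hx ▸ isAlgebraic_algebraMap _)
    · rw [map_sub, map_mul, Polynomial.aeval_map_algebraMap, Polynomial.aeval_map_algebraMap, Polynomial.aeval_C]
      exact sub_eq_zero.2 h.symm
  have hx : x ∈ IntermediateField.adjoin ℂ {ψ y} := by
    rw [IntermediateField.mem_adjoin_simple_iff]
    exact ⟨p, q, by rw [eq_div_iff hq]; exact h⟩
  obtain ⟨a, b, c, d, h0, hW⟩ := mobius (x_transc K) hY hx
  have hm : ∀ a : ℂ, algebraMap ℂ K a ∈ kk := fun a => algebraMap_mem _ a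
  obtain ⟨s, hs, s1, s2, m, hm, m1, m2⟩ := g_conj hG (g_mob hG (hm a) (hm b) (hm c) (hm d) (by
    rw [← map_mul, ← map_mul, ← map_sub]; exact (map_ne_zero _).2 h0))
  have hmx : m x = ψ y := by
    rw [m1, hW]; simp only [map_div₀, map_add, map_mul, AlgEquiv.commutes, s2]
  have : m⁻¹ * ψ * s ∈ G := by
    apply fix_mem hG
    rw [AlgEquiv.mul_apply, AlgEquiv.mul_apply, s1, ← hmx, AlgEquiv.aut_inv, AlgEquiv.symm_apply_apply]
  have h5 := G.mul_mem (G.mul_mem hm this) (G.inv_mem hs)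
  rwa [mul_assoc m⁻¹, mul_inv_cancel_left, mul_inv_cancel_right] at h5

include hG in
theorem main_abs (f : K ≃ₐ[ℂ] K) : f ∈ G := by
  obtain ⟨D, E, h1, h2, h3, h4⟩ := J_base K
  let φ : K ≃ₐ[ℂ] K := f⁻¹
  have hφ : ∀ z, φ (f z) = z := fun z => AlgEquiv.symm_apply_apply f z
  let O : K → K → Prop := fun A B => ∃ g ∈ G, φ (g x) = A ∧ φ (g y) = B
  have hO : Orbit D E O := by
    refine ⟨?_, ?_, ?_, ?_, ?_⟩
    · rintro _ _ ⟨g, hg, rfl, rfl⟩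
      obtain ⟨i, hi, i1, i2⟩ := g_I hG
      exact ⟨g * i, G.mul_mem hg hi, by simp only [AlgEquiv.mul_apply, i1, map_inv₀], by simp only [AlgEquiv.mul_apply, i2]⟩
    · rintro _ _ ⟨g, hg, rfl, rfl⟩
      obtain ⟨i, hi, i1, i2⟩ := g_swap hG
      exact ⟨g * i, G.mul_mem hg hi, by simp only [AlgEquiv.mul_apply, i1], by simp only [AlgEquiv.mul_apply, i2]⟩
    · rintro _ _ ⟨g, hg, rfl, rfl⟩
      obtain ⟨i, hi, i1, i2⟩ := g_div hG
      exact ⟨g * i, G.mul_mem hg hi, by simp only [AlgEquiv.mul_apply, i1, map_div₀], by simp only [AlgEquiv.mul_apply, i2]⟩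
    · rintro _ _ α ⟨g, hg, rfl, rfl⟩
      obtain ⟨i, hi, i1, i2⟩ := g_trans hG (-α)
      exact ⟨g * i, G.mul_mem hg hi, by
        simp only [AlgEquiv.mul_apply, i1, map_add, map_neg, AlgEquiv.commutes, sub_eq_add_neg], by simp only [AlgEquiv.mul_apply, i2]⟩
    · rintro _ _ ⟨g, hg, rfl, rfl⟩
      exact J_auto h1 h2 h3 h4 (φ * g)
  obtain ⟨τ, _, t1, t2⟩ := g_I' hG
  have hFin := final_zero h1 h2 h3 h4 τ t1 t2
  have hex : ∃ a n b X Y P Q, Dat O x (Box a n b) X Y P Q := by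
    let p : RR := IsFractionRing.num RR (f x)
    let q : RR := IsFractionRing.den RR (f x)
    have hq : q ≠ 0 := nonZeroDivisors.ne_zero (IsFractionRing.den RR (f x)).2
    have hpq : ι p / ι q = f x := IsFractionRing.mk'_num_den' RR (f x)
    have hqn : ι q ≠ 0 := by rwa [Ne, FaithfulSMul.algebraMap_eq_zero_iff]
    have hfx : f x ≠ 0 := fun h => x_ne ((map_eq_zero_iff _ f.injective).1 h)
    have hp : p ≠ 0 := by
      intro h; rw [← hpq, h, map_zero, zero_div] at hfx; exact hfx rfl
    have hae : ∀ r : RR, aeval ![φ x, φ y] r = φ (ι r) := by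
      intro r
      rw [← iota_aeval K r]
      have : ((φ : K →ₐ[ℂ] K).comp (aeval ![x, y])) = aeval ![φ x, φ y] := by
        ext i; fin_cases i <;> simp
      exact (DFunLike.congr_fun this r).symm
    have hbox : ∀ r : RR, r.totalDegree ≤ p.totalDegree + q.totalDegree →
        aeval ![φ x, φ y] r ∈ VV (φ x) (φ y) (Box ((p.totalDegree + q.totalDegree : ℕ) : ℤ) 0 ((p.totalDegree + q.totalDegree : ℕ) : ℤ)) := by
      intro r hr
      rw [VV_iff (fun e he => ⟨he.1, he.2.1⟩)]
      refine ⟨r, fun d hd => ?_, rfl⟩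
      have hl := le_totalDegree hd
      have h5 : ∑ i ∈ d.support, d i = d 0 + d 1 := by
        have := Finsupp.sum_fintype d (fun _ n => n) (by simp)
        simpa [Finsupp.sum] using this
      simp only [Finsupp.sum] at hl
      refine ⟨?_, ?_, ?_, ?_⟩ <;> dsimp only <;> push_cast <;> omega
    refine ⟨_, 0, _, φ x, φ y, _, _, ⟨1, G.one_mem, rfl, rfl⟩, hbox p (by omega), hbox q (by omega), ?_, ?_,
      cop_of_relprime hp (IsFractionRing.num_den_reduced RR (f x))⟩
    · rw [hae, hae, ← hφ x, ← map_mul, ← hpq, div_mul_cancel₀ _ hqn]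
    · rw [hae]; exact fun h => hqn ((map_eq_zero_iff _ φ.injective).1 h)
  obtain ⟨n, b, X', Y', P, Q, ⟨g, hg, rfl, rfl⟩, hP, hQ, hPQ, hQ0, -⟩ := noether_fano hO hFin hex
  have hS : ∀ e ∈ Box 0 n b, e.1 = 0 ∧ 0 ≤ e.2 := fun e he => ⟨le_antisymm he.2.2.1 he.1, he.2.1⟩
  obtain ⟨p, rfl⟩ := VV_poly hS hP
  obtain ⟨q, rfl⟩ := VV_poly hS hQ
  have : φ * g ∈ G := finish hG (ψ := φ * g) hPQ hQ0
  have h6 : φ ∈ G := by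
    have := G.mul_mem this (G.inv_mem hg)
    rwa [mul_inv_cancel_right] at this
  exact (G.inv_mem_iff).1 h6
end AbsF

lemma proj_mem (f : Cremona) (M : Matrix (Fin 3) (Fin 3) ℂ) (hM : M.det ≠ 0)
    (h1 : f xx = (cc (M 0 0) * xx + cc (M 0 1) * yy + cc (M 0 2)) / (cc (M 2 0) * xx + cc (M 2 1) * yy + cc (M 2 2)))
    (h2 : f yy = (cc (M 1 0) * xx + cc (M 1 1) * yy + cc (M 1 2)) / (cc (M 2 0) * xx + cc (M 2 1) * yy + cc (M 2 2))) :
    f ∈ projLinear :=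
  ⟨Matrix.GeneralLinearGroup.mkOfDetNeZero M hM, h1, h2⟩

lemma gen_K2 (σ : Cremona) (hσx : σ xx = xx⁻¹) (hσy : σ yy = yy⁻¹) :
    Gen K2 (Subgroup.closure ({σ} ∪ projLinear)) := by
  have hp : ∀ f ∈ projLinear, f ∈ Subgroup.closure ({σ} ∪ projLinear) := fun f hf =>
    Subgroup.subset_closure (Or.inr hf)
  have c0 : cc 0 = 0 := map_zero _
  have c1 : cc 1 = 1 := map_one _
  refine ⟨?_, ?_, ?_, ?_, ?_, ⟨σ, Subgroup.subset_closure (Or.inl rfl), hσx, hσy⟩⟩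
  · intro α f h1 h2
    refine hp _ (proj_mem f !![1, 0, α; 0, 1, 0; 0, 0, 1] (by simp [Matrix.det_fin_three]) ?_ ?_)
    · simp [c0, c1]; exact h1
    · simp [c0, c1]; exact h2
  · intro f h1 h2
    refine hp _ (proj_mem f !![1, 1, 0; 0, 1, 0; 0, 0, 1] (by simp [Matrix.det_fin_three]) ?_ ?_)
    · simp [c0, c1]; exact h1
    · simp [c0, c1]; exact h2
  · intro f h1 h2
    refine hp _ (proj_mem f !![0, 1, 0; 1, 0, 0; 0, 0, 1] (by simp [Matrix.det_fin_three]) ?_ ?_)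
    · simp [c0, c1]; exact h1
    · simp [c0, c1]; exact h2
  · intro α f hα h1 h2
    refine hp _ (proj_mem f !![α, 0, 0; 0, 1, 0; 0, 0, 1] (by simpa [Matrix.det_fin_three] using hα) ?_ ?_)
    · simp [c0, c1]; exact h1
    · simp [c0, c1]; exact h2
  · intro f h1 h2
    refine hp _ (proj_mem f !![0, 0, 1; 0, 1, 0; 1, 0, 0] (by simp [Matrix.det_fin_three]) ?_ ?_)
    · simp [c0, c1]; exact h1
    · simp [c0, c1]; exact h2

/-- **Noether's theorem.** The Cremona group is generated by the Cremona
involution `σ : x ↦ 1/x, y ↦ 1/y` together with the projective linear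
transformations. -/
theorem noether_generation (σ : Cremona) (hσx : σ xx = xx⁻¹) (hσy : σ yy = yy⁻¹) :
    Subgroup.closure ({σ} ∪ projLinear) = ⊤ := by
  rw [eq_top_iff]
  intro f _
  exact main_abs (gen_K2 σ hσx hσy) f
end
end

section
/- (Automorphisms of PGL₃(ℂ)) Every group automorphism of PGL₃(ℂ) is obtained by composing inner automorphisms, the contragredient involution u ↦ ᵗu⁻¹ (inverse transpose), and automorphisms induced by field automorphisms of ℂ acting entrywise on matrices. Concretely: for every group automorphism φ of PGL₃(ℂ) there exist ψ ∈ PGL₃(ℂ) and a field automorphism κ of ℂ such that either φ(u) = ψ κ(u) ψ⁻¹ for all u, or φ(u) = ψ κ(ᵗu⁻¹) ψ⁻¹ for all u, where κ(u) denotes the class of the matrix obtained by applying κ to each entry of a representative of u. -/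
open Matrix

noncomputable section

/-- `PGL₃(ℂ)`: the quotient of `GL₃(ℂ)` by its center. -/
abbrev PGL3 : Type := GL (Fin 3) ℂ ⧸ Subgroup.center (GL (Fin 3) ℂ)

/-- The quotient map `GL₃(ℂ) → PGL₃(ℂ)`. -/
def pglMk : GL (Fin 3) ℂ →* PGL3 := QuotientGroup.mk' _

/-- The entrywise action of a field automorphism `κ` of `ℂ` on `GL₃(ℂ)`. -/
def glMapField (κ : ℂ ≃+* ℂ) : GL (Fin 3) ℂ →* GL (Fin 3) ℂ :=
  Units.map (RingHom.mapMatrix κ.toRingHom).toMonoidHom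

/-- The transpose of an element of `GL₃(ℂ)`. -/
def glTranspose (M : GL (Fin 3) ℂ) : GL (Fin 3) ℂ :=
  ⟨(M : Matrix (Fin 3) (Fin 3) ℂ)ᵀ, (M.inv)ᵀ,
    by rw [← Matrix.transpose_mul, M.inv_val, Matrix.transpose_one],
    by rw [← Matrix.transpose_mul, M.val_inv, Matrix.transpose_one]⟩

abbrev M3 := Matrix (Fin 3) (Fin 3) ℂ

theorem mk_eq (A B : GL (Fin 3) ℂ) :
    pglMk A = pglMk B ↔ ∃ r : ℂ, (A : M3) = r • (B : M3) := by
  unfold pglMk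
  rw [QuotientGroup.mk'_apply, QuotientGroup.mk'_apply, eq_comm, QuotientGroup.eq,
    Matrix.GeneralLinearGroup.mem_center_iff_val_mem_range_scalar]
  constructor
  · rintro ⟨r, hr⟩
    refine ⟨r, ?_⟩
    have h : (A : M3) = (B : M3) * ((B⁻¹ * A : GL (Fin 3) ℂ) : M3) := by
      rw [← Units.val_mul]; simp
    rw [h, ← hr]
    ext i j
    simp [mul_comm]
  · rintro ⟨r, hr⟩
    refine ⟨r, ?_⟩
    rw [Units.val_mul, hr, Matrix.mul_smul, ← Units.val_mul]
    ext i j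
    simp [Matrix.one_apply, Matrix.diagonal_apply]

theorem mk_surj (x : PGL3) : ∃ A, pglMk A = x := QuotientGroup.mk'_surjective _ x

theorem sq_lift (x : PGL3) (hx : x * x = 1) :
    ∃ g : GL (Fin 3) ℂ, pglMk g = x ∧ (g : M3) * g = 1 := by
  obtain ⟨A, rfl⟩ := mk_surj x
  rw [← map_mul, ← map_one pglMk, mk_eq] at hx
  obtain ⟨r, hr⟩ := hx
  have hr0 : r ≠ 0 := by
    rintro rfl
    rw [zero_smul] at hr
    exact (A * A).ne_zero hr
  obtain ⟨s, hs⟩ := IsAlgClosed.exists_pow_nat_eq r (n := 2) (by norm_num)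
  have hs0 : s ≠ 0 := by rintro rfl; simp at hs; exact hr0 hs.symm
  have key : (s⁻¹ • (A : M3)) * (s⁻¹ • (A : M3)) = 1 := by
    rw [Units.val_mul] at hr
    rw [Matrix.smul_mul, Matrix.mul_smul, hr, ← hs, smul_smul, smul_smul]
    rw [show s⁻¹ * s⁻¹ * s ^ 2 = 1 by field_simp]
    simp
  refine ⟨⟨s⁻¹ • (A : M3), s⁻¹ • (A : M3), key, key⟩, ?_, key⟩
  rw [mk_eq]
  exact ⟨s⁻¹, rfl⟩

theorem comm_lift (A B : GL (Fin 3) ℂ) (hB : (B : M3) * B = 1)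
    (h : pglMk A * pglMk B = pglMk B * pglMk A) : (A : M3) * B = B * A := by
  rw [← map_mul, ← map_mul, mk_eq] at h
  obtain ⟨r, hr⟩ := h
  rw [Units.val_mul, Units.val_mul] at hr
  have h2 : (A : M3) = (r ^ 2) • (A : M3) := by
    calc (A : M3) = (A : M3) * B * B := by rw [mul_assoc, hB, mul_one]
      _ = r • (B * (A * B)) := by rw [← mul_assoc (B : M3) A B, ← Matrix.smul_mul, ← hr]
      _ = (r ^ 2) • ((B * B) * (A : M3)) := by rw [hr, Matrix.mul_smul, smul_smul, ← mul_assoc, pow_two]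
      _ = _ := by rw [hB, one_mul]
  have h3 := congrArg Matrix.det hr
  have dA : (A : M3).det ≠ 0 := by
    have := (Matrix.isUnit_iff_isUnit_det _).1 A.isUnit
    exact this.ne_zero
  have dB : (B : M3).det ≠ 0 := by
    have := (Matrix.isUnit_iff_isUnit_det _).1 B.isUnit
    exact this.ne_zero
  rw [Matrix.det_smul, Matrix.det_mul, Matrix.det_mul, Fintype.card_fin] at h3
  have r3 : r ^ 3 = 1 := by
    have : (r ^ 3 - 1) * (A.val.det * B.val.det) = 0 := by linear_combination -h3
    rcases mul_eq_zero.1 this with h | h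
    · linear_combination h
    · exact absurd h (mul_ne_zero dA dB)
  have r2 : r ^ 2 = 1 := by
    have : (r ^ 2 - 1) • (A : M3) = 0 := by rw [sub_smul, ← h2, one_smul, sub_self]
    rcases smul_eq_zero.1 this with h | h
    · linear_combination h
    · exact absurd h A.ne_zero
  have r1 : r = 1 := by linear_combination r3 - r * r2
  rw [hr, r1, one_smul]

theorem eigvec (g h : M3) (hg : g * g = 1) (hh : h * h = 1) (c : g * h = h * g) (e d : ℂ)
    (he : e * e = 1) (hd : d * d = 1) (hN : (1 + e • g) * (1 + d • h) ≠ 0) :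
    ∃ v : Fin 3 → ℂ, v ≠ 0 ∧ g *ᵥ v = e • v ∧ h *ᵥ v = d • v := by
  have : ∃ x, ((1 + e • g) * (1 + d • h)) *ᵥ x ≠ 0 := by
    by_contra! hx
    apply hN
    ext i j
    have := congrFun (hx (Pi.single j 1)) i
    simpa using this
  obtain ⟨x, hx⟩ := this
  have e1 : g * ((1 + e • g) * (1 + d • h)) = e • ((1 + e • g) * (1 + d • h)) := by
    rw [← mul_assoc, ← Matrix.smul_mul]
    congr 1
    rw [mul_add, Matrix.mul_smul, hg, smul_add, smul_smul, he, mul_one, one_smul, add_comm]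
  have c' : (1 + e • g) * (1 + d • h) = (1 + d • h) * (1 + e • g) := by
    simp only [mul_add, add_mul, mul_one, one_mul, Matrix.smul_mul, Matrix.mul_smul, c, smul_comm e d]
    abel
  have e2 : h * ((1 + e • g) * (1 + d • h)) = d • ((1 + e • g) * (1 + d • h)) := by
    rw [c', ← mul_assoc, ← Matrix.smul_mul]
    congr 1
    rw [mul_add, Matrix.mul_smul, hh, smul_add, smul_smul, hd, mul_one, one_smul, add_comm]
  refine ⟨_, hx, ?_, ?_⟩
  · rw [Matrix.mulVec_mulVec, e1, Matrix.smul_mulVec]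
  · rw [Matrix.mulVec_mulVec, e2, Matrix.smul_mulVec]

theorem signs (g h : M3)
    (sg : ∀ r : ℂ, g ≠ r • (1 : M3)) (sh : ∀ r : ℂ, h ≠ r • (1 : M3))
    (sgh : ∀ r : ℂ, g * h ≠ r • (1 : M3)) :
    ∃ e d : ℂ, e * e = 1 ∧ d * d = 1 ∧ (1 + e • g) * (1 + (-d) • h) ≠ 0 ∧
      (1 + (-e) • g) * (1 + d • h) ≠ 0 ∧ (1 + (-e) • g) * (1 + (-d) • h) ≠ 0 := by
  have aux : ∀ (k : M3) (r : ℂ), r * r = 1 → (2 : ℂ) • ((1 : M3) + r • k) = 0 → k = (-r) • (1 : M3) := by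
    intro k r hr h0
    have h1 : (1 : M3) + r • k = 0 := by
      rcases smul_eq_zero.1 h0 with h | h
      · norm_num at h
      · exact h
    have h2 : r • k = -1 := by rw [eq_neg_iff_add_eq_zero, add_comm]; exact h1
    calc k = (r * r) • k := by rw [hr, one_smul]
      _ = _ := by rw [← smul_smul, h2]; simp
  by_cases H : ∃ e d : ℂ, e * e = 1 ∧ d * d = 1 ∧ (1 + e • g) * (1 + d • h) = 0
  · obtain ⟨e, d, he, hd, h0⟩ := H
    refine ⟨e, d, he, hd, ?_, ?_, ?_⟩
    · intro h1
      refine sg _ (aux g e he ?_)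
      calc _ = (1 + e • g) * (1 + d • h) + (1 + e • g) * (1 + (-d) • h) := by
            simp only [mul_add, add_mul, mul_one, one_mul, Matrix.smul_mul, Matrix.mul_smul]; module
        _ = 0 := by rw [h0, h1, add_zero]
    · intro h1
      refine sh _ (aux h d hd ?_)
      calc _ = (1 + e • g) * (1 + d • h) + (1 + (-e) • g) * (1 + d • h) := by
            simp only [mul_add, add_mul, mul_one, one_mul, Matrix.smul_mul, Matrix.mul_smul]; module
        _ = 0 := by rw [h0, h1, add_zero]
    · intro h1
      refine sgh _ (aux (g * h) (e * d) (by linear_combination d * d * he + hd) ?_)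
      calc _ = (1 + e • g) * (1 + d • h) + (1 + (-e) • g) * (1 + (-d) • h) := by
            simp only [mul_add, add_mul, mul_one, one_mul, Matrix.smul_mul, Matrix.mul_smul]; module
        _ = 0 := by rw [h0, h1, add_zero]
  · push Not at H
    exact ⟨1, 1, by simp, by simp, H _ _ (by simp) (by simp), H _ _ (by simp) (by simp),
      H _ _ (by simp) (by simp)⟩

def dg (a b c : ℂˣ) : GL (Fin 3) ℂ where
  val := !![(a : ℂ), 0, 0; 0, b, 0; 0, 0, c]
  inv := !![((a⁻¹ : ℂˣ) : ℂ), 0, 0; 0, (b⁻¹ : ℂˣ), 0; 0, 0, (c⁻¹ : ℂˣ)]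
  val_inv := by ext i j; fin_cases i <;> fin_cases j <;> simp [Matrix.mul_apply, Fin.sum_univ_three]
  inv_val := by ext i j; fin_cases i <;> fin_cases j <;> simp [Matrix.mul_apply, Fin.sum_univ_three]

def cM : GL (Fin 3) ℂ where
  val := !![0, 0, 1; 1, 0, 0; 0, 1, 0]
  inv := !![0, 1, 0; 0, 0, 1; 1, 0, 0]
  val_inv := by ext i j; fin_cases i <;> fin_cases j <;> simp [Matrix.mul_apply, Fin.sum_univ_three]
  inv_val := by ext i j; fin_cases i <;> fin_cases j <;> simp [Matrix.mul_apply, Fin.sum_univ_three]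

def wM : GL (Fin 3) ℂ where
  val := !![1, 0, 0; 0, 0, 1; 0, 1, 0]
  inv := !![1, 0, 0; 0, 0, 1; 0, 1, 0]
  val_inv := by ext i j; fin_cases i <;> fin_cases j <;> simp [Matrix.mul_apply, Fin.sum_univ_three]
  inv_val := by ext i j; fin_cases i <;> fin_cases j <;> simp [Matrix.mul_apply, Fin.sum_univ_three]

def uM (s : ℂ) : GL (Fin 3) ℂ where
  val := !![1, s, 0; 0, 1, 0; 0, 0, 1]
  inv := !![1, -s, 0; 0, 1, 0; 0, 0, 1]
  val_inv := by ext i j; fin_cases i <;> fin_cases j <;> simp [Matrix.mul_apply, Fin.sum_univ_three]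
  inv_val := by ext i j; fin_cases i <;> fin_cases j <;> simp [Matrix.mul_apply, Fin.sum_univ_three]

theorem dg_val (a b c : ℂˣ) : (dg a b c : M3) = !![(a : ℂ), 0, 0; 0, b, 0; 0, 0, c] := rfl
theorem cM_val : (cM : M3) = !![0, 0, 1; 1, 0, 0; 0, 1, 0] := rfl
theorem wM_val : (wM : M3) = !![1, 0, 0; 0, 0, 1; 0, 1, 0] := rfl
theorem uM_val (s : ℂ) : (uM s : M3) = !![1, s, 0; 0, 1, 0; 0, 0, 1] := rfl

theorem klein (g h : M3) (hg : g * g = 1) (hh : h * h = 1) (c : g * h = h * g)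
    (sg : ∀ r : ℂ, g ≠ r • (1 : M3)) (sh : ∀ r : ℂ, h ≠ r • (1 : M3))
    (sgh : ∀ r : ℂ, g * h ≠ r • (1 : M3)) :
    ∃ (p : GL (Fin 3) ℂ) (e d : ℂ), 
      g * p = e • ((p : M3) * dg 1 (-1) (-1)) ∧ h * p = d • ((p : M3) * dg (-1) 1 (-1)) := by
  obtain ⟨e, d, he, hd, h1, h2, h3⟩ := signs g h sg sh sgh
  obtain ⟨v1, n1, g1, k1⟩ := eigvec g h hg hh c _ _ he (by simpa using hd) h1
  obtain ⟨v2, n2, g2, k2⟩ := eigvec g h hg hh c _ _ (by simpa using he) hd h2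
  obtain ⟨v3, n3, g3, k3⟩ := eigvec g h hg hh c _ _ (by simpa using he) (by simpa using hd) h3
  have he0 : e ≠ 0 := by rintro rfl; simp at he
  have hd0 : d ≠ 0 := by rintro rfl; simp at hd
  let P : M3 := Matrix.of fun i j => ![v1 i, v2 i, v3 i] j
  have hP : ∀ x : Fin 3 → ℂ, P *ᵥ x = x 0 • v1 + x 1 • v2 + x 2 • v3 := by
    intro x; ext i; simp [P, Matrix.mulVec, dotProduct, Fin.sum_univ_three]; ring
  have hgP : g * P = e • (P * dg 1 (-1) (-1)) := by
    ext i j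
    have a1 := congrFun g1 i
    have a2 := congrFun g2 i
    have a3 := congrFun g3 i
    simp [Matrix.mulVec, dotProduct, Fin.sum_univ_three] at a1 a2 a3
    fin_cases j <;> simp [P, Matrix.mul_apply, Fin.sum_univ_three, dg_val, a1, a2, a3]
  have hhP : h * P = d • (P * dg (-1) 1 (-1)) := by
    ext i j
    have a1 := congrFun k1 i
    have a2 := congrFun k2 i
    have a3 := congrFun k3 i
    simp [Matrix.mulVec, dotProduct, Fin.sum_univ_three] at a1 a2 a3
    fin_cases j <;> simp [P, Matrix.mul_apply, Fin.sum_univ_three, dg_val, a1, a2, a3]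
  have det0 : P.det ≠ 0 := by
    intro h0
    obtain ⟨x, hx0, hx⟩ := Matrix.exists_mulVec_eq_zero_iff.2 h0
    rw [hP] at hx
    have hgx := congrArg (fun v => e • (g *ᵥ v)) hx
    have hhx := congrArg (fun v => d • (h *ᵥ v)) hx
    simp only [Matrix.mulVec_add, Matrix.mulVec_smul, g1, g2, g3, k1, k2, k3, Matrix.mulVec_zero, smul_zero] at hgx hhx
    apply hx0
    have A : ∀ i, x 0 * v1 i + x 1 * v2 i + x 2 * v3 i = 0 := fun i => by simpa using congrFun hx i
    have B : ∀ i, x 0 * v1 i - x 1 * v2 i - x 2 * v3 i = 0 := fun i => by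
      have := congrFun hgx i
      simp only [Pi.add_apply, Pi.smul_apply, smul_eq_mul, Pi.zero_apply] at this
      linear_combination this - (x 0 * v1 i - x 1 * v2 i - x 2 * v3 i) * he
    have C : ∀ i, -x 0 * v1 i + x 1 * v2 i - x 2 * v3 i = 0 := fun i => by
      have := congrFun hhx i
      simp only [Pi.add_apply, Pi.smul_apply, smul_eq_mul, Pi.zero_apply] at this
      linear_combination this - (-x 0 * v1 i + x 1 * v2 i - x 2 * v3 i) * hd
    have z0 : x 0 • v1 = 0 := by ext i; simp only [Pi.smul_apply, smul_eq_mul, Pi.zero_apply]; linear_combination (A i + B i) / 2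
    have z1 : x 1 • v2 = 0 := by ext i; simp only [Pi.smul_apply, smul_eq_mul, Pi.zero_apply]; linear_combination (A i + C i) / 2
    have z2 : x 2 • v3 = 0 := by ext i; simp only [Pi.smul_apply, smul_eq_mul, Pi.zero_apply]; linear_combination -(B i + C i) / 2
    have y0 := (smul_eq_zero.1 z0).resolve_right n1
    have y1 := (smul_eq_zero.1 z1).resolve_right n2
    have y2 := (smul_eq_zero.1 z2).resolve_right n3
    ext i; fin_cases i <;> simp [y0, y1, y2]
  exact ⟨Matrix.GeneralLinearGroup.mkOfDetNeZero P det0, e, d, hgP, hhP⟩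

theorem cM_inv_val : ((cM⁻¹ : GL (Fin 3) ℂ) : M3) = !![0, 1, 0; 0, 0, 1; 1, 0, 0] := rfl
theorem wM_inv_val : ((wM⁻¹ : GL (Fin 3) ℂ) : M3) = !![1, 0, 0; 0, 0, 1; 0, 1, 0] := rfl

theorem dg_mul (a b c a' b' c' : ℂˣ) : dg a b c * dg a' b' c' = dg (a * a') (b * b') (c * c') := by
  apply Units.ext
  rw [Units.val_mul, dg_val, dg_val, dg_val]
  ext i j; fin_cases i <;> fin_cases j <;> simp [Matrix.mul_apply, Fin.sum_univ_three]

theorem dg_one : dg 1 1 1 = 1 := by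
  apply Units.ext
  rw [dg_val, Units.val_one]
  ext i j; fin_cases i <;> fin_cases j <;> simp

theorem uM_mul (a b : ℂ) : uM a * uM b = uM (a + b) := by
  apply Units.ext
  rw [Units.val_mul, uM_val, uM_val, uM_val]
  ext i j; fin_cases i <;> fin_cases j <;> simp [Matrix.mul_apply, Fin.sum_univ_three, add_comm]

theorem uM_zero : uM 0 = 1 := by
  apply Units.ext
  rw [uM_val, Units.val_one]
  ext i j; fin_cases i <;> fin_cases j <;> simp

theorem dg_uM (y : ℂˣ) (b : ℂ) : dg y 1 1 * uM b = uM (y * b) * dg y 1 1 := by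
  apply Units.ext
  rw [Units.val_mul, Units.val_mul, uM_val, uM_val, dg_val]
  ext i j; fin_cases i <;> fin_cases j <;> simp [Matrix.mul_apply, Fin.sum_univ_three]

theorem uM_comm (s s' : ℂ) : uM s * (cM * uM s' * cM⁻¹) =
    (wM * uM (s * s') * wM⁻¹) * (cM * uM s' * cM⁻¹) * uM s := by
  apply Units.ext
  simp only [Units.val_mul, uM_val, wM_val, cM_val, wM_inv_val, cM_inv_val]
  ext i j; fin_cases i <;> fin_cases j <;> simp [Matrix.mul_apply, Fin.sum_univ_three]

theorem cM_dg (a b c : ℂˣ) : cM * dg a b c = dg c a b * cM := by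
  apply Units.ext
  rw [Units.val_mul, Units.val_mul, cM_val, dg_val, dg_val]
  ext i j; fin_cases i <;> fin_cases j <;> simp [Matrix.mul_apply, Fin.sum_univ_three]

theorem wM_dg (a b c : ℂˣ) : wM * dg a b c = dg a c b * wM := by
  apply Units.ext
  rw [Units.val_mul, Units.val_mul, wM_val, dg_val, dg_val]
  ext i j; fin_cases i <;> fin_cases j <;> simp [Matrix.mul_apply, Fin.sum_univ_three]

theorem wM_cM : cM * wM * cM = wM := by
  apply Units.ext
  rw [Units.val_mul, Units.val_mul, wM_val, cM_val]
  ext i j; fin_cases i <;> fin_cases j <;> simp [Matrix.mul_apply, Fin.sum_univ_three]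

theorem uM_inj {a b : ℂ} (h : pglMk (uM a) = pglMk (uM b)) : a = b := by
  obtain ⟨r, hr⟩ := (mk_eq _ _).1 h
  rw [uM_val, uM_val] at hr
  have h0 := congrFun (congrFun hr 0) 0
  have h1 := congrFun (congrFun hr 0) 1
  simp at h0 h1
  rw [h1, ← h0, one_mul]

theorem dg_inj {a b : ℂˣ} (h : pglMk (dg a 1 1) = pglMk (dg b 1 1)) : a = b := by
  obtain ⟨r, hr⟩ := (mk_eq _ _).1 h
  rw [dg_val, dg_val] at hr
  have h0 := congrFun (congrFun hr 0) 0
  have h1 := congrFun (congrFun hr 1) 1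
  simp at h0 h1
  apply Units.ext
  rw [h0, ← h1, one_mul]

theorem diag_of_comm (x : PGL3)
    (h1 : x * pglMk (dg (-1) 1 (-1)) = pglMk (dg (-1) 1 (-1)) * x)
    (h2 : x * pglMk (dg (-1) (-1) 1) = pglMk (dg (-1) (-1) 1) * x) :
    ∃ a b c, x = pglMk (dg a b c) := by
  obtain ⟨A, rfl⟩ := mk_surj x
  have e1 := comm_lift A _ (by rw [← Units.val_mul, dg_mul]; simp [dg_one]) h1
  have e2 := comm_lift A _ (by rw [← Units.val_mul, dg_mul]; simp [dg_one]) h2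
  rw [dg_val] at e1 e2
  have a01 := congrFun (congrFun e1 0) 1
  have a02 := congrFun (congrFun e2 0) 2
  have a10 := congrFun (congrFun e1 1) 0
  have a12 := congrFun (congrFun e1 1) 2
  have a20 := congrFun (congrFun e2 2) 0
  have a21 := congrFun (congrFun e1 2) 1
  simp [Matrix.mul_apply, Fin.sum_univ_three, self_eq_neg, neg_eq_self] at a01 a02 a10 a12 a20 a21
  have dA : (A : M3).det ≠ 0 := ((Matrix.isUnit_iff_isUnit_det _).1 A.isUnit).ne_zero
  rw [Matrix.det_fin_three] at dA
  simp only [a01, a02, a10, a12, a20, a21] at dA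
  have n0 : A.val 0 0 ≠ 0 := by intro h; simp [h] at dA
  have n1 : A.val 1 1 ≠ 0 := by intro h; simp [h] at dA
  have n2 : A.val 2 2 ≠ 0 := by intro h; simp [h] at dA
  refine ⟨Units.mk0 _ n0, Units.mk0 _ n1, Units.mk0 _ n2, ?_⟩
  congr 1
  apply Units.ext
  rw [dg_val]
  ext i j; fin_cases i <;> fin_cases j <;> simp [a01, a02, a10, a12, a20, a21]

structure PFix (φ : PGL3 ≃* PGL3) : Prop where
  g : φ (pglMk (dg 1 (-1) (-1))) = pglMk (dg 1 (-1) (-1))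
  h : φ (pglMk (dg (-1) 1 (-1))) = pglMk (dg (-1) 1 (-1))

theorem PFix.k {φ : PGL3 ≃* PGL3} (F : PFix φ) :
    φ (pglMk (dg (-1) (-1) 1)) = pglMk (dg (-1) (-1) 1) := by
  have : dg (-1) (-1) 1 = dg 1 (-1) (-1) * dg (-1) 1 (-1) := by rw [dg_mul]; simp
  rw [this, map_mul, map_mul, F.g, F.h]

theorem PFix.symm {φ : PGL3 ≃* PGL3} (F : PFix φ) : PFix φ.symm :=
  ⟨by rw [MulEquiv.symm_apply_eq, F.g], by rw [MulEquiv.symm_apply_eq, F.h]⟩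

theorem PFix.conj {φ : PGL3 ≃* PGL3} (F : PFix φ) (a b c : ℂˣ) :
    PFix (φ.trans (MulAut.conj (pglMk (dg a b c)))) := by
  constructor
  · simp only [MulEquiv.trans_apply, MulAut.conj_apply, F.g]
    rw [mul_inv_eq_iff_eq_mul, ← map_mul, ← map_mul, dg_mul, dg_mul]
    simp
  · simp only [MulEquiv.trans_apply, MulAut.conj_apply, F.h]
    rw [mul_inv_eq_iff_eq_mul, ← map_mul, ← map_mul, dg_mul, dg_mul]
    simp

theorem comm_aux {G : Type*} [Group G] (φ : G ≃* G) (c g h : G) (H : c * g = h * c)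
    (hg : φ g = g) (hh : φ h = h) : (φ c * c⁻¹) * h = h * (φ c * c⁻¹) := by
  have h1 : c⁻¹ * h = g * c⁻¹ := by
    rw [inv_mul_eq_iff_eq_mul, ← mul_assoc, H]; simp
  have h2 : φ c * g = h * φ c := by
    have := congrArg φ H
    rwa [map_mul, map_mul, hg, hh] at this
  rw [mul_assoc, h1, ← mul_assoc, h2, mul_assoc]

theorem PFix.c1 {φ : PGL3 ≃* PGL3} (F : PFix φ) :
    ∃ a b c, φ (pglMk cM) = pglMk (dg a b c) * pglMk cM := by
  obtain ⟨a, b, c, h⟩ := diag_of_comm (φ (pglMk cM) * (pglMk cM)⁻¹)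
    (comm_aux φ _ (pglMk (dg 1 (-1) (-1))) _ (by rw [← map_mul, ← map_mul, cM_dg]) F.g F.h)
    (comm_aux φ _ (pglMk (dg (-1) 1 (-1))) _ (by rw [← map_mul, ← map_mul, cM_dg]) F.h F.k)
  exact ⟨a, b, c, by rw [← h]; simp⟩

theorem PFix.w1 {φ : PGL3 ≃* PGL3} (F : PFix φ) :
    ∃ a b c, φ (pglMk wM) * (pglMk wM)⁻¹ = pglMk (dg a b c) := by
  exact diag_of_comm (φ (pglMk wM) * (pglMk wM)⁻¹)
    (comm_aux φ _ (pglMk (dg (-1) (-1) 1)) _ (by rw [← map_mul, ← map_mul, wM_dg]) F.k F.h)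
    (comm_aux φ _ (pglMk (dg (-1) 1 (-1))) _ (by rw [← map_mul, ← map_mul, wM_dg]) F.h F.k)

theorem PFix.c2 {φ : PGL3 ≃* PGL3} (F : PFix φ) :
    ∃ p : GL (Fin 3) ℂ, PFix (φ.trans (MulAut.conj (pglMk p))) ∧
      (φ.trans (MulAut.conj (pglMk p))) (pglMk cM) = pglMk cM := by
  obtain ⟨a, b, e, h⟩ := F.c1
  obtain ⟨m, hm⟩ := IsAlgClosed.exists_pow_nat_eq ((a * b * e : ℂˣ) : ℂ) (n := 3) (by norm_num)
  have hm0 : m ≠ 0 := by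
    rintro rfl
    rw [zero_pow (by norm_num)] at hm
    exact (a * b * e).ne_zero hm.symm
  refine ⟨dg 1 (Units.mk0 m hm0 / b) (Units.mk0 m hm0 ^ 2 / (b * e)), F.conj _ _ _, ?_⟩
  simp only [MulEquiv.trans_apply, MulAut.conj_apply, h]
  rw [mul_inv_eq_iff_eq_mul, ← map_mul, ← map_mul, ← map_mul, mk_eq]
  refine ⟨m, ?_⟩
  simp only [Units.val_mul, dg_val, cM_val]
  have hb := b.ne_zero
  have he := e.ne_zero
  push_cast at hm
  ext i j; fin_cases i <;> fin_cases j <;> simp [Matrix.mul_apply, Fin.sum_univ_three] <;> field_simp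
  linear_combination -hm

theorem PFix.w2 {φ : PGL3 ≃* PGL3} (F : PFix φ) (hc : φ (pglMk cM) = pglMk cM) :
    ∃ p : GL (Fin 3) ℂ, PFix (φ.trans (MulAut.conj (pglMk p))) ∧
      (φ.trans (MulAut.conj (pglMk p))) (pglMk cM) = pglMk cM ∧ 
      (φ.trans (MulAut.conj (pglMk p))) (pglMk wM) = pglMk wM := by
  obtain ⟨a, b, e, h⟩ := F.w1
  have hcw : pglMk wM * (pglMk cM)⁻¹ = pglMk cM * pglMk wM := by
    rw [mul_inv_eq_iff_eq_mul, ← map_mul, ← map_mul, wM_cM]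
  have H := comm_aux φ (pglMk wM) (pglMk cM)⁻¹ (pglMk cM) hcw (by rw [map_inv, hc]) hc
  rw [h] at H
  have H' := H
  rw [← map_mul, ← map_mul, mk_eq] at H
  obtain ⟨r, hr⟩ := H
  simp only [Units.val_mul, dg_val, cM_val] at hr
  have h0 := congrFun (congrFun hr 0) 2
  have h1 := congrFun (congrFun hr 1) 0
  have h2 := congrFun (congrFun hr 2) 1
  simp [Matrix.mul_apply, Fin.sum_univ_three] at h0 h1 h2
  have hw : φ (pglMk wM) = pglMk (dg a b e) * pglMk wM := by rw [← h]; simp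
  refine ⟨dg a b e, F.conj _ _ _, ?_, ?_⟩
  · simp only [MulEquiv.trans_apply, MulAut.conj_apply, hc]
    rw [mul_inv_eq_iff_eq_mul, H']
  · simp only [MulEquiv.trans_apply, MulAut.conj_apply, hw]
    rw [mul_inv_eq_iff_eq_mul, ← map_mul, ← map_mul, ← map_mul, mk_eq]
    refine ⟨a, ?_⟩
    simp only [Units.val_mul, dg_val, wM_val]
    have r3 : (a : ℂ) = r ^ 3 * a := by
      linear_combination h0 + r * h2 + r ^ 2 * h1
    have r3' : r ^ 3 = 1 := by
      have := a.ne_zero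
      field_simp at r3
      exact r3.symm
    ext i j; fin_cases i <;> fin_cases j <;> simp [Matrix.mul_apply, Fin.sum_univ_three]
    · linear_combination (-e : ℂ) * h0 - r * (e + r * b) * h2 - b ^ 2 * r3'
    · linear_combination (e : ℂ) * h2 - b * h0

structure PFix2 (φ : PGL3 ≃* PGL3) : Prop extends PFix φ where
  c : φ (pglMk cM) = pglMk cM
  w : φ (pglMk wM) = pglMk wM

theorem PFix2.symm {φ : PGL3 ≃* PGL3} (F : PFix2 φ) : PFix2 φ.symm :=
  ⟨F.toPFix.symm, by rw [MulEquiv.symm_apply_eq, F.c], by rw [MulEquiv.symm_apply_eq, F.w]⟩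

theorem PFix2.t {φ : PGL3 ≃* PGL3} (F : PFix2 φ) (s : ℂˣ) :
    ∃ y, φ (pglMk (dg s 1 1)) = pglMk (dg y 1 1) := by
  have hc : ∀ a b c : ℂˣ, pglMk (dg s 1 1) * pglMk (dg a b c) = pglMk (dg a b c) * pglMk (dg s 1 1) := by
    intro a b c
    rw [← map_mul, ← map_mul, dg_mul, dg_mul]; simp [mul_comm]
  obtain ⟨a, b, e, h⟩ := diag_of_comm (φ (pglMk (dg s 1 1)))
    (by have := congrArg φ (hc (-1) 1 (-1)); rwa [map_mul, map_mul, F.h] at this)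
    (by have := congrArg φ (hc (-1) (-1) 1); rwa [map_mul, map_mul, F.k] at this)
  have hw : pglMk wM * pglMk (dg s 1 1) = pglMk (dg s 1 1) * pglMk wM := by
    rw [← map_mul, ← map_mul, wM_dg]
  have hw' := congrArg φ hw
  rw [map_mul, map_mul, F.w, h, ← map_mul, ← map_mul, mk_eq] at hw'
  obtain ⟨r, hr⟩ := hw'
  simp only [Units.val_mul, dg_val, wM_val] at hr
  have h0 := congrFun (congrFun hr 0) 0
  have h1 := congrFun (congrFun hr 1) 2
  simp [Matrix.mul_apply, Fin.sum_univ_three] at h0 h1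
  rw [h0, one_mul] at h1
  refine ⟨a / b, ?_⟩
  rw [h, mk_eq]
  refine ⟨b, ?_⟩
  rw [dg_val, dg_val]
  ext i j; fin_cases i <;> fin_cases j <;> simp [h1]
  field_simp

theorem dg_conj (a b e : ℂˣ) :
    dg a b e = dg a 1 1 * (cM * dg b 1 1 * cM⁻¹) * (cM⁻¹ * dg e 1 1 * cM) := by
  rw [cM_dg, mul_inv_cancel_right, mul_assoc cM⁻¹, show dg e 1 1 * cM = cM * dg 1 1 e by rw [cM_dg],
    inv_mul_cancel_left, dg_mul, dg_mul]
  simp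

theorem PFix2.u {φ : PGL3 ≃* PGL3} (F : PFix2 φ) :
    ∃ b, φ (pglMk (uM 1)) = pglMk (uM b) ∨ φ (pglMk (uM 1)) = pglMk (glTranspose (uM b)) := by
  obtain ⟨y, hy⟩ := F.t (Units.mk0 2 two_ne_zero)
  have hy2 : y * y ≠ 1 := by
    intro h
    have h1 : φ (pglMk (dg (Units.mk0 2 two_ne_zero * Units.mk0 2 two_ne_zero) 1 1)) = pglMk (dg 1 1 1) := by
      have := dg_mul (Units.mk0 2 two_ne_zero) 1 1 (Units.mk0 2 two_ne_zero) 1 1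
      rw [one_mul] at this
      rw [← this, map_mul, map_mul, hy, ← map_mul, dg_mul, h, one_mul]
    rw [dg_one, map_one, map_eq_one_iff φ φ.injective, ← map_one pglMk, ← dg_one] at h1
    have := congrArg Units.val (dg_inj h1)
    norm_num at this
  obtain ⟨A, hA⟩ := mk_surj (φ (pglMk (uM 1)))
  have hk : pglMk (uM 1) * pglMk (dg (-1) (-1) 1) = pglMk (dg (-1) (-1) 1) * pglMk (uM 1) := by
    rw [← map_mul, ← map_mul]
    congr 1
    apply Units.ext
    rw [Units.val_mul, Units.val_mul, uM_val, dg_val]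
    ext i j; fin_cases i <;> fin_cases j <;> simp [Matrix.mul_apply, Fin.sum_univ_three]
  have hk' := congrArg φ hk
  rw [map_mul, map_mul, F.k, ← hA] at hk'
  have e2 := comm_lift A _ (by rw [← Units.val_mul, dg_mul]; simp [dg_one]) hk'
  rw [dg_val] at e2
  have a02 := congrFun (congrFun e2 0) 2
  have a12 := congrFun (congrFun e2 1) 2
  have a20 := congrFun (congrFun e2 2) 0
  have a21 := congrFun (congrFun e2 2) 1
  simp [Matrix.mul_apply, Fin.sum_univ_three, self_eq_neg, neg_eq_self] at a02 a12 a20 a21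
  have dA : (A : M3).det ≠ 0 := ((Matrix.isUnit_iff_isUnit_det _).1 A.isUnit).ne_zero
  rw [Matrix.det_fin_three] at dA
  simp only [a02, a12, a20, a21] at dA
  have n2 : A.val 2 2 ≠ 0 := by intro h; simp [h] at dA
  have hs : pglMk (dg (Units.mk0 2 two_ne_zero) 1 1) * pglMk (uM 1) =
      pglMk (uM 1) * pglMk (uM 1) * pglMk (dg (Units.mk0 2 two_ne_zero) 1 1) := by
    rw [← map_mul, ← map_mul, ← map_mul, dg_uM, uM_mul]
    norm_num
  have hs' := congrArg φ hs
  rw [map_mul, map_mul, map_mul, hy, ← hA, ← map_mul, ← map_mul, ← map_mul, mk_eq] at hs'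
  obtain ⟨r, hr⟩ := hs'
  simp only [Units.val_mul, dg_val] at hr
  have q00 := congrFun (congrFun hr 0) 0
  have q01 := congrFun (congrFun hr 0) 1
  have q10 := congrFun (congrFun hr 1) 0
  have q11 := congrFun (congrFun hr 1) 1
  have q22 := congrFun (congrFun hr 2) 2
  simp [Matrix.mul_apply, Fin.sum_univ_three, a02, a12, a20, a21] at q00 q01 q10 q11 q22
  have y0 := y.ne_zero
  have hre : r * A.val 2 2 = 1 := by
    apply mul_right_cancel₀ n2
    linear_combination -q22
  have hr0 : r ≠ 0 := left_ne_zero_of_mul_eq_one hre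
  have bc : A.val 0 1 = 0 ∨ A.val 1 0 = 0 := by
    by_contra! hne
    obtain ⟨hb, hc⟩ := hne
    apply hy2
    apply Units.ext
    have e1 : (y : ℂ) = r * (A.val 0 0 + A.val 1 1) := by
      apply mul_right_cancel₀ hb
      linear_combination q01
    have e2 : 1 = y * (r * (A.val 0 0 + A.val 1 1)) := by
      apply mul_right_cancel₀ hc
      linear_combination q10
    rw [← e1] at e2
    exact e2.symm
  have bc' : A.val 0 1 * A.val 1 0 = 0 := mul_eq_zero.2 bc
  have n0 : A.val 0 0 ≠ 0 := by
    intro h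
    apply dA
    rw [h]
    linear_combination -A.val 2 2 * bc'
  have n1 : A.val 1 1 ≠ 0 := by
    intro h
    apply dA
    rw [h]
    linear_combination -A.val 2 2 * bc'
  have ra : r * A.val 0 0 = 1 := by
    apply mul_right_cancel₀ n0
    apply mul_right_cancel₀ y0
    linear_combination -q00 - r * y * bc'
  have rd : r * A.val 1 1 = 1 := by
    apply mul_right_cancel₀ n1
    linear_combination -q11 - r * bc'
  have ea : A.val 0 0 = A.val 2 2 := mul_left_cancel₀ hr0 (ra.trans hre.symm)
  have ed : A.val 1 1 = A.val 2 2 := mul_left_cancel₀ hr0 (rd.trans hre.symm)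
  rw [← hA]
  rcases bc with hb | hc
  · refine ⟨A.val 1 0 / A.val 2 2, Or.inr ?_⟩
    rw [mk_eq]
    refine ⟨A.val 2 2, ?_⟩
    simp only [glTranspose, uM_val]
    ext i j; fin_cases i <;> fin_cases j <;> simp [hb, a02, a12, a20, a21, ea, ed]
    field_simp
  · refine ⟨A.val 0 1 / A.val 2 2, Or.inl ?_⟩
    rw [mk_eq]
    refine ⟨A.val 2 2, ?_⟩
    simp only [uM_val]
    ext i j; fin_cases i <;> fin_cases j <;> simp [hc, a02, a12, a20, a21, ea, ed]
    field_simp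

theorem gl_mem_of_gens (S : Subgroup (GL (Fin 3) ℂ)) (hc : cM ∈ S) (hw : wM ∈ S)
    (hd : ∀ s, dg s 1 1 ∈ S) (hu : ∀ s, uM s ∈ S) (G : GL (Fin 3) ℂ) : G ∈ S := by
  have key : ∀ N : M3, N.det ≠ 0 → ∀ G : GL (Fin 3) ℂ, (G : M3) = N → G ∈ S := by
    intro N hN
    refine Matrix.diagonal_transvection_induction_of_det_ne_zero
      (fun N => ∀ G : GL (Fin 3) ℂ, (G : M3) = N → G ∈ S) N hN ?_ ?_ ?_
    · intro D hD G hG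
      rw [Matrix.det_diagonal, Finset.prod_ne_zero_iff] at hD
      have : G = dg (Units.mk0 _ (hD 0 (Finset.mem_univ _))) (Units.mk0 _ (hD 1 (Finset.mem_univ _)))
          (Units.mk0 _ (hD 2 (Finset.mem_univ _))) := by
        apply Units.ext
        rw [hG, dg_val]
        ext i j; fin_cases i <;> fin_cases j <;> simp
      rw [this, dg_conj]
      exact S.mul_mem (S.mul_mem (hd _) (S.mul_mem (S.mul_mem hc (hd _)) (S.inv_mem hc)))
        (S.mul_mem (S.mul_mem (S.inv_mem hc) (hd _)) hc)
    · rintro ⟨i, j, hij, s⟩ G hG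
      have H : ∃ q ∈ S, G * q = q * uM s := by
        simp only [Matrix.TransvectionStruct.toMatrix] at hG
        fin_cases i <;> fin_cases j <;> simp at hij
        · refine ⟨1, S.one_mem, Units.ext ?_⟩
          rw [Units.val_mul, Units.val_mul, hG, Units.val_one, uM_val, mul_one, one_mul]
          ext i j; fin_cases i <;> fin_cases j <;> simp [Matrix.transvection, Matrix.single]
        · refine ⟨wM, hw, Units.ext ?_⟩
          rw [Units.val_mul, Units.val_mul, hG, uM_val, wM_val]
          ext i j; fin_cases i <;> fin_cases j <;>
            simp [Matrix.transvection, Matrix.single, Matrix.mul_apply, Fin.sum_univ_three]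
        · refine ⟨cM * wM, S.mul_mem hc hw, Units.ext ?_⟩
          simp only [Units.val_mul, hG, uM_val, wM_val, cM_val]
          ext i j; fin_cases i <;> fin_cases j <;>
            simp [Matrix.transvection, Matrix.single, Matrix.mul_apply, Fin.sum_univ_three]
        · refine ⟨cM, hc, Units.ext ?_⟩
          simp only [Units.val_mul, hG, uM_val, wM_val, cM_val]
          ext i j; fin_cases i <;> fin_cases j <;>
            simp [Matrix.transvection, Matrix.single, Matrix.mul_apply, Fin.sum_univ_three]
        · refine ⟨cM * cM, S.mul_mem hc hc, Units.ext ?_⟩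
          simp only [Units.val_mul, hG, uM_val, wM_val, cM_val]
          ext i j; fin_cases i <;> fin_cases j <;>
            simp [Matrix.transvection, Matrix.single, Matrix.mul_apply, Fin.sum_univ_three]
        · refine ⟨cM * cM * wM, S.mul_mem (S.mul_mem hc hc) hw, Units.ext ?_⟩
          simp only [Units.val_mul, hG, uM_val, wM_val, cM_val]
          ext i j; fin_cases i <;> fin_cases j <;>
            simp [Matrix.transvection, Matrix.single, Matrix.mul_apply, Fin.sum_univ_three]
      obtain ⟨q, hq, e⟩ := H
      have : G = q * uM s * q⁻¹ := by rw [← e]; simp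
      rw [this]
      exact S.mul_mem (S.mul_mem hq (hu s)) (S.inv_mem hq)
    · intro A B hA hB pA pB G hG
      have : G = Matrix.GeneralLinearGroup.mkOfDetNeZero A hA *
          Matrix.GeneralLinearGroup.mkOfDetNeZero B hB := Units.ext hG
      rw [this]
      exact S.mul_mem (pA _ rfl) (pB _ rfl)
  exact key G ((Matrix.isUnit_iff_isUnit_det _).1 G.isUnit).ne_zero G rfl

theorem glMap_val (κ : ℂ ≃+* ℂ) (A : GL (Fin 3) ℂ) (i j : Fin 3) :
    (glMapField κ A : M3) i j = κ ((A : M3) i j) := rfl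

theorem core {φ : PGL3 ≃* PGL3} (F : PFix2 φ) (b : ℂ) (hu : φ (pglMk (uM 1)) = pglMk (uM b)) :
    ∃ κ : ℂ ≃+* ℂ, ∀ M, φ (pglMk M) = pglMk (glMapField κ M) := by
  choose f hf using F.t
  have hb0 : b ≠ 0 := by
    rintro rfl
    rw [uM_zero, map_one, map_eq_one_iff φ φ.injective, ← map_one pglMk, ← uM_zero] at hu
    exact one_ne_zero (uM_inj hu)
  have hb1 : b = 1 := by
    have h1 := congrArg (fun x => φ (pglMk x)) (uM_comm 1 1)
    have h2 := congrArg pglMk (uM_comm b b)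
    simp only [map_mul, map_inv, F.c, F.w, hu, mul_one] at h1
    simp only [map_mul, map_inv] at h2
    rw [h1] at h2
    have h3 := mul_left_cancel (mul_right_cancel (mul_right_cancel (mul_right_cancel h2)))
    rw [← map_mul] at h2
    have h4 := uM_inj h3
    apply mul_left_cancel₀ hb0
    rw [← h4, mul_one]
  subst hb1
  have hfu : ∀ s : ℂˣ, φ (pglMk (uM s)) = pglMk (uM (f s)) := by
    intro s
    have h := congrArg (fun x => φ (pglMk x)) (dg_uM s 1)
    have h' := congrArg pglMk (dg_uM (f s) 1)
    simp only [map_mul, hf, hu, mul_one] at h h'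
    rw [h] at h'
    exact mul_right_cancel h'
  have hfm : ∀ s t, f (s * t) = f s * f t := by
    intro s t
    apply dg_inj
    have h := congrArg (fun x => φ (pglMk x)) (dg_mul s 1 1 t 1 1)
    have h' := congrArg pglMk (dg_mul (f s) 1 1 (f t) 1 1)
    simp only [map_mul, hf, one_mul] at h h'
    rw [← h, h']
  have hf1 : f 1 = 1 := by
    have := hfm 1 1
    rw [one_mul] at this
    exact (left_eq_mul.1 this)
  have hfs : ∀ y, ∃ s, f s = y := by
    intro y
    obtain ⟨s, hs⟩ := F.symm.t y
    refine ⟨s, dg_inj ?_⟩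
    rw [← hf, ← hs]; simp
  let K : ℂ → ℂ := fun s => if h : s = 0 then 0 else (f (Units.mk0 s h) : ℂ)
  have K0 : K 0 = 0 := by simp [K]
  have Kf : ∀ s : ℂˣ, K s = f s := by intro s; simp [K]
  have Ku : ∀ s, φ (pglMk (uM s)) = pglMk (uM (K s)) := by
    intro s
    by_cases h : s = 0
    · rw [h, K0, uM_zero, map_one, map_one]
    · have := hfu (Units.mk0 s h)
      rw [← Kf] at this
      exact this
  have Kadd : ∀ s t, K (s + t) = K s + K t := by
    intro s t
    apply uM_inj
    rw [← Ku, ← uM_mul, map_mul, map_mul, Ku, Ku, ← map_mul, uM_mul]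
  have Kmul : ∀ s t, K (s * t) = K s * K t := by
    intro s t
    by_cases h : s = 0
    · simp [h, K0]
    by_cases h' : t = 0
    · simp [h', K0]
    lift s to ℂˣ using isUnit_iff_ne_zero.2 h
    lift t to ℂˣ using isUnit_iff_ne_zero.2 h'
    rw [← Units.val_mul, Kf, Kf, Kf, hfm, Units.val_mul]
  have K1 : K 1 = 1 := by
    have := Kf 1
    rwa [hf1, Units.val_one] at this
  let k : ℂ →+* ℂ := { toFun := K, map_one' := K1, map_mul' := Kmul, map_zero' := K0, map_add' := Kadd }
  have kb : Function.Bijective k := by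
    refine ⟨k.injective, fun y => ?_⟩
    by_cases h : y = 0
    · exact ⟨0, by rw [h, map_zero]⟩
    · obtain ⟨s, hs⟩ := hfs (Units.mk0 y h)
      exact ⟨s, by change K s = y; rw [Kf, hs]; rfl⟩
  let κ : ℂ ≃+* ℂ := RingEquiv.ofBijective k kb
  have κK : ∀ s, κ s = K s := fun s => rfl
  refine ⟨κ, fun M => ?_⟩
  have := gl_mem_of_gens ((φ.toMonoidHom.comp pglMk).eqLocus (pglMk.comp (glMapField κ))) ?_ ?_ ?_ ?_ M
  · exact this
  · change φ (pglMk cM) = pglMk (glMapField κ cM)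
    rw [F.c]
    congr 1
    ext i j
    rw [glMap_val, cM_val]; fin_cases i <;> fin_cases j <;> simp
  · change φ (pglMk wM) = pglMk (glMapField κ wM)
    rw [F.w]
    congr 1
    ext i j
    rw [glMap_val, wM_val]; fin_cases i <;> fin_cases j <;> simp
  · intro s
    change φ (pglMk (dg s 1 1)) = pglMk (glMapField κ (dg s 1 1))
    rw [hf]
    congr 1
    ext i j
    rw [glMap_val, dg_val, dg_val]; fin_cases i <;> fin_cases j <;> simp [κK, Kf, K0, K1]
  · intro s
    change φ (pglMk (uM s)) = pglMk (glMapField κ (uM s))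
    rw [Ku]
    congr 1
    ext i j
    rw [glMap_val, uM_val, uM_val]; fin_cases i <;> fin_cases j <;> simp [κK, K0, K1]

theorem glT_val (M : GL (Fin 3) ℂ) : (glTranspose M : M3) = (M : M3)ᵀ := rfl

theorem glT_mul (A B : GL (Fin 3) ℂ) : glTranspose (A * B) = glTranspose B * glTranspose A := by
  apply Units.ext
  simp only [Units.val_mul, glT_val, Matrix.transpose_mul]

theorem glT_glT (A : GL (Fin 3) ℂ) : glTranspose (glTranspose A) = A := by
  apply Units.ext
  simp only [glT_val, Matrix.transpose_transpose]

theorem glT_inv (A : GL (Fin 3) ℂ) : glTranspose A⁻¹ = (glTranspose A)⁻¹ := by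
  apply Units.ext
  rfl

def ctr : GL (Fin 3) ℂ →* GL (Fin 3) ℂ where
  toFun A := (glTranspose A)⁻¹
  map_one' := by
    have : glTranspose 1 = 1 := by apply Units.ext; simp [glT_val]
    rw [this, inv_one]
  map_mul' A B := by rw [glT_mul, _root_.mul_inv_rev]

theorem ctr_ctr (A : GL (Fin 3) ℂ) : ctr (ctr A) = A := by
  change (glTranspose (glTranspose A)⁻¹)⁻¹ = A
  rw [glT_inv, glT_glT, inv_inv]

theorem mk_ctr {A B : GL (Fin 3) ℂ} (h : pglMk A = pglMk B) : pglMk (ctr A) = pglMk (ctr B) := by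
  change pglMk (glTranspose A)⁻¹ = pglMk (glTranspose B)⁻¹
  rw [map_inv, map_inv]
  congr 1
  rw [mk_eq] at h ⊢
  obtain ⟨r, hr⟩ := h
  exact ⟨r, by rw [glT_val, glT_val, hr, Matrix.transpose_smul]⟩

def pctrHom : PGL3 →* PGL3 :=
  QuotientGroup.lift _ (pglMk.comp ctr) (by
    intro x hx
    have h1 : pglMk x = pglMk 1 := by
      rw [map_one]; exact (QuotientGroup.eq_one_iff x).2 hx
    have := mk_ctr h1
    rwa [map_one, map_one] at this)

theorem pctrHom_mk (A : GL (Fin 3) ℂ) : pctrHom (pglMk A) = pglMk (ctr A) := rfl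

theorem pctrHom_invol (x : PGL3) : pctrHom (pctrHom x) = x := by
  obtain ⟨A, rfl⟩ := mk_surj x
  rw [pctrHom_mk, pctrHom_mk, ctr_ctr]

def pctr : PGL3 ≃* PGL3 where
  toFun := pctrHom
  invFun := pctrHom
  left_inv := pctrHom_invol
  right_inv := pctrHom_invol
  map_mul' := map_mul _

theorem pctr_mk (A : GL (Fin 3) ℂ) : pctr (pglMk A) = pglMk (ctr A) := rfl

theorem ctr_eq {A B : GL (Fin 3) ℂ} (h : B * glTranspose A = 1) : ctr A = B :=
  (eq_inv_of_mul_eq_one_left h).symm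

theorem ctr_dg (a b c : ℂˣ) : ctr (dg a b c) = dg a⁻¹ b⁻¹ c⁻¹ := by
  apply ctr_eq
  apply Units.ext
  rw [Units.val_mul, glT_val, dg_val, dg_val, Units.val_one]
  ext i j; fin_cases i <;> fin_cases j <;> simp [Matrix.mul_apply, Fin.sum_univ_three]

theorem ctr_cM : ctr cM = cM := by
  apply ctr_eq
  apply Units.ext
  rw [Units.val_mul, glT_val, cM_val, Units.val_one]
  ext i j; fin_cases i <;> fin_cases j <;> simp [Matrix.mul_apply, Fin.sum_univ_three]

theorem ctr_wM : ctr wM = wM := by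
  apply ctr_eq
  apply Units.ext
  rw [Units.val_mul, glT_val, wM_val, Units.val_one]
  ext i j; fin_cases i <;> fin_cases j <;> simp [Matrix.mul_apply, Fin.sum_univ_three]

theorem ctr_uM (s : ℂ) : ctr (glTranspose (uM s)) = uM (-s) := by
  apply ctr_eq
  rw [glT_glT, uM_mul, neg_add_cancel, uM_zero]

def Good (φ : PGL3 ≃* PGL3) : Prop := ∃ (ψ : GL (Fin 3) ℂ) (κ : ℂ ≃+* ℂ),
      (∀ M : GL (Fin 3) ℂ, φ (pglMk M) = pglMk (ψ * glMapField κ M * ψ⁻¹)) ∨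
      (∀ M : GL (Fin 3) ℂ, φ (pglMk M) = pglMk (ψ * glMapField κ (glTranspose M)⁻¹ * ψ⁻¹))

theorem good_conj {φ : PGL3 ≃* PGL3} (p : GL (Fin 3) ℂ)
    (h : Good (φ.trans (MulAut.conj (pglMk p)))) : Good φ := by
  obtain ⟨ψ, κ, h⟩ := h
  refine ⟨p⁻¹ * ψ, κ, ?_⟩
  have aux : ∀ x y : PGL3, pglMk p * x * (pglMk p)⁻¹ = pglMk ψ * y * (pglMk ψ)⁻¹ →
      x = (pglMk p)⁻¹ * pglMk ψ * y * ((pglMk p)⁻¹ * pglMk ψ)⁻¹ := by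
    intro x y hxy
    have : x = (pglMk p)⁻¹ * (pglMk p * x * (pglMk p)⁻¹) * pglMk p := by group
    rw [this, hxy]
    group
  refine h.imp (fun h M => ?_) (fun h M => ?_)
  · have := h M
    simp only [MulEquiv.trans_apply, MulAut.conj_apply] at this
    simp only [map_mul, map_inv] at this ⊢
    exact aux _ _ this
  · have := h M
    simp only [MulEquiv.trans_apply, MulAut.conj_apply] at this
    rw [map_mul, map_mul, map_inv pglMk ψ] at this
    rw [map_mul, map_mul, map_inv pglMk (p⁻¹ * ψ), map_mul, map_inv pglMk p]
    exact aux _ _ this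

theorem good_of_fix {φ : PGL3 ≃* PGL3} (F : PFix2 φ) : Good φ := by
  obtain ⟨b, h | h⟩ := F.u
  · obtain ⟨κ, hκ⟩ := core F b h
    exact ⟨1, κ, Or.inl fun M => by rw [hκ]; simp⟩
  · have F' : PFix2 (φ.trans pctr) := by
      refine ⟨⟨?_, ?_⟩, ?_, ?_⟩
      · rw [MulEquiv.trans_apply, F.g, pctr_mk, ctr_dg]; simp
      · rw [MulEquiv.trans_apply, F.h, pctr_mk, ctr_dg]; simp
      · rw [MulEquiv.trans_apply, F.c, pctr_mk, ctr_cM]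
      · rw [MulEquiv.trans_apply, F.w, pctr_mk, ctr_wM]
    obtain ⟨κ, hκ⟩ := core F' (-b) (by rw [MulEquiv.trans_apply, h, pctr_mk, ctr_uM])
    refine ⟨1, κ, Or.inr fun M => ?_⟩
    have h1 := congrArg pctr (hκ M)
    rw [MulEquiv.trans_apply] at h1
    change pctrHom (pctrHom _) = _ at h1
    rw [pctrHom_invol] at h1
    rw [h1, pctr_mk, one_mul, inv_one, mul_one, map_inv]
    rfl

theorem klein_fix (φ : PGL3 ≃* PGL3) :
    ∃ p : GL (Fin 3) ℂ, PFix (φ.trans (MulAut.conj (pglMk p))) := by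
  have sq : ∀ a b c : ℂˣ, a * a = 1 → b * b = 1 → c * c = 1 →
      φ (pglMk (dg a b c)) * φ (pglMk (dg a b c)) = 1 := by
    intro a b c ha hb hc
    rw [← map_mul, ← map_mul, dg_mul, ha, hb, hc, dg_one, map_one, map_one]
  obtain ⟨g, hg, g2⟩ := sq_lift _ (sq 1 (-1) (-1) (by simp) (by simp) (by simp))
  obtain ⟨h, hh, h2⟩ := sq_lift _ (sq (-1) 1 (-1) (by simp) (by simp) (by simp))
  have comm : (g : M3) * h = h * g := by
    apply comm_lift g h h2
    rw [hg, hh, ← map_mul, ← map_mul, ← map_mul, ← map_mul, dg_mul, dg_mul]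
    simp
  have ns : ∀ (G : GL (Fin 3) ℂ) (a b c : ℂˣ), pglMk G = φ (pglMk (dg a b c)) → (a ≠ b ∨ b ≠ c) →
      ∀ r : ℂ, (G : M3) ≠ r • (1 : M3) := by
    intro G a b c hG hab r hr
    have h1 : pglMk G = pglMk 1 := (mk_eq _ _).2 ⟨r, by rw [hr, Units.val_one]⟩
    rw [hG, map_one, map_eq_one_iff φ φ.injective, ← map_one pglMk, mk_eq] at h1
    obtain ⟨s, hs⟩ := h1
    rw [dg_val, Units.val_one] at hs
    have q0 := congrFun (congrFun hs 0) 0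
    have q1 := congrFun (congrFun hs 1) 1
    have q2 := congrFun (congrFun hs 2) 2
    simp at q0 q1 q2
    rcases hab with h | h
    · exact h (Units.ext (q0.trans q1.symm))
    · exact h (Units.ext (q1.trans q2.symm))
  have n1 : (1 : ℂˣ) ≠ -1 := by
    intro h
    have := congrArg Units.val h
    norm_num at this
  obtain ⟨p, e, d, hp1, hp2⟩ := klein g h g2 h2 comm (ns g _ _ _ hg (Or.inl n1))
    (ns h _ _ _ hh (Or.inl n1.symm))
    (by
      rw [← Units.val_mul]
      refine ns (g * h) (-1) (-1) 1 ?_ (Or.inr n1.symm)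
      rw [map_mul, hg, hh, ← map_mul, ← map_mul, dg_mul]
      simp)
  refine ⟨p⁻¹, ?_, ?_⟩
  · simp only [MulEquiv.trans_apply, MulAut.conj_apply]
    rw [← hg, map_inv, inv_inv, mul_assoc, inv_mul_eq_iff_eq_mul, ← map_mul, ← map_mul, mk_eq]
    exact ⟨e, hp1⟩
  · simp only [MulEquiv.trans_apply, MulAut.conj_apply]
    rw [← hh, map_inv, inv_inv, mul_assoc, inv_mul_eq_iff_eq_mul, ← map_mul, ← map_mul, mk_eq]
    exact ⟨d, hp2⟩

/-- **Automorphisms of `PGL₃(ℂ)`.** Every group automorphism of `PGL₃(ℂ)` is the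
composition of an inner automorphism, the action of a field automorphism of `ℂ`,
and possibly the contragredient involution `u ↦ ᵗu⁻¹`. -/
theorem pgl3_automorphisms (φ : PGL3 ≃* PGL3) :
    ∃ (ψ : GL (Fin 3) ℂ) (κ : ℂ ≃+* ℂ),
      (∀ M : GL (Fin 3) ℂ, φ (pglMk M) = pglMk (ψ * glMapField κ M * ψ⁻¹)) ∨
      (∀ M : GL (Fin 3) ℂ, φ (pglMk M) = pglMk (ψ * glMapField κ (glTranspose M)⁻¹ * ψ⁻¹)) := by
  obtain ⟨p, F⟩ := klein_fix φ
  obtain ⟨q, F1, hc⟩ := F.c2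
  obtain ⟨r, F2, hc', hw⟩ := F1.w2 hc
  exact good_conj p (good_conj q (good_conj r (good_of_fix ⟨F2, hc', hw⟩)))
end
end
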